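/- Let f : D^I_{p,q} → D^I_{p',q'} be a proper holomorphic map with p, q ≥ 2 that maps every (p−1,q)-subspace of D^I_{p,q} into a (p'−1,q')-subspace of D^I_{p',q'}: for every (A,B) ∈ Ω_{p,q} there exists (C,D) ∈ Ω_{p',q'} such that C·f(Z) = D for all Z ∈ D^I_{p,q} with A·Z = B. Suppose moreover there is a dense open subset of Ω_{p,q} on each point (A,B) of which the pair (C,D) is unique up to a nonzero scalar multiple. Then f has a rational moduli map: there exist a tuple P = (P',P'') of homogeneous polynomials of a common degree in the p+q coordinates of ℂ^p×ℂ^q (P' with p' components, P'' with q' components, not all identically zero) and a dense open subset U ⊆ Ω_{p,q} such that for every (A,B) ∈ U: P(A,B) ≠ 0, (P'(A,B), P''(A,B)) ∈ Ω_{p',q'}, and P'(A,B)·f(Z) = P''(A,B) for every Z ∈ D^I_{p,q} with A·Z = B. If in addition q ≥ p' ≥ 3, then this moduli map is proper: for every (A,B) ≠ (0,0) with ‖A‖ = ‖B‖ and P(A,B) ≠ 0, one has ‖P'(A,B)‖ = ‖P''(A,B)‖. -/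

import Mathlib

open Matrix
open scoped ComplexOrder

attribute [local instance] Matrix.normedAddCommGroup Matrix.normedSpace

/-- The type-I irreducible bounded symmetric domain `D^I_{m,n}`,
realized as the set of complex `m × n` matrices `Z` with `I - Zᴴ Z` positive definite. -/
def typeIDomain (m n : ℕ) : Set (Matrix (Fin m) (Fin n) ℂ) :=
  {Z | (1 - Zᴴ * Z).PosDef}

/-- `f` maps `D` into `D'` and the `f`-preimage of every compact subset of `D'`
is a compact subset of `D`. -/
def ProperOn {E F : Type*} [TopologicalSpace E] [TopologicalSpace F]
    (f : E → F) (D : Set E) (D' : Set F) : Prop :=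
  Set.MapsTo f D D' ∧ ∀ K : Set F, K ⊆ D' → IsCompact K → IsCompact (D ∩ f ⁻¹' K)

/-- The affine cone over the generalized ball `D_{r,s} ⊂ ℙ^{r+s-1}`:
pairs of row vectors `(A,B)` with `‖A‖ > ‖B‖`. -/
def genBallCone (r s : ℕ) : Set ((Fin r → ℂ) × (Fin s → ℂ)) :=
  {x | ∑ j, ‖x.2 j‖ ^ 2 < ∑ i, ‖x.1 i‖ ^ 2}

section SCV
variable {E F : Type*} [NormedAddCommGroup E] [NormedSpace ℂ E] [NormedAddCommGroup F] [NormedSpace ℂ F] [CompleteSpace F]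

/-- Cauchy estimate for the Frechet derivative. -/
theorem scv_cauchy {f : E → F} {Y : E} {r M : ℝ} (hr : 0 < r)
    (hf : ∀ X ∈ Metric.ball Y r, DifferentiableAt ℂ f X) 
    (hM : ∀ X ∈ Metric.ball Y r, ‖f X‖ ≤ M) : ‖fderiv ℂ f Y‖ ≤ 2 * M / r := by
  have hM0 : 0 ≤ M := (norm_nonneg _).trans (hM Y (Metric.mem_ball_self hr))
  refine ContinuousLinearMap.opNorm_le_bound _ (by positivity) fun H => ?_
  by_cases hH : H = 0
  · simp [hH]
  have hH' : 0 < ‖H‖ := norm_pos_iff.2 hH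
  set ρ := r / (2 * ‖H‖) with hρ
  have hρ0 : 0 < ρ := by positivity
  have hmem : ∀ τ : ℂ, ‖τ‖ ≤ ρ → Y + τ • H ∈ Metric.ball Y r := by
    intro τ hτ
    rw [mem_ball_iff_norm, add_sub_cancel_left, norm_smul]
    calc ‖τ‖ * ‖H‖ ≤ ρ * ‖H‖ := by gcongr
      _ = r / 2 := by rw [hρ]; field_simp
      _ < r := by linarith
  have hder : ∀ τ : ℂ, ‖τ‖ ≤ ρ → HasDerivAt (fun τ : ℂ => f (Y + τ • H)) (fderiv ℂ f (Y + τ • H) H) τ := by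
    intro τ hτ
    have h1 : HasDerivAt (fun τ : ℂ => Y + τ • H) H τ := by
      simpa using ((hasDerivAt_id τ).smul_const H).const_add Y
    exact (hf _ (hmem τ hτ)).hasFDerivAt.comp_hasDerivAt τ h1
  have h0 := hder 0 (by simpa using hρ0.le)
  have h2 := Complex.norm_deriv_le_of_forall_mem_sphere_norm_le (c := 0) (R := ρ) (C := M) (f := fun τ : ℂ => f (Y + τ • H)) hρ0 ?_ ?_
  · rw [h0.deriv] at h2
    simp only [zero_smul, add_zero] at h2
    calc _ ≤ _ := h2
      _ = _ := by rw [hρ]; field_simp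
  · refine DifferentiableOn.diffContOnCl ?_
    rw [closure_ball _ hρ0.ne']
    intro τ hτ
    exact (hder τ (by simpa using hτ)).differentiableAt.differentiableWithinAt
  · intro z hz
    exact hM _ (hmem z (by simpa using (le_of_eq (mem_sphere_iff_norm.1 hz))))

theorem scv_bdd {f : E → F} {D : Set E} (hD : IsOpen D) (hf : DifferentiableOn ℂ f D) {Y : E} (hY : Y ∈ D) :
    ∃ r > 0, ∃ M, 0 ≤ M ∧ Metric.ball Y r ⊆ D ∧ (∀ X ∈ Metric.ball Y r, ‖f X‖ ≤ M) := by
  have hc : ContinuousAt f Y := (hf.differentiableAt (hD.mem_nhds hY)).continuousAt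
  have : ∀ᶠ X in nhds Y, ‖f X‖ < ‖f Y‖ + 1 := hc.norm.eventually_lt_const (by linarith)
  obtain ⟨r, hr, h⟩ := Metric.eventually_nhds_iff_ball.1 (this.and (hD.mem_nhds hY))
  exact ⟨r, hr, ‖f Y‖ + 1, by positivity, fun X hX => (h X hX).2, fun X hX => (h X hX).1.le⟩

theorem scv_bdd' {f : E → F} {D : Set E} (hD : IsOpen D) (hf : DifferentiableOn ℂ f D) {Y : E} (hY : Y ∈ D) :
    ∃ r > 0, ∃ M, 0 ≤ M ∧ Metric.ball Y r ⊆ D ∧ (∀ X ∈ Metric.ball Y r, ‖fderiv ℂ f X‖ ≤ M) := by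
  obtain ⟨r, hr, M, hM0, hs, hM⟩ := scv_bdd hD hf hY
  refine ⟨r / 2, by positivity, 2 * M / (r / 2), by positivity, (Metric.ball_subset_ball (by linarith)).trans hs, fun X hX => ?_⟩
  have : Metric.ball X (r / 2) ⊆ Metric.ball Y r := by
    refine Metric.ball_subset_ball' ?_
    have := Metric.mem_ball.1 hX
    linarith
  exact scv_cauchy (by positivity) (fun X' h => hf.differentiableAt (hD.mem_nhds (hs (this h)))) (fun X' h => hM _ (this h))

theorem scv_cont {f : E → F} {D : Set E} (hD : IsOpen D) (hf : DifferentiableOn ℂ f D) :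
    ContinuousOn (fderiv ℂ f) D := by
  refine fun Y hY => ContinuousAt.continuousWithinAt ?_
  obtain ⟨r, hr, M, hM0, hs, hM⟩ := scv_bdd' hD hf hY
  have hdiff : ∀ X ∈ Metric.ball Y r, DifferentiableAt ℂ f X := fun X hX => hf.differentiableAt (hD.mem_nhds (hs hX))
  have hL : ∀ X ∈ Metric.ball Y r, ∀ X' ∈ Metric.ball Y r, ‖f X' - f X‖ ≤ M * ‖X' - X‖ := by
    intro X hX X' hX'
    let _i : NormedSpace ℝ E := NormedSpace.restrictScalars ℝ ℂ E
    exact Convex.norm_image_sub_le_of_norm_fderiv_le (𝕜 := ℂ) hdiff hM (convex_ball Y r) hX hX'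
  have key : ∀ X ∈ Metric.ball Y (r / 2), ‖fderiv ℂ f X - fderiv ℂ f Y‖ ≤ 4 * M / r * ‖X - Y‖ := by
    intro X hX
    have hX2 : ‖X - Y‖ < r / 2 := mem_ball_iff_norm.1 hX
    have hsh : ∀ X' ∈ Metric.ball Y (r/2), X' + (X - Y) ∈ Metric.ball Y r := by
      intro X' hX'
      rw [mem_ball_iff_norm] at *
      calc ‖X' + (X - Y) - Y‖ = ‖(X' - Y) + (X - Y)‖ := by congr 1; abel
        _ ≤ ‖X' - Y‖ + ‖X - Y‖ := norm_add_le _ _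
        _ < r := by linarith
    have hin : ∀ X' ∈ Metric.ball Y (r/2), X' ∈ Metric.ball Y r := fun X' h => Metric.ball_subset_ball (by linarith) h
    have hd1 : ∀ X' ∈ Metric.ball Y (r/2), HasFDerivAt (fun X' => f (X' + (X - Y)) - f X')
        (fderiv ℂ f (X' + (X - Y)) - fderiv ℂ f X') X' := by
      intro X' hX'
      refine HasFDerivAt.sub ?_ (hdiff _ (hin _ hX')).hasFDerivAt
      exact (hasFDerivAt_comp_add_right (X - Y)).2 (hdiff _ (hsh _ hX')).hasFDerivAt
    have := scv_cauchy (f := fun X' => f (X' + (X - Y)) - f X') (Y := Y) (r := r / 2) (M := M * ‖X - Y‖)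
      (by positivity) (fun X' h => (hd1 X' h).differentiableAt) (fun X' h => by
        have := hL _ (hin _ h) _ (hsh _ h)
        rwa [add_sub_cancel_left] at this)
    rw [(hd1 Y (Metric.mem_ball_self (by positivity))).fderiv] at this
    rw [add_sub_cancel] at this
    calc _ ≤ _ := this
      _ = _ := by field_simp; ring
  rw [ContinuousAt, tendsto_iff_norm_sub_tendsto_zero]
  refine squeeze_zero' (Filter.Eventually.of_forall fun _ => norm_nonneg _)
    (Filter.eventually_of_mem (Metric.ball_mem_nhds Y (by positivity : 0 < r / 2)) key) ?_
  have : Filter.Tendsto (fun X => 4 * M / r * ‖X - Y‖) (nhds Y) (nhds (4 * M / r * ‖Y - Y‖)) :=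
    Continuous.tendsto (by fun_prop) Y
  simpa using this

/-- directional derivative -/
noncomputable def dd (H : E) (u : E → F) : E → F := fun Z => fderiv ℂ u Z H

theorem dd_diff {u : E → F} {D : Set E} (hD : IsOpen D) (hu : DifferentiableOn ℂ u D) (H : E) :
    DifferentiableOn ℂ (dd H u) D := by
  intro Y hY
  refine DifferentiableAt.differentiableWithinAt ?_
  obtain ⟨r, hr, M, hM0, hs, hM⟩ := scv_bdd' hD hu hY
  have hdiff : ∀ X ∈ Metric.ball Y r, DifferentiableAt ℂ u X := fun X hX => hu.differentiableAt (hD.mem_nhds (hs hX))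
  set ρ := r / (2 * (‖H‖ + 1)) with hρ
  have hρ0 : 0 < ρ := by positivity
  have hmem : ∀ X ∈ Metric.ball Y (r/2), ∀ τ : ℂ, ‖τ‖ ≤ ρ → X + τ • H ∈ Metric.ball Y r := by
    intro X hX τ hτ
    rw [mem_ball_iff_norm] at *
    calc ‖X + τ • H - Y‖ = ‖(X - Y) + τ • H‖ := by congr 1; abel
      _ ≤ ‖X - Y‖ + ‖τ‖ * ‖H‖ := by rw [← norm_smul]; exact norm_add_le _ _
      _ ≤ ‖X - Y‖ + ρ * (‖H‖ + 1) := by gcongr; linarith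
      _ = ‖X - Y‖ + r / 2 := by rw [hρ]; field_simp
      _ < r := by linarith
  have hder : ∀ X ∈ Metric.ball Y (r/2), ∀ τ : ℂ, ‖τ‖ ≤ ρ → HasDerivAt (fun τ : ℂ => u (X + τ • H)) (fderiv ℂ u (X + τ • H) H) τ := by
    intro X hX τ hτ
    have h1 : HasDerivAt (fun τ : ℂ => X + τ • H) H τ := by
      simpa using ((hasDerivAt_id τ).smul_const H).const_add X
    exact (hdiff _ (hmem X hX τ hτ)).hasFDerivAt.comp_hasDerivAt τ h1
  -- integral formula
  let G : E → ℝ → F := fun X θ => deriv (circleMap 0 ρ) θ • ((1 / (circleMap 0 ρ θ - 0) ^ 2) • u (X + circleMap 0 ρ θ • H))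
  let G' : E → ℝ → (E →L[ℂ] F) := fun X θ => deriv (circleMap 0 ρ) θ • ((1 / (circleMap 0 ρ θ - 0) ^ 2) • fderiv ℂ u (X + circleMap 0 ρ θ • H))
  have hcm : ∀ θ, ‖circleMap 0 ρ θ‖ ≤ ρ := fun θ => by simp [abs_of_pos hρ0]
  have hcm0 : ∀ θ, circleMap 0 ρ θ ≠ 0 := fun θ => by
    exact circleMap_ne_center (c := 0) hρ0.ne'
  have hform : ∀ X ∈ Metric.ball Y (r/2), (2 * Real.pi * Complex.I : ℂ) • dd H u X = ∫ θ in (0:ℝ)..2 * Real.pi, G X θ := by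
    intro X hX
    have := DifferentiableOn.deriv_eq_smul_circleIntegral (c := 0) (R := ρ) (f := fun τ : ℂ => u (X + τ • H)) hρ0 
      (fun τ hτ => (hder X hX τ (by simpa using hτ)).differentiableAt.differentiableWithinAt)
    rw [(hder X hX 0 (by simpa using hρ0.le)).deriv] at this
    simp only [zero_smul, add_zero] at this
    rw [dd, ← this]
    rfl
  have hcontc : Continuous (circleMap 0 ρ) := continuous_circleMap 0 ρ
  have hcontk : Continuous fun θ => deriv (circleMap 0 ρ) θ • ((1 / (circleMap 0 ρ θ - 0) ^ 2)) := by
    simp only [deriv_circleMap, sub_zero]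
    exact (hcontc.mul continuous_const).smul (Continuous.div continuous_const (hcontc.pow 2) fun θ => pow_ne_zero _ (hcm0 θ))
  have hcontG : ∀ X ∈ Metric.ball Y (r/2), Continuous (G X) := by
    intro X hX
    simp only [G, ← smul_assoc]
    refine hcontk.smul ?_
    refine continuous_iff_continuousAt.2 fun θ => ?_
    exact ContinuousAt.comp (g := u) (hdiff _ (hmem X hX _ (hcm θ))).continuousAt (by fun_prop)
  have hcontG' : Continuous (G' Y) := by
    simp only [G', ← smul_assoc]
    refine hcontk.smul ?_
    refine continuous_iff_continuousAt.2 fun θ => ?_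
    have hc := (scv_cont hD hu).continuousAt (hD.mem_nhds (hs (hmem Y (Metric.mem_ball_self (by positivity)) _ (hcm θ))))
    exact ContinuousAt.comp (g := fderiv ℂ u) hc (by fun_prop)
  have hmain := intervalIntegral.hasFDerivAt_integral_of_dominated_of_fderiv_le (𝕜 := ℂ) (F := G) (F' := G') (x₀ := Y) (a := 0) (b := 2 * Real.pi) (μ := MeasureTheory.volume)
    (s := Metric.ball Y (r / 2)) (bound := fun θ => ‖deriv (circleMap 0 ρ) θ • ((1 / (circleMap 0 ρ θ - 0) ^ 2))‖ * M)
    (Metric.ball_mem_nhds Y (by positivity))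
    (Filter.eventually_of_mem (Metric.ball_mem_nhds Y (by positivity : 0 < r / 2)) fun X hX => (hcontG X hX).aestronglyMeasurable)
    ((hcontG Y (Metric.mem_ball_self (by positivity))).intervalIntegrable _ _)
    hcontG'.aestronglyMeasurable
    (Filter.Eventually.of_forall fun θ _ X hX => by
      simp only [G', ← smul_assoc]
      rw [norm_smul]
      gcongr
      exact hM _ (hmem X hX _ (hcm θ)))
    ((hcontk.norm.mul continuous_const).intervalIntegrable _ _)
    (Filter.Eventually.of_forall fun θ _ X hX => by
      refine HasFDerivAt.const_smul (HasFDerivAt.const_smul ?_ _) _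
      exact (hasFDerivAt_comp_add_right _).2 (hdiff _ (hmem X hX _ (hcm θ))).hasFDerivAt)
  have h3 : DifferentiableAt ℂ (fun X => (2 * Real.pi * Complex.I : ℂ)⁻¹ • ∫ θ in (0:ℝ)..2 * Real.pi, G X θ) Y :=
    hmain.differentiableAt.const_smul _
  refine h3.congr_of_eventuallyEq ?_
  filter_upwards [Metric.ball_mem_nhds Y (by positivity : 0 < r / 2)] with X hX
  rw [← hform X hX, smul_smul, inv_mul_cancel₀, one_smul]
  simp [Real.pi_ne_zero]
end SCV

section SCV2
variable {E F : Type*} [NormedAddCommGroup E] [NormedSpace ℂ E] [NormedAddCommGroup F] [NormedSpace ℂ F] [CompleteSpace F]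

theorem dd_iter_diff {u : E → F} {D : Set E} (hD : IsOpen D) (hu : DifferentiableOn ℂ u D) (H : E) (k : ℕ) :
    DifferentiableOn ℂ ((dd H)^[k] u) D := by
  induction k with
  | zero => simpa using hu
  | succ k ih => rw [Function.iterate_succ_apply']; exact dd_diff hD ih H

theorem slice_hasDerivAt {u : E → F} {D : Set E} (hD : IsOpen D) (hu : DifferentiableOn ℂ u D) (Z H : E) (τ : ℂ)
    (h : Z + τ • H ∈ D) : HasDerivAt (fun τ : ℂ => u (Z + τ • H)) (dd H u (Z + τ • H)) τ := by
  have h1 : HasDerivAt (fun τ : ℂ => Z + τ • H) H τ := by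
    simpa using ((hasDerivAt_id τ).smul_const H).const_add Z
  exact (hu.differentiableAt (hD.mem_nhds h)).hasFDerivAt.comp_hasDerivAt τ h1

theorem slice_open {D : Set E} (hD : IsOpen D) (Z H : E) : IsOpen {τ : ℂ | Z + τ • H ∈ D} :=
  hD.preimage (by fun_prop)

theorem slice_preconn {D : Set E} (Z H : E) (hZ : Z ∈ D)
    (hst : ∀ X ∈ D, ∀ t : ℝ, 0 ≤ t → t ≤ 1 → Z + (t : ℂ) • (X - Z) ∈ D) :
    IsPreconnected {τ : ℂ | Z + τ • H ∈ D} := by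
  have : StarConvex ℝ (0:ℂ) {τ : ℂ | Z + τ • H ∈ D} := by
    rw [starConvex_zero_iff]
    intro τ hτ t ht0 ht1
    have := hst _ hτ t ht0 ht1
    rw [add_sub_cancel_left, smul_smul] at this
    simpa using this
  exact (this.isPathConnected (by simpa using hZ)).isConnected.isPreconnected

theorem slice_iter {u : E → F} {D : Set E} (hD : IsOpen D) (hu : DifferentiableOn ℂ u D) (L : F →L[ℂ] ℂ) (Z H : E) (k : ℕ) :
    ∀ τ : ℂ, Z + τ • H ∈ D → iteratedDeriv k (fun τ : ℂ => L (u (Z + τ • H))) τ = L ((dd H)^[k] u (Z + τ • H)) := by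
  induction k with
  | zero => intro τ _; simp
  | succ k ih =>
    intro τ hτ
    rw [iteratedDeriv_succ, Function.iterate_succ_apply']
    have : iteratedDeriv k (fun τ : ℂ => L (u (Z + τ • H))) =ᶠ[nhds τ] fun τ => L ((dd H)^[k] u (Z + τ • H)) :=
      Filter.eventually_of_mem ((slice_open hD Z H).mem_nhds hτ) ih
    rw [this.deriv_eq]
    exact (L.hasFDerivAt.comp_hasDerivAt τ (slice_hasDerivAt hD (dd_iter_diff hD hu H k) Z H τ hτ)).deriv

theorem slice_diff {u : E → F} {D : Set E} (hD : IsOpen D) (hu : DifferentiableOn ℂ u D) (L : F →L[ℂ] ℂ) (Z H : E) :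
    DifferentiableOn ℂ (fun τ : ℂ => L (u (Z + τ • H))) {τ : ℂ | Z + τ • H ∈ D} := fun τ hτ =>
  (L.hasFDerivAt.comp_hasDerivAt τ (slice_hasDerivAt hD hu Z H τ hτ)).differentiableAt.differentiableWithinAt

theorem taylor_to {u : E → F} {D : Set E} (hD : IsOpen D) (hu : DifferentiableOn ℂ u D) (L : F →L[ℂ] ℂ) (Z H : E) (hZ : Z ∈ D)
    (hst : ∀ X ∈ D, ∀ t : ℝ, 0 ≤ t → t ≤ 1 → Z + (t : ℂ) • (X - Z) ∈ D)
    (h : ∀ k, 1 ≤ k → L ((dd H)^[k] u Z) = 0) (τ : ℂ) (hτ : Z + τ • H ∈ D) : L (u (Z + τ • H)) = L (u Z) := by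
  have hop := slice_open hD Z H
  have h0 : (0:ℂ) ∈ {τ : ℂ | Z + τ • H ∈ D} := by simpa using hZ
  have hdiff := slice_diff hD hu L Z H
  have han := hdiff.analyticOnNhd hop
  obtain ⟨r, hr, hb⟩ := Metric.isOpen_iff.1 hop 0 h0
  have hev : (fun τ : ℂ => L (u (Z + τ • H))) =ᶠ[nhds 0] fun _ => L (u Z) := by
    filter_upwards [Metric.ball_mem_nhds (0:ℂ) hr] with z hz
    have hs := Complex.hasSum_taylorSeries_on_ball (hdiff.mono hb) hz
    have hs2 := hasSum_single (f := fun n : ℕ => ((n.factorial : ℂ)⁻¹) • (z - 0) ^ n • iteratedDeriv n (fun τ : ℂ => L (u (Z + τ • H))) 0) 0 (by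
      intro n hn
      rw [slice_iter hD hu L Z H n 0 (by simpa using hZ)]
      simp [h n (Nat.one_le_iff_ne_zero.2 hn)])
    have := hs.unique hs2
    simpa using this
  exact han.eqOn_of_preconnected_of_eventuallyEq analyticOnNhd_const (slice_preconn Z H hZ hst) h0 hev hτ

theorem taylor_from {u : E → F} {D : Set E} (hD : IsOpen D) (hu : DifferentiableOn ℂ u D) (L : F →L[ℂ] ℂ) (Z H : E) (hZ : Z ∈ D)
    (h : ∀ᶠ τ : ℂ in nhds 0, L (u (Z + τ • H)) = L (u Z)) (k : ℕ) (hk : 1 ≤ k) : L ((dd H)^[k] u Z) = 0 := by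
  have h1 := slice_iter hD hu L Z H k 0 (by simpa using hZ)
  have h2 : (fun τ : ℂ => L (u (Z + τ • H))) =ᶠ[nhds 0] fun _ => L (u Z) := h
  rw [h2.iteratedDeriv_eq, iteratedDeriv_const] at h1
  simp only [zero_smul, add_zero] at h1
  rw [← h1, if_neg (by omega)]

theorem ident_star {u : E → ℂ} {D : Set E} (hD : IsOpen D) (hu : DifferentiableOn ℂ u D) (Z : E) (hZ : Z ∈ D)
    (hst : ∀ X ∈ D, ∀ t : ℝ, 0 ≤ t → t ≤ 1 → Z + (t : ℂ) • (X - Z) ∈ D)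
    (h : ∀ᶠ X in nhds Z, u X = 0) : ∀ X ∈ D, u X = 0 := by
  intro X hX
  have hdiff := slice_diff hD hu (ContinuousLinearMap.id ℂ ℂ) Z (X - Z)
  have han := hdiff.analyticOnNhd (slice_open hD Z (X - Z))
  have h0 : (0:ℂ) ∈ {τ : ℂ | Z + τ • (X - Z) ∈ D} := by simpa using hZ
  have hev : (fun τ : ℂ => ContinuousLinearMap.id ℂ ℂ (u (Z + τ • (X - Z)))) =ᶠ[nhds 0] fun _ => 0 := by
    have : Filter.Tendsto (fun τ : ℂ => Z + τ • (X - Z)) (nhds 0) (nhds Z) := by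
      have h : Continuous (fun τ : ℂ => Z + τ • (X - Z)) := by fun_prop
      simpa using h.tendsto 0
    exact this.eventually h
  have := han.eqOn_of_preconnected_of_eventuallyEq analyticOnNhd_const (slice_preconn Z (X - Z) hZ hst) h0 hev
    (show (1:ℂ) ∈ _ by simpa using hX)
  simpa using this

theorem dd_congr {u v : E → F} {D : Set E} (hD : IsOpen D) (h : ∀ Z ∈ D, u Z = v Z) (H : E) : ∀ Z ∈ D, dd H u Z = dd H v Z := by
  intro Z hZ
  have : u =ᶠ[nhds Z] v := Filter.eventually_of_mem (hD.mem_nhds hZ) h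
  simp only [dd, this.fderiv_eq]

theorem dd_poly {u : E → F} {D : Set E} (hD : IsOpen D) (hu : DifferentiableOn ℂ u D) (H0 H1 : E) (k : ℕ) :
    ∃ g : ℕ → E → F, (∀ j, DifferentiableOn ℂ (g j) D) ∧ ∀ t : ℂ, ∀ Z ∈ D,
      (dd (H0 + t • H1))^[k] u Z = ∑ j ∈ Finset.range (k+1), t ^ j • g j Z := by
  induction k with
  | zero => exact ⟨fun _ => u, fun _ => hu, by simp⟩
  | succ k ih =>
    obtain ⟨g, hg, hs⟩ := ih
    refine ⟨fun j => dd H0 (if j < k + 1 then g j else 0) + (match j with | 0 => 0 | i + 1 => dd H1 (g i)), ?_, ?_⟩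
    · intro j
      refine DifferentiableOn.add (dd_diff hD ?_ _) ?_
      · split_ifs
        · exact hg j
        · exact differentiableOn_const 0
      · cases j with
        | zero => exact differentiableOn_const 0
        | succ i => exact dd_diff hD (hg i) _
    · intro t Z hZ
      rw [Function.iterate_succ_apply', dd_congr hD (hs t) _ Z hZ]
      have e1 : dd (H0 + t • H1) (fun Z => ∑ j ∈ Finset.range (k+1), t ^ j • g j Z) Z
          = ∑ j ∈ Finset.range (k+1), t ^ j • (dd H0 (g j) Z + t • dd H1 (g j) Z) := by
        have : HasFDerivAt (fun Z => ∑ j ∈ Finset.range (k+1), t ^ j • g j Z) (∑ j ∈ Finset.range (k+1), t ^ j • fderiv ℂ (g j) Z) Z :=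
          HasFDerivAt.fun_sum fun j _ => ((hg j).differentiableAt (hD.mem_nhds hZ)).hasFDerivAt.const_smul _
        simp only [dd, this.fderiv, map_add, map_smul, ContinuousLinearMap.sum_apply, ContinuousLinearMap.smul_apply, Finset.smul_sum, smul_add, Finset.sum_add_distrib]
        simp only [smul_comm t]
      rw [e1]
      simp only [Pi.add_apply, smul_add, Finset.sum_add_distrib]
      have z0 : dd H0 (0 : E → F) Z = 0 := by simp [dd]
      congr 1
      · rw [Finset.sum_range_succ _ (k+1)]
        rw [if_neg (lt_irrefl _), z0, smul_zero, add_zero]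
        refine Finset.sum_congr rfl fun j hj => ?_
        rw [if_pos (Finset.mem_range.1 hj)]
      · rw [Finset.sum_range_succ' _ (k+1)]
        simp [pow_succ, smul_smul]

theorem dd_poly_pi {n : ℕ} {u : E → (Fin n → ℂ)} {D : Set E} (hD : IsOpen D) (hu : DifferentiableOn ℂ u D) (H0 H1 : E) (k : ℕ) {Z : E} (hZ : Z ∈ D) :
    ∃ Φ : Fin n → Polynomial ℂ, ∀ t : ℂ, ∀ i, ((dd (H0 + t • H1))^[k] u Z) i = (Φ i).eval t := by
  obtain ⟨g, hg, hs⟩ := dd_poly hD hu H0 H1 k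
  refine ⟨fun i => ∑ j ∈ Finset.range (k+1), Polynomial.C (g j Z i) * Polynomial.X ^ j, fun t i => ?_⟩
  rw [hs t Z hZ]
  simp only [Polynomial.eval_finset_sum, Finset.sum_apply, Polynomial.eval_mul, Polynomial.eval_C, Polynomial.eval_pow, Polynomial.eval_X, Pi.smul_apply, smul_eq_mul]
  exact Finset.sum_congr rfl fun j _ => mul_comm _ _
end SCV2

/-- squared euclidean norm -/
noncomputable def nsq {n : ℕ} (v : Fin n → ℂ) : ℝ := ∑ i, ‖v i‖ ^ 2

theorem nsq_nonneg {n : ℕ} (v : Fin n → ℂ) : 0 ≤ nsq v := Finset.sum_nonneg fun _ _ => by positivity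

theorem nsq_eq_zero {n : ℕ} {v : Fin n → ℂ} : nsq v = 0 ↔ v = 0 := by
  rw [nsq, Finset.sum_eq_zero_iff_of_nonneg (fun _ _ => by positivity)]
  constructor
  · intro h; ext i; simpa using h i (Finset.mem_univ i)
  · rintro rfl; simp

theorem nsq_pos {n : ℕ} {v : Fin n → ℂ} (h : v ≠ 0) : 0 < nsq v :=
  lt_of_le_of_ne (nsq_nonneg v) fun h' => h (nsq_eq_zero.1 h'.symm)

@[simp] theorem nsq_zero {n : ℕ} : nsq (0 : Fin n → ℂ) = 0 := nsq_eq_zero.2 rfl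

theorem nsq_smul {n : ℕ} (c : ℂ) (v : Fin n → ℂ) : nsq (c • v) = ‖c‖ ^ 2 * nsq v := by
  simp [nsq, mul_pow, Finset.mul_sum]

theorem nsq_star {n : ℕ} (v : Fin n → ℂ) : nsq (star v) = nsq v := by simp [nsq]

theorem nsq_eq_dot {n : ℕ} (v : Fin n → ℂ) : ((nsq v : ℝ) : ℂ) = v ⬝ᵥ star v := by
  simp only [nsq, dotProduct, Pi.star_apply, RCLike.star_def, Complex.mul_conj, Complex.normSq_eq_norm_sq]
  push_cast; rfl

theorem nsq_continuous {n : ℕ} : Continuous (nsq : (Fin n → ℂ) → ℝ) := by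
  unfold nsq; fun_prop

theorem nsq_cs {n : ℕ} (a b : Fin n → ℂ) : ‖a ⬝ᵥ b‖ ^ 2 ≤ nsq a * nsq b := by
  have h1 : ‖a ⬝ᵥ b‖ ≤ ∑ i, ‖a i‖ * ‖b i‖ := by
    refine (norm_sum_le _ _).trans (le_of_eq ?_)
    simp
  calc ‖a ⬝ᵥ b‖ ^ 2 ≤ (∑ i, ‖a i‖ * ‖b i‖) ^ 2 := by gcongr
    _ ≤ _ := Finset.sum_mul_sq_le_sq_mul_sq _ _ _

theorem nsq_le_one_of {n : ℕ} (v : Fin n → ℂ) (i : Fin n) : ‖v i‖ ^ 2 ≤ nsq v :=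
  Finset.single_le_sum (f := fun i => ‖v i‖ ^ 2) (fun _ _ => by positivity) (Finset.mem_univ i)

theorem nsq_convex {n : ℕ} (a b : Fin n → ℂ) (t : ℝ) (h0 : 0 ≤ t) (h1 : t ≤ 1) :
    nsq (a + (t : ℂ) • (b - a)) ≤ (1 - t) * nsq a + t * nsq b := by
  simp only [nsq, Finset.mul_sum, ← Finset.sum_add_distrib]
  refine Finset.sum_le_sum fun i _ => ?_
  have : ‖(a + (t : ℂ) • (b - a)) i‖ ≤ (1 - t) * ‖a i‖ + t * ‖b i‖ := by
    have e : (a + (t : ℂ) • (b - a)) i = ((1 - t : ℝ) : ℂ) * a i + (t : ℂ) * b i := by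
      simp; ring
    rw [e]
    refine (norm_add_le _ _).trans (le_of_eq ?_)
    rw [norm_mul, norm_mul, Complex.norm_real, Complex.norm_real, Real.norm_of_nonneg h0, Real.norm_of_nonneg (by linarith)]
  calc _ ≤ ((1 - t) * ‖a i‖ + t * ‖b i‖) ^ 2 := by gcongr
    _ ≤ _ := by nlinarith [mul_nonneg (mul_nonneg h0 (sub_nonneg.2 h1)) (sq_nonneg (‖a i‖ - ‖b i‖))]

theorem mem_dom_iff {m n : ℕ} (Z : Matrix (Fin m) (Fin n) ℂ) :
    Z ∈ typeIDomain m n ↔ ∀ v : Fin n → ℂ, v ≠ 0 → nsq (Z *ᵥ v) < nsq v := by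
  have key : ∀ v : Fin n → ℂ, star v ⬝ᵥ ((1 - Zᴴ * Z) *ᵥ v) = ((nsq v - nsq (Z *ᵥ v) : ℝ) : ℂ) := by
    intro v
    rw [Matrix.sub_mulVec, dotProduct_sub, one_mulVec, Complex.ofReal_sub, nsq_eq_dot, nsq_eq_dot, ← mulVec_mulVec,
      dotProduct_mulVec, ← star_mulVec, dotProduct_comm, dotProduct_comm (star (Z *ᵥ v))]
  rw [typeIDomain, Set.mem_setOf_eq, Matrix.posDef_iff_dotProduct_mulVec]
  constructor
  · rintro ⟨_, h⟩ v hv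
    have := h hv
    rw [key] at this
    have := Complex.zero_lt_real.1 this
    linarith
  · intro h
    refine ⟨?_, fun v hv => ?_⟩
    · rw [Matrix.IsHermitian, conjTranspose_sub, conjTranspose_mul, conjTranspose_conjTranspose, conjTranspose_one]
    · rw [key]
      exact Complex.zero_lt_real.2 (by linarith [h v hv])

theorem contr_dual {m n : ℕ} (Z : Matrix (Fin m) (Fin n) ℂ) (h : ∀ v : Fin n → ℂ, v ≠ 0 → nsq (Z *ᵥ v) < nsq v)
    (a : Fin m → ℂ) (ha : a ≠ 0) : nsq (a ᵥ* Z) < nsq a := by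
  by_cases h0 : a ᵥ* Z = 0
  · rw [h0, nsq_zero]; exact nsq_pos ha
  have h1 := h (star (a ᵥ* Z)) (by simpa using h0)
  rw [nsq_star] at h1
  have h2 := nsq_cs a (Z *ᵥ star (a ᵥ* Z))
  rw [dotProduct_mulVec, ← nsq_eq_dot, Complex.norm_real, Real.norm_of_nonneg (nsq_nonneg _)] at h2
  have h3 := nsq_pos h0
  have h4 := nsq_pos ha
  nlinarith

theorem mem_dom_iff' {m n : ℕ} (Z : Matrix (Fin m) (Fin n) ℂ) :
    Z ∈ typeIDomain m n ↔ ∀ a : Fin m → ℂ, a ≠ 0 → nsq (a ᵥ* Z) < nsq a := by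
  rw [mem_dom_iff]
  refine ⟨contr_dual Z, fun h => ?_⟩
  have := contr_dual Zᵀ (by simpa [mulVec_transpose] using h)
  simpa [vecMul_transpose] using this

theorem zero_mem_dom (m n : ℕ) : (0 : Matrix (Fin m) (Fin n) ℂ) ∈ typeIDomain m n := by
  rw [mem_dom_iff]; intro v hv; simpa using nsq_pos hv

theorem dom_convex {m n : ℕ} {Z Z' : Matrix (Fin m) (Fin n) ℂ} (hZ : Z ∈ typeIDomain m n) (hZ' : Z' ∈ typeIDomain m n)
    (t : ℝ) (h0 : 0 ≤ t) (h1 : t ≤ 1) : Z + (t : ℂ) • (Z' - Z) ∈ typeIDomain m n := by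
  rw [mem_dom_iff] at *
  intro v hv
  rw [add_mulVec, smul_mulVec, sub_mulVec]
  have h2 := nsq_convex (Z *ᵥ v) (Z' *ᵥ v) t h0 h1
  have h3 := hZ v hv
  have h4 := hZ' v hv
  rcases eq_or_lt_of_le h0 with h | h
  · subst h; simpa using h3
  · nlinarith

theorem dom_entry {m n : ℕ} {Z : Matrix (Fin m) (Fin n) ℂ} (hZ : Z ∈ typeIDomain m n) (i : Fin m) (j : Fin n) : ‖Z i j‖ ≤ 1 := by
  rw [mem_dom_iff] at hZ
  have h := hZ (Pi.single j 1) (by simp)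
  have h1 := nsq_le_one_of (Z *ᵥ Pi.single j 1) i
  have h2 : nsq (Pi.single j 1 : Fin n → ℂ) = 1 := by
    simp [nsq, Pi.single_apply, apply_ite]
  rw [h2] at h
  simp only [mulVec_single_one, col_apply] at h1
  have h3 : ‖Z i j‖ ^ 2 < 1 := by
    refine lt_of_le_of_lt h1 ?_
    simpa [mulVec_single_one] using h
  nlinarith [norm_nonneg (Z i j)]

theorem dom_norm {m n : ℕ} {Z : Matrix (Fin m) (Fin n) ℂ} (hZ : Z ∈ typeIDomain m n) : ‖Z‖ ≤ 1 := 
  (Matrix.norm_le_iff zero_le_one).2 fun i j => dom_entry hZ i j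

theorem dom_open (m n : ℕ) : IsOpen (typeIDomain m n) := by
  have hK : IsCompact {v : Fin n → ℂ | nsq v = 1} := by
    refine Metric.isCompact_of_isClosed_isBounded (isClosed_eq nsq_continuous continuous_const) ?_
    refine (Metric.isBounded_closedBall (x := (0 : Fin n → ℂ)) (r := 1)).subset fun v hv => ?_
    rw [mem_closedBall_zero_iff, pi_norm_le_iff_of_nonneg zero_le_one]
    intro i
    have := nsq_le_one_of v i
    rw [show nsq v = 1 from hv] at this
    nlinarith [norm_nonneg (v i)]
  have e : typeIDomain m n = {Z | ∀ v ∈ {v : Fin n → ℂ | nsq v = 1}, nsq (Z *ᵥ v) < nsq v} := by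
    ext Z
    rw [mem_dom_iff]
    constructor
    · intro h v hv
      exact h v (by rintro rfl; simp at hv)
    · intro h v hv
      have hp := nsq_pos hv
      set c : ℂ := (((Real.sqrt (nsq v))⁻¹ : ℝ) : ℂ) with hc
      have hcn : ‖c‖ ^ 2 * nsq v = 1 := by
        rw [hc, Complex.norm_real, norm_inv, inv_pow, Real.norm_of_nonneg (Real.sqrt_nonneg _), Real.sq_sqrt hp.le, inv_mul_cancel₀ hp.ne']
      have := h (c • v) (by simp [nsq_smul, hcn])
      rw [mulVec_smul, nsq_smul, nsq_smul] at this
      have hcp : 0 < ‖c‖ ^ 2 := by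
        by_contra hh
        have : ‖c‖ ^ 2 = 0 := le_antisymm (not_lt.1 hh) (by positivity)
        rw [this] at hcn; simp at hcn
      exact lt_of_mul_lt_mul_left this hcp.le
  rw [e, isOpen_iff_mem_nhds]
  intro Z hZ
  refine hK.eventually_forall_of_forall_eventually (P := fun Z v => nsq (Z *ᵥ v) < nsq v) fun v hv => ?_
  have : IsOpen {x : Matrix (Fin m) (Fin n) ℂ × (Fin n → ℂ) | nsq (x.1 *ᵥ x.2) < nsq x.2} := by
    refine isOpen_lt (nsq_continuous.comp ?_) (nsq_continuous.comp continuous_snd)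
    exact Continuous.matrix_mulVec continuous_fst continuous_snd
  exact this.mem_nhds (hZ v hv)

theorem fiber_nonempty {m n : ℕ} (A : Fin m → ℂ) (B : Fin n → ℂ) (h : nsq B < nsq A) :
    ∃ Z ∈ typeIDomain m n, A ᵥ* Z = B := by
  have hA : 0 < nsq A := (nsq_nonneg B).trans_lt h
  have hA' : ((nsq A : ℝ) : ℂ) ≠ 0 := by exact_mod_cast hA.ne'
  refine ⟨((nsq A : ℝ) : ℂ)⁻¹ • vecMulVec (star A) B, ?_, ?_⟩
  · rw [mem_dom_iff]
    intro v hv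
    have : (((nsq A : ℝ) : ℂ)⁻¹ • vecMulVec (star A) B) *ᵥ v = (((nsq A : ℝ) : ℂ)⁻¹ * (B ⬝ᵥ v)) • star A := by
      rw [smul_mulVec, vecMulVec_mulVec, mul_smul]
      simp
    rw [this, nsq_smul, nsq_star, norm_mul, norm_inv, Complex.norm_real, Real.norm_of_nonneg hA.le, mul_pow]
    have h2 := nsq_cs B v
    have h3 := nsq_pos hv
    calc (nsq A)⁻¹ ^ 2 * ‖B ⬝ᵥ v‖ ^ 2 * nsq A = ‖B ⬝ᵥ v‖ ^ 2 / nsq A := by field_simp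
      _ ≤ nsq B * nsq v / nsq A := by gcongr
      _ < nsq v := by rw [div_lt_iff₀ hA]; nlinarith
  · rw [vecMul_smul, vecMul_vecMulVec, ← nsq_eq_dot, smul_smul, inv_mul_cancel₀ hA', one_smul]

theorem infinite_ball_c (c : ℂ) {r : ℝ} (hr : 0 < r) : (Metric.ball c r).Infinite :=
  infinite_of_mem_nhds c (Metric.ball_mem_nhds c hr)

theorem mvpoly_open {n : ℕ} {S : Set (Fin n → ℂ)} (hS : IsOpen S) (hne : S.Nonempty) (P : MvPolynomial (Fin n) ℂ)
    (h : ∀ w ∈ S, MvPolynomial.eval w P = 0) : P = 0 := by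
  obtain ⟨w0, hw0⟩ := hne
  obtain ⟨r, hr, hb⟩ := Metric.isOpen_iff.1 hS w0 hw0
  refine MvPolynomial.funext_set (fun i => Metric.ball (w0 i) r) (fun i => infinite_ball_c _ hr) fun x hx => ?_
  rw [map_zero]
  refine h x (hb ?_)
  rw [Metric.mem_ball, dist_pi_lt_iff hr]
  exact fun i => hx i (Set.mem_univ i)

theorem mvpoly_cont {n : ℕ} (P : MvPolynomial (Fin n) ℂ) : Continuous fun w : Fin n → ℂ => MvPolynomial.eval w P :=
  MvPolynomial.continuous_eval P

/-- the polynomial with given coefficients -/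
noncomputable def pc {R : Type*} [CommRing R] {m : ℕ} (c : Fin (m+1) → R) : Polynomial R :=
  ∑ j, Polynomial.C (c j) * Polynomial.X ^ (j : ℕ)

theorem pc_eval {R : Type*} [CommRing R] {m : ℕ} (c : Fin (m+1) → R) (t : R) : (pc c).eval t = ∑ j, c j * t ^ (j : ℕ) := by
  simp [pc, Polynomial.eval_finset_sum]

theorem pc_deg {R : Type*} [CommRing R] {m : ℕ} (c : Fin (m+1) → R) : (pc c).natDegree ≤ m := by
  refine Polynomial.natDegree_sum_le_of_forall_le _ _ fun j _ => ?_
  exact (Polynomial.natDegree_C_mul_X_pow_le _ _).trans (by omega)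

theorem pc_coeff {R : Type*} [CommRing R] {m : ℕ} (c : Fin (m+1) → R) (i : Fin (m+1)) : (pc c).coeff i = c i := by
  simp only [pc, Polynomial.finset_sum_coeff, Polynomial.coeff_C_mul_X_pow]
  rw [Finset.sum_eq_single i]
  · simp
  · intro j _ hj
    rw [if_neg]
    exact fun h => hj (Fin.ext h.symm)
  · simp

theorem pc_zero {R : Type*} [CommRing R] {m : ℕ} (c : Fin (m+1) → R) (h : pc c = 0) : c = 0 := by
  ext i; rw [← pc_coeff c i, h]; simp

theorem pc_map {R S : Type*} [CommRing R] [CommRing S] (φ : R →+* S) {m : ℕ} (c : Fin (m+1) → R) : (pc c).map φ = pc fun j => φ (c j) := by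
  simp [pc, Polynomial.map_sum]

theorem pc_of {m : ℕ} (P : Polynomial ℂ) (h : P.natDegree ≤ m) : pc (fun j : Fin (m+1) => P.coeff j) = P := by
  rw [pc, Finset.sum_range (fun i => Polynomial.C (P.coeff i) * Polynomial.X ^ i) |>.symm]
  conv_rhs => rw [P.as_sum_range' (m+1) (by omega)]
  simp [Polynomial.C_mul_X_pow_eq_monomial]

theorem pc_smul {m : ℕ} (k : ℂ) (c : Fin (m+1) → ℂ) (t : ℂ) : (pc (k • c)).eval t = k * (pc c).eval t := by
  simp [pc_eval, Finset.mul_sum, mul_assoc]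

/-- one-variable step: if `B h = A` on a ball and `β h = α` at many points of the ball then `β h = α` on the ball -/
theorem one_var {m : ℕ} {ι : Type*} [Fintype ι] (s : ι → ℂ) (hs : Function.Injective s) (hcard : 2 * m < Fintype.card ι)
    {t0 : ℂ} {ε : ℝ} (hε : 0 < ε) (hsm : ∀ i, s i ∈ Metric.ball t0 ε) (h : ℂ → ℂ) (hc : ContinuousOn h (Metric.ball t0 ε))
    (A B α β : Fin (m+1) → ℂ) (hne : A ≠ 0 ∨ B ≠ 0)
    (h1 : ∀ t ∈ Metric.ball t0 ε, (pc B).eval t * h t = (pc A).eval t)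
    (h2 : ∀ i, (pc β).eval (s i) * h (s i) = (pc α).eval (s i)) :
    ∀ t ∈ Metric.ball t0 ε, (pc β).eval t * h t = (pc α).eval t := by
  have hB : pc B ≠ 0 := by
    intro hB
    have hA : pc A = 0 := by
      refine Polynomial.eq_zero_of_infinite_isRoot _ ((infinite_ball_c t0 hε).mono fun t ht => ?_)
      have := h1 t ht
      rw [hB] at this
      simpa using this.symm
    rcases hne with h' | h'
    · exact h' (pc_zero _ hA)
    · exact h' (pc_zero _ hB)
  have hz : pc β * pc A - pc α * pc B = 0 := by
    refine Polynomial.eq_zero_of_natDegree_lt_card_of_eval_eq_zero _ hs (fun i => ?_) (lt_of_le_of_lt ?_ hcard)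
    · rw [Polynomial.eval_sub, Polynomial.eval_mul, Polynomial.eval_mul, ← h1 _ (hsm i), ← h2 i]; ring
    · refine (Polynomial.natDegree_sub_le _ _).trans (max_le ?_ ?_)
      · refine Polynomial.natDegree_mul_le.trans ?_
        have := pc_deg β; have := pc_deg A; omega
      · refine Polynomial.natDegree_mul_le.trans ?_
        have := pc_deg α; have := pc_deg B; omega
  intro t1 ht1
  by_contra hcon
  have hφ : ContinuousAt (fun t => (pc β).eval t * h t - (pc α).eval t) t1 := by
    have := hc.continuousAt (Metric.isOpen_ball.mem_nhds ht1)
    exact ((pc β).continuous.continuousAt.mul this).sub (pc α).continuous.continuousAt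
  have hev := (hφ.eventually_ne (sub_ne_zero.2 hcon)).and (Metric.isOpen_ball.mem_nhds ht1)
  refine hB (Polynomial.eq_zero_of_infinite_isRoot _ ((infinite_of_mem_nhds t1 hev).mono ?_))
  rintro t ⟨ht, htb⟩
  have e : (pc β * pc A - pc α * pc B).eval t = 0 := by rw [hz]; simp
  rw [Polynomial.eval_sub, Polynomial.eval_mul, Polynomial.eval_mul, ← h1 _ htb] at e
  have : (pc B).eval t * ((pc β).eval t * h t - (pc α).eval t) = 0 := by rw [← e]; ring
  exact (mul_eq_zero.1 this).resolve_right ht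

theorem pc_eval_cont {m : ℕ} (t : ℂ) : Continuous fun c : Fin (m+1) → ℂ => (pc c).eval t := by
  simp only [pc_eval]; fun_prop

theorem baire_step {n : ℕ} (t0 : ℂ) (w0 : Fin n → ℂ) {ε : ℝ} (hε : 0 < ε) (h : ℂ → (Fin n → ℂ) → ℂ)
    (hc : ∀ t ∈ Metric.closedBall t0 ε, ContinuousOn (h t) (Metric.closedBall w0 ε))
    (hr : ∀ w ∈ Metric.closedBall w0 ε, ∃ a b : Polynomial ℂ, b ≠ 0 ∧ ∀ t ∈ Metric.closedBall t0 ε, b.eval t * h t w = a.eval t) :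
    ∃ m : ℕ, ∃ V : Set (Fin n → ℂ), IsOpen V ∧ V.Nonempty ∧ V ⊆ Metric.ball w0 ε ∧ ∀ w ∈ V, ∃ A B : Fin (m+1) → ℂ,
      (A ≠ 0 ∨ B ≠ 0) ∧ ∀ t ∈ Metric.closedBall t0 ε, (pc B).eval t * h t w = (pc A).eval t := by
  let T : ℕ → Set (Fin n → ℂ) := fun m => {w | w ∈ Metric.closedBall w0 ε ∧ ∃ c : (Fin (m+1) → ℂ) × (Fin (m+1) → ℂ), c ∈ Metric.sphere (0 : (Fin (m+1) → ℂ) × (Fin (m+1) → ℂ)) 1 ∧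
      ∀ t ∈ Metric.closedBall t0 ε, (pc c.2).eval t * h t w = (pc c.1).eval t}
  have hT : ∀ m, IsClosed (T m) := by
    intro m
    let K : Set ((Fin n → ℂ) × ((Fin (m+1) → ℂ) × (Fin (m+1) → ℂ))) := Metric.closedBall w0 ε ×ˢ Metric.sphere 0 1
    have hK : IsCompact K := (isCompact_closedBall _ _).prod (isCompact_sphere _ _)
    have hS : IsCompact (K ∩ ⋂ t ∈ Metric.closedBall t0 ε, (K ∩ (fun x => (pc x.2.2).eval t * h t x.1 - (pc x.2.1).eval t) ⁻¹' {0})) := by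
      refine hK.inter_right (isClosed_biInter fun t ht => ?_)
      refine ContinuousOn.preimage_isClosed_of_isClosed ?_ hK.isClosed isClosed_singleton
      refine ContinuousOn.sub (ContinuousOn.mul ?_ ?_) ?_
      · exact ((pc_eval_cont t).comp (by fun_prop : Continuous fun x : (Fin n → ℂ) × ((Fin (m+1) → ℂ) × (Fin (m+1) → ℂ)) => x.2.2)).continuousOn
      · exact (hc t ht).comp continuousOn_fst fun x hx => hx.1
      · exact ((pc_eval_cont t).comp (by fun_prop : Continuous fun x : (Fin n → ℂ) × ((Fin (m+1) → ℂ) × (Fin (m+1) → ℂ)) => x.2.1)).continuousOn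
    have : T m = Prod.fst '' (K ∩ ⋂ t ∈ Metric.closedBall t0 ε, (K ∩ (fun x => (pc x.2.2).eval t * h t x.1 - (pc x.2.1).eval t) ⁻¹' {0})) := by
      ext w
      constructor
      · rintro ⟨hw, c, hc1, hc2⟩
        refine ⟨(w, c), ⟨⟨hw, hc1⟩, ?_⟩, rfl⟩
        simp only [Set.mem_iInter]
        exact fun t ht => ⟨⟨hw, hc1⟩, by simpa [sub_eq_zero] using hc2 t ht⟩
      · rintro ⟨⟨w', c⟩, ⟨⟨hw, hc1⟩, h2⟩, rfl⟩
        refine ⟨hw, c, hc1, fun t ht => ?_⟩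
        simp only [Set.mem_iInter] at h2
        simpa [sub_eq_zero] using (h2 t ht).2
    rw [this]
    exact (hS.image continuous_fst).isClosed
  have hcov : ∀ w ∈ Metric.closedBall w0 ε, ∃ m, w ∈ T m := by
    intro w hw
    obtain ⟨a, b, hb, hab⟩ := hr w hw
    let m := max a.natDegree b.natDegree
    let c : (Fin (m+1) → ℂ) × (Fin (m+1) → ℂ) := (fun j => a.coeff j, fun j => b.coeff j)
    have ha' : pc c.1 = a := pc_of a (le_max_left _ _)
    have hb' : pc c.2 = b := pc_of b (le_max_right _ _)
    have hc0 : c ≠ 0 := by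
      intro h0
      apply hb
      rw [← hb', h0]; simp [pc]
    have hn : ‖c‖ ≠ 0 := norm_ne_zero_iff.2 hc0
    refine ⟨m, hw, ((‖c‖⁻¹ : ℝ) : ℂ) • c, ?_, fun t ht => ?_⟩
    · rw [mem_sphere_zero_iff_norm, norm_smul, Complex.norm_real, norm_inv, norm_norm, inv_mul_cancel₀ hn]
    · rw [Prod.smul_fst, Prod.smul_snd, pc_smul, pc_smul, ha', hb', mul_assoc, hab t ht]
  have hd := dense_iUnion_interior_of_closed (f := fun m => T m ∪ (Metric.ball w0 ε)ᶜ)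
    (fun m => (hT m).union Metric.isOpen_ball.isClosed_compl) (by
      refine Set.eq_univ_of_forall fun w => ?_
      by_cases hw : w ∈ Metric.ball w0 ε
      · obtain ⟨m, hm⟩ := hcov w (Metric.ball_subset_closedBall hw)
        exact Set.mem_iUnion.2 ⟨m, Or.inl hm⟩
      · exact Set.mem_iUnion.2 ⟨0, Or.inr hw⟩)
  obtain ⟨w, hw1, hw2⟩ := hd.inter_open_nonempty _ Metric.isOpen_ball ⟨w0, Metric.mem_ball_self hε⟩
  obtain ⟨m, hm⟩ := Set.mem_iUnion.1 hw2
  refine ⟨m, Metric.ball w0 ε ∩ interior (T m ∪ (Metric.ball w0 ε)ᶜ), Metric.isOpen_ball.inter isOpen_interior, ⟨w, hw1, hm⟩, Set.inter_subset_left, ?_⟩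
  rintro w' ⟨h1, h2⟩
  rcases interior_subset h2 with h3 | h3
  · obtain ⟨_, c, hc1, hc2⟩ := h3
    refine ⟨c.1, c.2, ?_, hc2⟩
    by_contra hcon
    push Not at hcon
    have : c = 0 := Prod.ext hcon.1 hcon.2
    rw [this] at hc1
    simp at hc1
  · exact absurd h1 h3

theorem hurwitz (n : ℕ) : ∀ (W : Set (Fin n → ℂ)) (hW : IsOpen W) (hne : W.Nonempty) (h : (Fin n → ℂ) → ℂ) (hc : ContinuousOn h W)
    (hr : ∀ w ∈ W, ∀ i, ∃ a b : Polynomial ℂ, b ≠ 0 ∧ ∀ t, Function.update w i t ∈ W → b.eval t * h (Function.update w i t) = a.eval t),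
    ∃ W' ⊆ W, IsOpen W' ∧ W'.Nonempty ∧ ∃ a b : MvPolynomial (Fin n) ℂ, b ≠ 0 ∧ ∀ w ∈ W', MvPolynomial.eval w b * h w = MvPolynomial.eval w a := by
  induction n with
  | zero =>
    intro W hW hne h hc hr
    refine ⟨W, le_rfl, hW, hne, MvPolynomial.C (h 0), 1, one_ne_zero, fun w _ => ?_⟩
    have : w = 0 := Subsingleton.elim _ _
    simp [this]
  | succ n ih =>
    intro W hW hne h hc hr
    obtain ⟨z0, hz0⟩ := hne
    obtain ⟨δ, hδ, hball⟩ := Metric.isOpen_iff.1 hW z0 hz0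
    set ε := δ / 2 with hεd
    have hε : 0 < ε := by positivity
    set t0 := z0 0
    set w0 := Fin.tail z0
    have hin : ∀ t ∈ Metric.closedBall t0 ε, ∀ w ∈ Metric.closedBall w0 ε, (Fin.cons t w : Fin (n+1) → ℂ) ∈ W := by
      intro t ht w hw
      refine hball ?_
      rw [Metric.mem_ball, dist_pi_lt_iff hδ]
      refine Fin.cases ?_ (fun i => ?_)
      · simp only [Fin.cons_zero]
        exact lt_of_le_of_lt ht (by rw [hεd]; linarith)
      · simp only [Fin.cons_succ]
        refine lt_of_le_of_lt ((dist_le_pi_dist w w0 i).trans hw) (by rw [hεd]; linarith)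
    have hcont : ∀ t ∈ Metric.closedBall t0 ε, ContinuousOn (fun w => h (Fin.cons t w)) (Metric.closedBall w0 ε) := by
      intro t ht
      refine hc.comp ?_ (fun w hw => hin t ht w hw)
      exact (Continuous.finCons (A := fun _ => ℂ) (f := fun _ : Fin n → ℂ => t) (g := fun w : Fin n → ℂ => w) continuous_const continuous_id).continuousOn
    have hcont2 : ∀ w ∈ Metric.closedBall w0 ε, ContinuousOn (fun t => h (Fin.cons t w)) (Metric.closedBall t0 ε) := by
      intro w hw
      refine hc.comp ?_ (fun t ht => hin t ht w hw)
      exact (Continuous.finCons (A := fun _ => ℂ) (f := fun t : ℂ => t) (g := fun _ : ℂ => w) continuous_id continuous_const).continuousOn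
    obtain ⟨m, V, hVo, hVne, hVs, hV⟩ := baire_step t0 w0 hε (fun t w => h (Fin.cons t w)) hcont (by
      intro w hw
      obtain ⟨a, b, hb, hab⟩ := hr (Fin.cons t0 w) (hin t0 (Metric.mem_closedBall_self hε.le) w hw) 0
      refine ⟨a, b, hb, fun t ht => ?_⟩
      have := hab t
      rw [Fin.update_cons_zero] at this
      exact this (hin t ht w hw))
    -- sample points
    obtain ⟨s, hs, hsm⟩ : ∃ s : Fin (m+1) ⊕ Fin (m+1) → ℂ, Function.Injective s ∧ ∀ i, s i ∈ Metric.ball t0 ε := by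
      obtain ⟨S, hS1, hS2⟩ := (infinite_ball_c t0 hε).exists_subset_card_eq (Fintype.card (Fin (m+1) ⊕ Fin (m+1)))
      have e : Fin (m+1) ⊕ Fin (m+1) ≃ S := Fintype.equivOfCardEq (by rw [Fintype.card_coe, hS2])
      exact ⟨fun i => (e i : ℂ), Subtype.val_injective.comp e.injective, fun i => hS1 (e i).2⟩
    have hfin : ∀ I : Finset (Fin (m+1) ⊕ Fin (m+1)), ∃ V' ⊆ V, IsOpen V' ∧ V'.Nonempty ∧ ∀ i ∈ I, ∃ a b : MvPolynomial (Fin n) ℂ, b ≠ 0 ∧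
        ∀ w ∈ V', MvPolynomial.eval w b * h (Fin.cons (s i) w) = MvPolynomial.eval w a := by
      intro I
      induction I using Finset.induction_on with
      | empty => exact ⟨V, le_rfl, hVo, hVne, by simp⟩
      | insert i I hi ihI =>
        obtain ⟨V', hs', ho', hne', h'⟩ := ihI
        have hsi := Metric.ball_subset_closedBall (hsm i)
        obtain ⟨V'', hs'', ho'', hne'', a, b, hb, hab⟩ := ih V' ho' hne' (fun w => h (Fin.cons (s i) w))
          ((hcont _ hsi).mono ((hs'.trans hVs).trans Metric.ball_subset_closedBall)) (by
          intro w hw j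
          have hwc := Metric.ball_subset_closedBall (hVs (hs' hw))
          obtain ⟨a, b, hb, hab⟩ := hr (Fin.cons (s i) w) (hin _ hsi w hwc) j.succ
          refine ⟨a, b, hb, fun t ht => ?_⟩
          have := hab t
          rw [← Fin.cons_update] at this
          exact this (hin _ hsi _ (Metric.ball_subset_closedBall (hVs (hs' ht)))))
        refine ⟨V'', hs''.trans hs', ho'', hne'', ?_⟩
        intro j hj
        rcases Finset.mem_insert.1 hj with rfl | hj
        · exact ⟨a, b, hb, hab⟩
        · obtain ⟨a, b, hb, hab⟩ := h' j hj
          exact ⟨a, b, hb, fun w hw => hab w (hs'' hw)⟩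
    obtain ⟨V', hV's, hV'o, hV'ne, hV'⟩ := hfin Finset.univ
    have hV'2 := fun i => hV' i (Finset.mem_univ i)
    choose a b hb hab using hV'2
    -- linear system
    let M : Matrix (Fin (m+1) ⊕ Fin (m+1)) (Fin (m+1) ⊕ Fin (m+1)) (MvPolynomial (Fin n) ℂ) :=
      fun i j => if i = Sum.inl 0 then 0 else
        Sum.elim (fun j : Fin (m+1) => MvPolynomial.C (s i ^ (j:ℕ)) * b i) (fun j : Fin (m+1) => - (MvPolynomial.C (s i ^ (j:ℕ)) * a i)) j
    have hM : M.det = 0 := Matrix.det_eq_zero_of_row_eq_zero (Sum.inl 0) (fun j => by simp [M])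
    obtain ⟨γ, hγ0, hγ⟩ := Matrix.exists_mulVec_eq_zero_iff.2 hM
    set α : Fin (m+1) → MvPolynomial (Fin n) ℂ := fun j => γ (Sum.inl j) with hα
    set β : Fin (m+1) → MvPolynomial (Fin n) ℂ := fun j => γ (Sum.inr j) with hβ
    have hsys : ∀ i, i ≠ Sum.inl 0 → ∀ w, MvPolynomial.eval w (b i) * (pc fun j => MvPolynomial.eval w (α j)).eval (s i)
        = MvPolynomial.eval w (a i) * (pc fun j => MvPolynomial.eval w (β j)).eval (s i) := by
      intro i hi w
      have := congrArg (MvPolynomial.eval w) (congrFun hγ i)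
      simp only [Matrix.mulVec, dotProduct, M, if_neg hi, Fintype.sum_sum_type, Sum.elim_inl, Sum.elim_inr, map_add, map_sum, map_mul, map_neg,
        MvPolynomial.eval_C, Pi.zero_apply, map_zero] at this
      simp only [pc_eval, Finset.mul_sum]
      rw [← sub_eq_zero, ← this, sub_eq_add_neg, ← Finset.sum_neg_distrib]
      congr 1
      · exact Finset.sum_congr rfl fun j _ => by simp only [hα]; ring
      · exact Finset.sum_congr rfl fun j _ => by simp only [hβ]; ring
    let V'' := V' ∩ {w | MvPolynomial.eval w (∏ i, b i) ≠ 0}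
    have hV''o : IsOpen V'' := hV'o.inter (isOpen_ne_fun (mvpoly_cont _) continuous_const)
    have hV''ne : V''.Nonempty := by
      by_contra hcon
      rw [Set.not_nonempty_iff_eq_empty] at hcon
      have : ∏ i, b i = 0 := mvpoly_open hV'o hV'ne _ fun w hw => by
        by_contra hh
        have : w ∈ V'' := ⟨hw, hh⟩
        rw [hcon] at this; exact this
      exact Finset.prod_ne_zero_iff.2 (fun i _ => hb i) this
    have hfinal : ∀ w ∈ V'', ∀ t ∈ Metric.ball t0 ε, (pc fun j => MvPolynomial.eval w (β j)).eval t * h (Fin.cons t w) = (pc fun j => MvPolynomial.eval w (α j)).eval t := by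
      intro w hw
      have hwV : w ∈ V := hV's hw.1
      have hwB := Metric.ball_subset_closedBall (hVs hwV)
      obtain ⟨A, B, hAB, h1⟩ := hV w hwV
      refine one_var (ι := {i : Fin (m+1) ⊕ Fin (m+1) // i ≠ Sum.inl 0}) (fun i => s i.1) (hs.comp Subtype.val_injective) ?_ hε (fun i => hsm i.1)
        (fun t => h (Fin.cons t w)) ((hcont2 w hwB).mono Metric.ball_subset_closedBall) A B _ _ hAB (fun t ht => h1 t (Metric.ball_subset_closedBall ht)) ?_
      · rw [Fintype.card_subtype_compl, Fintype.card_subtype_eq, Fintype.card_sum, Fintype.card_fin]; omega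
      · rintro ⟨i, hi⟩
        have e1 := hsys i hi w
        have e2 := hab i w hw.1
        have e3 : MvPolynomial.eval w (b i) ≠ 0 := by
          have := hw.2
          simp only [Set.mem_setOf_eq, map_prod] at this
          exact Finset.prod_ne_zero_iff.1 this i (Finset.mem_univ i)
        refine mul_left_cancel₀ e3 ?_
        rw [e1, ← e2]; ring
    let W' : Set (Fin (n+1) → ℂ) := {z | z 0 ∈ Metric.ball t0 ε ∧ Fin.tail z ∈ V''}
    have hW'o : IsOpen W' := by
      have h1 : IsOpen ((fun z : Fin (n+1) → ℂ => z 0) ⁻¹' Metric.ball t0 ε) := Metric.isOpen_ball.preimage (continuous_apply 0)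
      refine h1.inter (hV''o.preimage ?_)
      exact continuous_pi fun i => continuous_apply _
    have hW'ne : W'.Nonempty := by
      obtain ⟨w, hw⟩ := hV''ne
      exact ⟨Fin.cons t0 w, by simpa using hε, by simpa using hw⟩
    let a' := (MvPolynomial.finSuccEquiv ℂ n).symm (pc α)
    let b' := (MvPolynomial.finSuccEquiv ℂ n).symm (pc β)
    have hev : ∀ z ∈ W', MvPolynomial.eval z b' * h z = MvPolynomial.eval z a' := by
      intro z hz
      have e := hfinal _ hz.2 _ hz.1
      rw [Fin.cons_self_tail] at e
      have e1 : MvPolynomial.eval z b' = (pc fun j => MvPolynomial.eval (Fin.tail z) (β j)).eval (z 0) := by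
        conv_lhs => rw [← Fin.cons_self_tail z]
        rw [MvPolynomial.eval_eq_eval_mv_eval', AlgEquiv.apply_symm_apply, pc_map]
      have e2 : MvPolynomial.eval z a' = (pc fun j => MvPolynomial.eval (Fin.tail z) (α j)).eval (z 0) := by
        conv_lhs => rw [← Fin.cons_self_tail z]
        rw [MvPolynomial.eval_eq_eval_mv_eval', AlgEquiv.apply_symm_apply, pc_map]
      rw [e1, e2, e]
    refine ⟨W', ?_, hW'o, hW'ne, a', b', ?_, hev⟩
    · intro z hz
      rw [← Fin.cons_self_tail z]
      exact hin _ (Metric.ball_subset_closedBall hz.1) _ (Metric.ball_subset_closedBall (hVs (hV's hz.2.1)))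
    · intro hb0
      have ha0 : a' = 0 := mvpoly_open hW'o hW'ne _ fun z hz => by rw [← hev z hz, hb0]; simp
      have hα0 := pc_zero α ((map_eq_zero_iff _ (MvPolynomial.finSuccEquiv ℂ n).symm.injective).1 ha0)
      have hβ0 := pc_zero β ((map_eq_zero_iff _ (MvPolynomial.finSuccEquiv ℂ n).symm.injective).1 hb0)
      apply hγ0
      ext1 i
      rcases i with i | i
      · exact congrFun hα0 i
      · exact congrFun hβ0 i

theorem span_top_of_ann {N : ℕ} {J : Type*} (v : J → (Fin N → ℂ)) (h : ∀ C : Fin N → ℂ, (∀ j, C ⬝ᵥ v j = 0) → C = 0) :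
    Submodule.span ℂ (Set.range v) = ⊤ := by
  by_contra hne
  obtain ⟨φ, hφ, hle⟩ := Submodule.exists_le_ker_of_lt_top _ (lt_top_iff_ne_top.2 hne)
  have e : ∀ w : Fin N → ℂ, φ w = (fun i => φ (Pi.single i 1)) ⬝ᵥ w := by
    intro w
    conv_lhs => rw [pi_eq_sum_univ' w, map_sum]
    simp only [dotProduct, map_smul, smul_eq_mul]
    refine Finset.sum_congr rfl fun i _ => ?_
    rw [mul_comm]
  have h0 := h (fun i => φ (Pi.single i 1)) (fun j => by
    rw [← e]; exact hle (Submodule.subset_span ⟨j, rfl⟩))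
  apply hφ
  refine LinearMap.ext fun w => ?_
  rw [e, h0, zero_dotProduct, LinearMap.zero_apply]

theorem exists_det_of_ann {N : ℕ} {J : Type*} (v : J → (Fin N → ℂ)) (h : ∀ C : Fin N → ℂ, (∀ j, C ⬝ᵥ v j = 0) → C = 0) :
    ∃ s : Fin N → J, (Matrix.of fun i => v (s i)).det ≠ 0 := by
  have ht := span_top_of_ann v h
  obtain ⟨g, hg1, hg2, hg3⟩ := Submodule.exists_fun_fin_finrank_span_eq ℂ (Set.range v)
  have hN : Module.finrank ℂ (Submodule.span ℂ (Set.range v)) = N := by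
    rw [ht]; simp
  choose s hs using hg1
  refine ⟨fun i => s (Fin.cast hN.symm i), ?_⟩
  have : LinearIndependent ℂ (Matrix.of fun i : Fin N => v (s (Fin.cast hN.symm i))).row := by
    have e : (Matrix.of fun i : Fin N => v (s (Fin.cast hN.symm i))).row = g ∘ (Fin.cast hN.symm) := by
      ext i : 1
      simp only [Function.comp, ← hs]; rfl
    rw [e]
    exact hg3.comp _ (Fin.cast_injective _)
  exact ((Matrix.isUnit_iff_isUnit_det _).1 (Matrix.linearIndependent_rows_iff_isUnit.1 this)).ne_zero

/-- normalized version: the annihilator is spanned by a vector with `k`-th coordinate nonzero. -/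
theorem exists_det_of_ann_opt {N : ℕ} {J : Type*} (v : J → (Fin N → ℂ)) (C0 : Fin N → ℂ) (k : Fin N) (hk : C0 k ≠ 0)
    (h : ∀ C : Fin N → ℂ, (∀ j, C ⬝ᵥ v j = 0) → ∃ c : ℂ, C = c • C0) :
    ∃ s : Fin N → Option J, (Matrix.of fun i => (s i).elim (Pi.single k 1) v).det ≠ 0 := by
  refine exists_det_of_ann (fun o : Option J => o.elim (Pi.single k 1) v) fun C hC => ?_
  obtain ⟨c, rfl⟩ := h C fun j => hC (some j)
  have := hC none
  simp only [Option.elim, dotProduct_single, mul_one, Pi.smul_apply, smul_eq_mul] at this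
  rcases mul_eq_zero.1 this with h | h
  · simp [h]
  · exact absurd h hk

theorem poly_select {N : ℕ} {J : Type*} (φ : J → Fin N → Polynomial ℂ) (k : Fin N) (t0 : ℂ) (C0 : Fin N → ℂ) (hk : C0 k ≠ 0)
    (h : ∀ C : Fin N → ℂ, (∀ j, C ⬝ᵥ (fun i => (φ j i).eval t0) = 0) → ∃ c : ℂ, C = c • C0) :
    ∃ (b : Polynomial ℂ) (a : Fin N → Polynomial ℂ), b ≠ 0 ∧ ∀ t : ℂ, ∀ C : Fin N → ℂ, C k = 1 → (∀ j, C ⬝ᵥ (fun i => (φ j i).eval t) = 0) →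
      ∀ i, b.eval t * C i = (a i).eval t := by
  obtain ⟨s, hs⟩ := exists_det_of_ann_opt (fun j => fun i => (φ j i).eval t0) C0 k hk h
  let M : Matrix (Fin N) (Fin N) (Polynomial ℂ) := Matrix.of fun i => (s i).elim (Pi.single k 1) φ
  let ρ : Fin N → Polynomial ℂ := fun i => (s i).elim 1 (fun _ => 0)
  have hM : ∀ t : ℂ, M.map (Polynomial.evalRingHom t) = Matrix.of fun i => (s i).elim (Pi.single k 1) (fun j => fun i => (φ j i).eval t) := by
    intro t
    ext i l
    simp only [M, map_apply, of_apply]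
    cases s i with
    | none => simp [Pi.single_apply, apply_ite]
    | some j => simp
  refine ⟨M.det, M.adjugate *ᵥ ρ, ?_, ?_⟩
  · intro h0
    apply hs
    rw [← hM t0]
    have := (Polynomial.evalRingHom t0).map_det M
    rw [h0, map_zero] at this
    exact this.symm
  · intro t C hC1 hC i
    have e1 : (M.map (Polynomial.evalRingHom t)) *ᵥ C = fun i => (ρ i).eval t := by
      rw [hM]
      ext i
      simp only [mulVec, of_apply, ρ]
      cases s i with
      | none => simp [hC1]
      | some j => 
        simp only [Option.elim]
        rw [dotProduct_comm, hC j]; simp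
    have e2 : (M.map (Polynomial.evalRingHom t)).adjugate *ᵥ ((M.map (Polynomial.evalRingHom t)) *ᵥ C) = (M.map (Polynomial.evalRingHom t)).det • C := by
      rw [mulVec_mulVec, adjugate_mul, smul_mulVec, one_mulVec]
    have e3 := congrFun e2 i
    rw [e1] at e3
    have e4 : (M.map (Polynomial.evalRingHom t)).det = M.det.eval t := ((Polynomial.evalRingHom t).map_det M).symm
    have e5 : (M.map (Polynomial.evalRingHom t)).adjugate = (M.adjugate).map (Polynomial.evalRingHom t) := ((Polynomial.evalRingHom t).map_adjugate M).symm
    rw [e4, e5] at e3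
    simp only [Pi.smul_apply, smul_eq_mul] at e3
    rw [← e3]
    simp [mulVec, dotProduct, Polynomial.eval_finset_sum]

/-- `C f` is constant on the fibral image of `x`. -/
def InV {p q p' q' : ℕ} (f : Matrix (Fin p) (Fin q) ℂ → Matrix (Fin p') (Fin q') ℂ) (x : (Fin p → ℂ) × (Fin q → ℂ)) (C : Fin p' → ℂ) : Prop :=
  ∀ Z ∈ typeIDomain p q, ∀ Z' ∈ typeIDomain p q, x.1 ᵥ* Z = x.2 → x.1 ᵥ* Z' = x.2 → C ᵥ* f Z = C ᵥ* f Z'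

/-- columns of `f` -/
def fcol {p q p' q' : ℕ} (f : Matrix (Fin p) (Fin q) ℂ → Matrix (Fin p') (Fin q') ℂ) (j : Fin q') : Matrix (Fin p) (Fin q) ℂ → (Fin p' → ℂ) :=
  fun Z i => f Z i j

theorem fcol_diff {p q p' q' : ℕ} {f : Matrix (Fin p) (Fin q) ℂ → Matrix (Fin p') (Fin q') ℂ} {D : Set (Matrix (Fin p) (Fin q) ℂ)}
    (hf : DifferentiableOn ℂ f D) (j : Fin q') : DifferentiableOn ℂ (fcol f j) D := by
  refine differentiableOn_pi.2 fun i => ?_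
  have h1 := differentiableOn_pi.1 hf i
  exact differentiableOn_pi.1 h1 j

theorem vecMul_fcol {p q p' q' : ℕ} (f : Matrix (Fin p) (Fin q) ℂ → Matrix (Fin p') (Fin q') ℂ) (C : Fin p' → ℂ) (Z) (j : Fin q') :
    (C ᵥ* f Z) j = C ⬝ᵥ fcol f j Z := rfl

/-- functional `C ⬝ᵥ ·` -/
noncomputable def dotL {n : ℕ} (C : Fin n → ℂ) : (Fin n → ℂ) →L[ℂ] ℂ :=
  LinearMap.toContinuousLinearMap ({ toFun := fun w => C ⬝ᵥ w, map_add' := dotProduct_add C, map_smul' := fun c w => dotProduct_smul c C w } : (Fin n → ℂ) →ₗ[ℂ] ℂ)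

theorem dotL_apply {n : ℕ} (C w : Fin n → ℂ) : dotL C w = C ⬝ᵥ w := rfl

theorem dom_star {m n : ℕ} {Z : Matrix (Fin m) (Fin n) ℂ} (hZ : Z ∈ typeIDomain m n) :
    ∀ X ∈ typeIDomain m n, ∀ t : ℝ, 0 ≤ t → t ≤ 1 → Z + (t : ℂ) • (X - Z) ∈ typeIDomain m n :=
  fun X hX t h0 h1 => dom_convex hZ hX t h0 h1

theorem line_near {E : Type*} [NormedAddCommGroup E] [NormedSpace ℂ E] {D : Set E} (hD : IsOpen D) {Z : E} (hZ : Z ∈ D) (H : E) :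
    ∀ᶠ τ : ℂ in nhds 0, Z + τ • H ∈ D := by
  have h : Continuous (fun τ : ℂ => Z + τ • H) := by fun_prop
  have := h.tendsto 0
  simp only [zero_smul, add_zero] at this
  exact this.eventually (hD.mem_nhds hZ)

/-- `C` lies in `V(x)` iff all derivatives along fibre directions are killed (at a point of the fibre). -/
theorem InV_of_dd {p q p' q' : ℕ} {f : Matrix (Fin p) (Fin q) ℂ → Matrix (Fin p') (Fin q') ℂ}
    (hf : DifferentiableOn ℂ f (typeIDomain p q)) {x : (Fin p → ℂ) × (Fin q → ℂ)} {Z0 : Matrix (Fin p) (Fin q) ℂ} (hZ0 : Z0 ∈ typeIDomain p q)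
    (hx : x.1 ᵥ* Z0 = x.2) (C : Fin p' → ℂ)
    (h : ∀ H : Matrix (Fin p) (Fin q) ℂ, x.1 ᵥ* H = 0 → ∀ k, ∀ j, C ⬝ᵥ ((dd H)^[k+1] (fcol f j) Z0) = 0) : InV f x C := by
  have key : ∀ Z ∈ typeIDomain p q, x.1 ᵥ* Z = x.2 → C ᵥ* f Z = C ᵥ* f Z0 := by
    intro Z hZ hxZ
    ext j
    rw [vecMul_fcol, vecMul_fcol]
    have := taylor_to (dom_open p q) (fcol_diff hf j) (dotL C) Z0 (Z - Z0) hZ0 (dom_star hZ0) (fun k hk => by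
      obtain ⟨k, rfl⟩ : ∃ k', k = k' + 1 := ⟨k - 1, by omega⟩
      exact h _ (by rw [vecMul_sub, hxZ, hx, sub_self]) k j) 1 (by simpa using hZ)
    simpa [dotL_apply] using this
  intro Z hZ Z' hZ' h1 h2
  rw [key Z hZ h1, key Z' hZ' h2]

theorem dd_of_InV {p q p' q' : ℕ} {f : Matrix (Fin p) (Fin q) ℂ → Matrix (Fin p') (Fin q') ℂ}
    (hf : DifferentiableOn ℂ f (typeIDomain p q)) {x : (Fin p → ℂ) × (Fin q → ℂ)} {Z0 : Matrix (Fin p) (Fin q) ℂ} (hZ0 : Z0 ∈ typeIDomain p q)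
    (hx : x.1 ᵥ* Z0 = x.2) (C : Fin p' → ℂ) (hC : InV f x C) 
    (H : Matrix (Fin p) (Fin q) ℂ) (hH : x.1 ᵥ* H = 0) (k : ℕ) (j : Fin q') : C ⬝ᵥ ((dd H)^[k+1] (fcol f j) Z0) = 0 := by
  refine taylor_from (dom_open p q) (fcol_diff hf j) (dotL C) Z0 H hZ0 ?_ (k+1) (by omega)
  filter_upwards [line_near (dom_open p q) hZ0 H] with τ hτ
  have := hC _ hτ _ hZ0 (by rw [vecMul_add, vecMul_smul, hH, smul_zero, add_zero, hx]) hx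
  exact congrFun this j

theorem line_rat {p q p' q' : ℕ} {f : Matrix (Fin p) (Fin q) ℂ → Matrix (Fin p') (Fin q') ℂ}
    (hf : DifferentiableOn ℂ f (typeIDomain p q)) (x v : (Fin p → ℂ) × (Fin q → ℂ)) {Z0 : Matrix (Fin p) (Fin q) ℂ} (hZ0 : Z0 ∈ typeIDomain p q)
    (hx : x.1 ᵥ* Z0 = x.2) (hv : v.1 ᵥ* Z0 = v.2) (κ : Fin p → ℂ) (hκx : x.1 ⬝ᵥ κ = 1) (hκv : v.1 ⬝ᵥ κ = 0) (t0 : ℂ) (C0 : Fin p' → ℂ) (k : Fin p') (hk : C0 k ≠ 0)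
    (hu : ∀ C, InV f (x + t0 • v) C → ∃ c : ℂ, C = c • C0) :
    ∃ (b : Polynomial ℂ) (a : Fin p' → Polynomial ℂ) (a2 : Fin q' → Polynomial ℂ), b ≠ 0 ∧ ∀ t : ℂ, ∀ C : Fin p' → ℂ, C k = 1 → InV f (x + t • v) C →
      (∀ i, b.eval t * C i = (a i).eval t) ∧ ∀ Z ∈ typeIDomain p q, (x + t • v).1 ᵥ* Z = (x + t • v).2 → ∀ j, b.eval t * (C ᵥ* f Z) j = (a2 j).eval t := by
  have hZt : ∀ t : ℂ, (x + t • v).1 ᵥ* Z0 = (x + t • v).2 := by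
    intro t
    simp [add_vecMul, smul_vecMul, hx, hv]
  have hκt : ∀ t : ℂ, (x + t • v).1 ⬝ᵥ κ = 1 := by
    intro t
    simp [hκx, hκv]
  let H0 : Matrix (Fin p) (Fin q) ℂ → Matrix (Fin p) (Fin q) ℂ := fun G => G - vecMulVec κ (x.1 ᵥ* G)
  let H1 : Matrix (Fin p) (Fin q) ℂ → Matrix (Fin p) (Fin q) ℂ := fun G => - vecMulVec κ (v.1 ᵥ* G)
  have hH : ∀ (t : ℂ) G, H0 G + t • H1 G = G - vecMulVec κ ((x + t • v).1 ᵥ* G) := by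
    intro t G
    ext i j
    simp [H0, H1, vecMulVec_apply, add_vecMul, smul_vecMul]
    ring
  have hH2 : ∀ (t : ℂ) G, (x + t • v).1 ᵥ* (H0 G + t • H1 G) = 0 := by
    intro t G
    rw [hH, vecMul_sub, vecMul_vecMulVec, hκt, one_smul, sub_self]
  have hH3 : ∀ (t : ℂ) G, (x + t • v).1 ᵥ* G = 0 → H0 G + t • H1 G = G := by
    intro t G h
    rw [hH, h]; ext; simp [vecMulVec_apply]
  have hpoly := fun (J : Matrix (Fin p) (Fin q) ℂ × ℕ × Fin q') => dd_poly_pi (dom_open p q) (fcol_diff hf J.2.2) (H0 J.1) (H1 J.1) (J.2.1 + 1) hZ0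
  choose φ hφ using hpoly
  have hφ' : ∀ J (t : ℂ), (fun i => (φ J i).eval t) = (dd (H0 J.1 + t • H1 J.1))^[J.2.1+1] (fcol f J.2.2) Z0 := by
    intro J t; ext i; exact (hφ J t i).symm
  obtain ⟨b, a, hb, hab⟩ := poly_select φ k t0 C0 hk (by
    intro C hC
    refine hu C (InV_of_dd hf hZ0 (hZt t0) C fun H hH k j => ?_)
    have := hC (H, k, j)
    rw [hφ'] at this
    simpa only [hH3 t0 H hH] using this)
  refine ⟨b, a, fun j => ∑ i, a i * Polynomial.C (f Z0 i j), hb, fun t C hC1 hC => ?_⟩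
  have h1 := hab t C hC1 (fun J => by
    rw [hφ']
    exact dd_of_InV hf hZ0 (hZt t) C hC _ (hH2 t _) _ _)
  refine ⟨h1, fun Z hZ hZx j => ?_⟩
  rw [hC Z hZ Z0 hZ0 hZx (hZt t)]
  simp only [vecMul, dotProduct, Finset.mul_sum, Polynomial.eval_finset_sum, Polynomial.eval_mul, Polynomial.eval_C, ← h1]
  exact Finset.sum_congr rfl fun i _ => by ring

abbrev PX (p q : ℕ) := (Fin p → ℂ) × (Fin q → ℂ)

theorem mem_cone {p q : ℕ} {x : PX p q} : x ∈ genBallCone p q ↔ nsq x.2 < nsq x.1 := Iff.rfl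

theorem cone_open (p q : ℕ) : IsOpen (genBallCone p q) :=
  isOpen_lt (nsq_continuous.comp continuous_snd) (nsq_continuous.comp continuous_fst)

theorem good_pair {p : ℕ} (q : ℕ) (i0 i1 : Fin p) (hi : i0 ≠ i1) : ∃ ε > 0, ∀ x v : PX p q,
    dist x (Pi.single i0 1, 0) < ε → dist v (Pi.single i1 1, 0) < ε → ∃ κ : Fin p → ℂ, ∃ Z0 ∈ typeIDomain p q,
      x.1 ⬝ᵥ κ = 1 ∧ v.1 ⬝ᵥ κ = 0 ∧ x.1 ᵥ* Z0 = x.2 ∧ v.1 ᵥ* Z0 = v.2 := by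
  let Δ : PX p q × PX p q → ℂ := fun y => y.1.1 i0 * y.2.1 i1 - y.1.1 i1 * y.2.1 i0
  let κx : PX p q × PX p q → (Fin p → ℂ) := fun y => (Δ y)⁻¹ • (Pi.single i0 (y.2.1 i1) - Pi.single i1 (y.2.1 i0))
  let κv : PX p q × PX p q → (Fin p → ℂ) := fun y => (Δ y)⁻¹ • (Pi.single i1 (y.1.1 i0) - Pi.single i0 (y.1.1 i1))
  let Z0 : PX p q × PX p q → Matrix (Fin p) (Fin q) ℂ := fun y => vecMulVec (κx y) y.1.2 + vecMulVec (κv y) y.2.2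
  let y0 : PX p q × PX p q := ((Pi.single i0 1, 0), (Pi.single i1 1, 0))
  have hΔ0 : Δ y0 = 1 := by simp [Δ, y0, Pi.single_apply, hi, hi.symm]
  have hΔc : Continuous Δ := by fun_prop
  have hZc : ContinuousAt Z0 y0 := by
    have hinv : ContinuousAt (fun y => (Δ y)⁻¹) y0 := hΔc.continuousAt.inv₀ (by rw [hΔ0]; exact one_ne_zero)
    refine continuousAt_pi.2 fun i => continuousAt_pi.2 fun j => ?_
    simp only [Z0, κx, κv, Matrix.add_apply, vecMulVec_apply, Pi.smul_apply, Pi.sub_apply, smul_eq_mul, Pi.single_apply]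
    have c1 : Continuous fun y : PX p q × PX p q => ((if i = i0 then y.2.1 i1 else 0) - if i = i1 then y.2.1 i0 else 0) := by
      split_ifs <;> fun_prop
    have c2 : Continuous fun y : PX p q × PX p q => ((if i = i1 then y.1.1 i0 else 0) - if i = i0 then y.1.1 i1 else 0) := by
      split_ifs <;> fun_prop
    have c3 : Continuous fun y : PX p q × PX p q => y.1.2 j := by fun_prop
    have c4 : Continuous fun y : PX p q × PX p q => y.2.2 j := by fun_prop
    exact ((hinv.fun_mul c1.continuousAt).fun_mul c3.continuousAt).fun_add ((hinv.fun_mul c2.continuousAt).fun_mul c4.continuousAt)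
  have hZ0 : Z0 y0 = 0 := by
    ext i j; simp [Z0, y0, vecMulVec_apply]
  have hev : ∀ᶠ y in nhds y0, Z0 y ∈ typeIDomain p q ∧ Δ y ≠ 0 := by
    refine (hZc.eventually_mem ((dom_open p q).mem_nhds ?_)).and (hΔc.continuousAt.eventually_ne ?_)
    · rw [hZ0]; exact zero_mem_dom p q
    · rw [hΔ0]; exact one_ne_zero
  obtain ⟨ε, hε, h⟩ := Metric.eventually_nhds_iff.1 hev
  refine ⟨ε, hε, fun x v hx hv => ?_⟩
  obtain ⟨h1, h2⟩ := @h (x, v) (by rw [Prod.dist_eq]; exact max_lt hx hv)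
  have e1 : x.1 ⬝ᵥ κx (x, v) = 1 := by
    simp only [κx, dotProduct_smul, dotProduct_sub, dotProduct_single, smul_eq_mul]
    exact inv_mul_cancel₀ h2
  have e2 : v.1 ⬝ᵥ κx (x, v) = 0 := by
    simp only [κx, dotProduct_smul, dotProduct_sub, dotProduct_single, smul_eq_mul]
    rw [mul_comm (v.1 i0), sub_self, mul_zero]
  have e3 : x.1 ⬝ᵥ κv (x, v) = 0 := by
    simp only [κv, dotProduct_smul, dotProduct_sub, dotProduct_single, smul_eq_mul]
    rw [mul_comm (x.1 i0), sub_self, mul_zero]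
  have e4 : v.1 ⬝ᵥ κv (x, v) = 1 := by
    simp only [κv, dotProduct_smul, dotProduct_sub, dotProduct_single, smul_eq_mul]
    rw [mul_comm (v.1 i1), mul_comm (v.1 i0)]
    exact inv_mul_cancel₀ h2
  refine ⟨κx (x, v), Z0 (x, v), h1, e1, e2, ?_, ?_⟩
  · simp [Z0, vecMul_add, vecMul_vecMulVec, e1, e3]
  · simp [Z0, vecMul_add, vecMul_vecMulVec, e2, e4]

/-- moving a point of the fibre of `x0` to the fibre of `x`. -/
noncomputable def Zd {p q : ℕ} (A0 : Fin p → ℂ) (Z : Matrix (Fin p) (Fin q) ℂ) (x : PX p q) : Matrix (Fin p) (Fin q) ℂ :=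
  Z + vecMulVec ((x.1 ⬝ᵥ star A0)⁻¹ • star A0) (x.2 - x.1 ᵥ* Z)

theorem Zd_fib {p q : ℕ} (A0 : Fin p → ℂ) (Z : Matrix (Fin p) (Fin q) ℂ) (x : PX p q) (h : x.1 ⬝ᵥ star A0 ≠ 0) : x.1 ᵥ* Zd A0 Z x = x.2 := by
  rw [Zd, vecMul_add, vecMul_vecMulVec, dotProduct_smul, smul_eq_mul, inv_mul_cancel₀ h, one_smul]
  abel

theorem Zd_self {p q : ℕ} (A0 : Fin p → ℂ) (Z : Matrix (Fin p) (Fin q) ℂ) (x : PX p q) (h : x.1 ᵥ* Z = x.2) : Zd A0 Z x = Z := by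
  rw [Zd, h, sub_self]; ext; simp [vecMulVec_apply]

theorem Zd_cont {p q : ℕ} (A0 : Fin p → ℂ) (Z : Matrix (Fin p) (Fin q) ℂ) : ContinuousOn (Zd A0 Z) {x : PX p q | x.1 ⬝ᵥ star A0 ≠ 0} := by
  intro x hx
  refine ContinuousAt.continuousWithinAt ?_
  have hd : Continuous fun x : PX p q => x.1 ⬝ᵥ star A0 := by
    exact continuous_fst.dotProduct continuous_const
  have hinv : ContinuousAt (fun x : PX p q => (x.1 ⬝ᵥ star A0)⁻¹) x := hd.continuousAt.inv₀ hx
  refine continuousAt_pi.2 fun i => continuousAt_pi.2 fun j => ?_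
  simp only [Zd, Matrix.add_apply, vecMulVec_apply, Pi.smul_apply, Pi.sub_apply, smul_eq_mul]
  have c3 : Continuous fun y : PX p q => y.2 j - (y.1 ᵥ* Z) j := by
    simp only [vecMul, dotProduct]; fun_prop
  exact continuousAt_const.fun_add ((hinv.fun_mul continuousAt_const).fun_mul c3.continuousAt)

set_option maxHeartbeats 1000000 in
theorem cont_sel {p q p' q' : ℕ} {f : Matrix (Fin p) (Fin q) ℂ → Matrix (Fin p') (Fin q') ℂ}
    (hf : DifferentiableOn ℂ f (typeIDomain p q)) (hV1 : ∀ x ∈ genBallCone p q, ∃ C : Fin p' → ℂ, C ≠ 0 ∧ InV f x C)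
    (x0 : PX p q) (hx0 : x0 ∈ genBallCone p q) (C0 : Fin p' → ℂ) (k : Fin p') (hk : C0 k ≠ 0) (hu : ∀ C, InV f x0 C → ∃ c : ℂ, C = c • C0) :
    ∃ N : Set (PX p q), IsOpen N ∧ x0 ∈ N ∧ N ⊆ genBallCone p q ∧ ∃ (h : PX p q → (Fin p' → ℂ)) (g : PX p q → (Fin q' → ℂ)), 
      ContinuousOn h N ∧ ContinuousOn g N ∧ ∀ x ∈ N, InV f x (h x) ∧ h x k = 1 ∧ ∀ Z ∈ typeIDomain p q, x.1 ᵥ* Z = x.2 → h x ᵥ* f Z = g x := by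
  obtain ⟨Zs, hZs, hZsx⟩ := fiber_nonempty x0.1 x0.2 hx0
  have hA0 : x0.1 ⬝ᵥ star x0.1 ≠ 0 := by
    rw [← nsq_eq_dot]
    have : 0 < nsq x0.1 := (nsq_nonneg _).trans_lt hx0
    exact_mod_cast this.ne'
  let S := {Z : Matrix (Fin p) (Fin q) ℂ // Z ∈ typeIDomain p q ∧ x0.1 ᵥ* Z = x0.2}
  let zs : S := ⟨Zs, hZs, hZsx⟩
  obtain ⟨s, hs⟩ := exists_det_of_ann_opt (J := S × S × Fin q') (fun J => fcol f J.2.2 J.1.1 - fcol f J.2.2 J.2.1.1) C0 k hk (by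
    intro C hC
    refine hu C fun Z hZ Z' hZ' h1 h2 => ?_
    ext j
    have := hC (⟨Z, hZ, h1⟩, ⟨Z', hZ', h2⟩, j)
    rw [dotProduct_sub, sub_eq_zero] at this
    exact this)
  let z1 : Fin p' → S := fun i => (s i).elim zs (fun J => J.1)
  let z2 : Fin p' → S := fun i => (s i).elim zs (fun J => J.2.1)
  let M : PX p q → Matrix (Fin p') (Fin p') ℂ := fun x => Matrix.of fun i => (s i).elim (Pi.single k 1)
    (fun J => fcol f J.2.2 (Zd x0.1 J.1.1 x) - fcol f J.2.2 (Zd x0.1 J.2.1.1 x))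
  let N1 : Set (PX p q) := {x : PX p q | x.1 ⬝ᵥ star x0.1 ≠ 0}
  have hN1 : IsOpen N1 := isOpen_ne_fun (continuous_fst.dotProduct continuous_const) continuous_const
  let T : S → Set (PX p q) := fun z => N1 ∩ (Zd x0.1 z.1) ⁻¹' (typeIDomain p q)
  have hT : ∀ z, IsOpen (T z) := fun z => (Zd_cont x0.1 z.1).isOpen_inter_preimage hN1 (dom_open p q)
  have hTx : ∀ z, x0 ∈ T z := fun z => ⟨hA0, by
    show Zd x0.1 z.1 x0 ∈ typeIDomain p q
    rw [Zd_self _ _ _ z.2.2]; exact z.2.1⟩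
  let N2 : Set (PX p q) := (genBallCone p q ∩ T zs) ∩ ⋂ i, (T (z1 i) ∩ T (z2 i))
  have hN2 : IsOpen N2 := ((cone_open p q).inter (hT _)).inter (isOpen_iInter_of_finite fun i => (hT _).inter (hT _))
  have hN2x : x0 ∈ N2 := ⟨⟨hx0, hTx _⟩, Set.mem_iInter.2 fun i => ⟨hTx _, hTx _⟩⟩
  have hfc : ∀ z : S, ∀ j, ContinuousOn (fun x => fcol f j (Zd x0.1 z.1 x)) (T z) := by
    intro z j
    exact (fcol_diff hf j).continuousOn.comp ((Zd_cont x0.1 z.1).mono Set.inter_subset_left) fun x hx => hx.2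
  have hMc : ContinuousOn M N2 := by
    refine continuousOn_pi.2 fun i => ?_
    have hi1 : N2 ⊆ T (z1 i) := fun x hx => (Set.mem_iInter.1 hx.2 i).1
    have hi2 : N2 ⊆ T (z2 i) := fun x hx => (Set.mem_iInter.1 hx.2 i).2
    simp only [z1, z2] at hi1 hi2
    cases hsi : s i with
    | none =>
      have e : (fun x => M x i) = fun _ => (Pi.single k 1 : Fin p' → ℂ) := by funext x; ext l; simp only [M, of_apply, hsi, Option.elim]
      rw [e]; exact continuousOn_const
    | some J =>
      rw [hsi] at hi1 hi2
      have e : (fun x => M x i) = fun x => fcol f J.2.2 (Zd x0.1 J.1.1 x) - fcol f J.2.2 (Zd x0.1 J.2.1.1 x) := by funext x; ext l; simp only [M, of_apply, hsi, Option.elim]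
      rw [e]
      exact ((hfc J.1 J.2.2).mono hi1).fun_sub ((hfc J.2.1 J.2.2).mono hi2)
  have hdet : ContinuousOn (fun x => (M x).det) N2 := (Continuous.matrix_det continuous_id).comp_continuousOn hMc
  let N := N2 ∩ (fun x => (M x).det) ⁻¹' {0}ᶜ
  have hN : IsOpen N := hdet.isOpen_inter_preimage hN2 isOpen_compl_singleton
  have hMx0 : (M x0).det ≠ 0 := by
    have : M x0 = Matrix.of fun i => (s i).elim (Pi.single k 1) (fun J => fcol f J.2.2 J.1.1 - fcol f J.2.2 J.2.1.1) := by
      ext i : 1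
      simp only [M, of_apply]
      cases s i with
      | none => rfl
      | some J => simp only [Option.elim]; rw [Zd_self _ _ _ J.1.2.2, Zd_self _ _ _ J.2.1.2.2]
    rw [this]; exact hs
  let ρ : Fin p' → ℂ := fun i => (s i).elim 1 (fun _ => 0)
  let h : PX p q → (Fin p' → ℂ) := fun x => ((M x).det)⁻¹ • ((M x).adjugate *ᵥ ρ)
  have hhc : ContinuousOn h N := by
    refine ContinuousOn.smul ((hdet.mono Set.inter_subset_left).inv₀ fun x hx => hx.2) ?_
    have : Continuous fun M : Matrix (Fin p') (Fin p') ℂ => M.adjugate *ᵥ ρ := (Continuous.matrix_adjugate continuous_id).matrix_mulVec continuous_const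
    exact this.comp_continuousOn (hMc.mono Set.inter_subset_left)
  have hkey : ∀ x ∈ N, ∀ C, InV f x C → M x *ᵥ C = C k • ρ := by
    intro x hx C hC
    ext i
    simp only [mulVec, M, of_apply, ρ, Pi.smul_apply, smul_eq_mul]
    have hi1 : x ∈ T (z1 i) := (Set.mem_iInter.1 hx.1.2 i).1
    have hi2 : x ∈ T (z2 i) := (Set.mem_iInter.1 hx.1.2 i).2
    simp only [z1, z2] at hi1 hi2
    cases hsi : s i with
    | none => simp
    | some J =>
      rw [hsi] at hi1 hi2
      simp only [Option.elim, mul_zero] at hi1 hi2 ⊢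
      rw [dotProduct_comm, dotProduct_sub, sub_eq_zero]
      exact congrFun (hC _ hi1.2 _ hi2.2 (Zd_fib _ _ _ hi1.1) (Zd_fib _ _ _ hi1.1)) J.2.2
  have hsol : ∀ x ∈ N, ∀ C, InV f x C → C = C k • h x := by
    intro x hx C hC
    have h1 := hkey x hx C hC
    have hd : (M x).det ≠ 0 := hx.2
    have h2 : (M x).adjugate *ᵥ (M x *ᵥ C) = (M x).det • C := by
      rw [mulVec_mulVec, adjugate_mul, smul_mulVec, one_mulVec]
    rw [h1, mulVec_smul] at h2
    simp only [h]
    rw [smul_comm, h2, smul_smul, inv_mul_cancel₀ hd, one_smul]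
  have hInV : ∀ x ∈ N, InV f x (h x) ∧ h x k = 1 := by
    intro x hx
    obtain ⟨C, hC0, hC⟩ := hV1 x hx.1.1.1
    have h1 := hsol x hx C hC
    have hCk : C k ≠ 0 := by
      intro h0; rw [h0, zero_smul] at h1; exact hC0 h1
    have h2 : h x = (C k)⁻¹ • C := by
      rw [eq_inv_smul_iff₀ hCk]; exact h1.symm
    refine ⟨?_, ?_⟩
    · rw [h2]
      intro Z hZ Z' hZ' e1 e2
      rw [smul_vecMul, smul_vecMul, hC Z hZ Z' hZ' e1 e2]
    · rw [h2]; simp [hCk]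
  refine ⟨N, hN, ⟨hN2x, hMx0⟩, fun x hx => hx.1.1.1, h, fun x => h x ᵥ* f (Zd x0.1 Zs x), hhc, ?_, ?_⟩
  · refine continuousOn_pi.2 fun j => ?_
    have hsub : N ⊆ T zs := fun x hx => hx.1.1.2
    have hz := (hfc zs j).mono hsub
    have e : (fun x => (h x ᵥ* f (Zd x0.1 Zs x)) j) = fun x => ∑ i, h x i * fcol f j (Zd x0.1 Zs x) i := rfl
    rw [e]
    exact continuousOn_finsetSum _ fun i _ => (continuousOn_pi.1 hhc i).fun_mul (continuousOn_pi.1 hz i)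
  · intro x hx
    refine ⟨(hInV x hx).1, (hInV x hx).2, fun Z hZ hxZ => ?_⟩
    exact (hInV x hx).1 _ hZ _ hx.1.1.2.2 hxZ (Zd_fib _ _ _ hx.1.1.2.1)

/-- linear substitution -/
noncomputable def msub {n : ℕ} (e : (Fin n → ℂ) →ₗ[ℂ] (Fin n → ℂ)) (a : MvPolynomial (Fin n) ℂ) : MvPolynomial (Fin n) ℂ :=
  MvPolynomial.bind₁ (fun i => ∑ j, MvPolynomial.C (e (Pi.single j 1) i) * MvPolynomial.X j) a

theorem msub_eval {n : ℕ} (e : (Fin n → ℂ) →ₗ[ℂ] (Fin n → ℂ)) (a : MvPolynomial (Fin n) ℂ) (y : Fin n → ℂ) :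
    MvPolynomial.eval y (msub e a) = MvPolynomial.eval (e y) a := by
  rw [msub, ← MvPolynomial.coe_aeval_eq_eval, RingHom.coe_coe, MvPolynomial.aeval_bind₁]
  rw [← MvPolynomial.coe_aeval_eq_eval, RingHom.coe_coe]
  congr 2
  funext i
  have : e y i = ∑ j, y j * e (Pi.single j 1) i := by
    conv_lhs => rw [pi_eq_sum_univ' y]
    simp [map_sum, Finset.sum_apply]
  rw [this]
  simp [mul_comm]

theorem hurwitz_lin {n : ℕ} (e : (Fin n → ℂ) ≃ₗ[ℂ] (Fin n → ℂ)) {N : Set (Fin n → ℂ)} (hN : IsOpen N) (hne : N.Nonempty)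
    (h : (Fin n → ℂ) → ℂ) (hc : ContinuousOn h N)
    (hr : ∀ y ∈ N, ∀ i, ∃ a b : Polynomial ℂ, b ≠ 0 ∧ ∀ t : ℂ, y + t • e (Pi.single i 1) ∈ N → b.eval t * h (y + t • e (Pi.single i 1)) = a.eval t) :
    ∃ O ⊆ N, IsOpen O ∧ O.Nonempty ∧ ∃ a b : MvPolynomial (Fin n) ℂ, b ≠ 0 ∧ ∀ y ∈ O, MvPolynomial.eval y b * h y = MvPolynomial.eval y a := by
  have hec : Continuous e := e.toLinearMap.continuous_of_finiteDimensional
  have hec' : Continuous e.symm := e.symm.toLinearMap.continuous_of_finiteDimensional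
  obtain ⟨W', hW'W, hW'o, ⟨w0, hw0⟩, a, b, hb, hab⟩ := hurwitz n (e ⁻¹' N) (hN.preimage hec)
    (by obtain ⟨y, hy⟩ := hne; exact ⟨e.symm y, by simpa using hy⟩) (fun w => h (e w))
    (hc.comp hec.continuousOn fun w hw => hw) (by
      intro w hw i
      obtain ⟨a, b, hb, hab⟩ := hr (e w) hw i
      refine ⟨a.comp (Polynomial.X - Polynomial.C (w i)), b.comp (Polynomial.X - Polynomial.C (w i)), ?_, fun t ht => ?_⟩
      · intro h0
        apply hb
        have := congrArg (fun r => Polynomial.comp r (Polynomial.X + Polynomial.C (w i))) h0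
        simpa [Polynomial.comp_assoc] using this
      · have e1 : Function.update w i t = w + (t - w i) • Pi.single i 1 := by
          ext j
          by_cases hj : j = i
          · subst hj; simp
          · simp [hj]
        have e2 : e (Function.update w i t) = e w + (t - w i) • e (Pi.single i 1) := by
          rw [e1, map_add, map_smul]
        have h3 : e (Function.update w i t) ∈ N := ht
        simp only [Polynomial.eval_comp, Polynomial.eval_sub, Polynomial.eval_X, Polynomial.eval_C]
        rw [e2] at h3 ⊢
        exact hab _ h3)
  refine ⟨e.symm ⁻¹' W', fun y hy => by simpa using hW'W hy, hW'o.preimage hec', ⟨e w0, by simpa using hw0⟩, msub e.symm a, msub e.symm b, ?_, ?_⟩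
  · intro h0
    apply hb
    refine MvPolynomial.funext fun w => ?_
    have := congrArg (MvPolynomial.eval (e w)) h0
    rw [msub_eval] at this
    simpa using this
  · intro y hy
    have := hab _ hy
    rw [msub_eval, msub_eval]
    simpa using this

theorem hurwitz_fin {n : ℕ} (e : (Fin n → ℂ) ≃ₗ[ℂ] (Fin n → ℂ)) {ι : Type} [DecidableEq ι] (s : Finset ι) {N : Set (Fin n → ℂ)} (hN : IsOpen N) (hne : N.Nonempty)
    (h : ι → (Fin n → ℂ) → ℂ) (hc : ∀ m, ContinuousOn (h m) N)
    (hr : ∀ m, ∀ y ∈ N, ∀ i, ∃ a b : Polynomial ℂ, b ≠ 0 ∧ ∀ t : ℂ, y + t • e (Pi.single i 1) ∈ N → b.eval t * h m (y + t • e (Pi.single i 1)) = a.eval t) :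
    ∃ O ⊆ N, IsOpen O ∧ O.Nonempty ∧ ∃ (a : ι → MvPolynomial (Fin n) ℂ) (b : MvPolynomial (Fin n) ℂ), b ≠ 0 ∧ ∀ m ∈ s, ∀ y ∈ O, MvPolynomial.eval y b * h m y = MvPolynomial.eval y (a m) := by
  induction s using Finset.induction_on with
  | empty => exact ⟨N, le_rfl, hN, hne, fun _ => 0, 1, one_ne_zero, by simp⟩
  | insert m s hm ih =>
    obtain ⟨O, hON, hO, hOne, a, b, hb, hab⟩ := ih
    obtain ⟨O', hO'O, hO', hO'ne, a', b', hb', hab'⟩ := hurwitz_lin e hO hOne (h m) ((hc m).mono hON) (by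
      intro y hy i
      obtain ⟨a, b, hb, hab⟩ := hr m y (hON hy) i
      exact ⟨a, b, hb, fun t ht => hab t (hON ht)⟩)
    refine ⟨O', hO'O.trans hON, hO', hO'ne, fun m' => if m' = m then a' * b else b' * a m', b' * b, mul_ne_zero hb' hb, ?_⟩
    intro m' hm' y hy
    rcases Finset.mem_insert.1 hm' with rfl | h1
    · simp only [if_true, map_mul, ← hab' y hy]; ring
    · have : m' ≠ m := fun h => hm (h ▸ h1)
      simp only [if_neg this, map_mul, ← hab m' h1 y (hO'O hy)]; ring

/-- splitting of coordinates -/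
def spl {p q : ℕ} (y : Fin (p + q) → ℂ) : PX p q := (fun i => y (Fin.castAdd q i), fun j => y (Fin.natAdd p j))

theorem spl_append {p q : ℕ} (x : PX p q) : spl (Fin.append x.1 x.2) = x := by
  ext <;> simp [spl]

theorem append_spl {p q : ℕ} (y : Fin (p+q) → ℂ) : Fin.append (spl y).1 (spl y).2 = y := by
  ext i
  refine Fin.addCases (fun i => ?_) (fun j => ?_) i <;> simp [spl]

theorem spl_cont {p q : ℕ} : Continuous (spl (p := p) (q := q)) := by
  unfold spl; fun_prop

theorem append_cont {p q : ℕ} : Continuous fun x : PX p q => Fin.append x.1 x.2 := by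
  refine continuous_pi fun i => ?_
  refine Fin.addCases (fun i => ?_) (fun j => ?_) i
  · simp only [Fin.append_left]; fun_prop
  · simp only [Fin.append_right]; fun_prop

/-- coordinates adapted to `v` -/
noncomputable def lam {n : ℕ} (i1 : Fin n) (δ : ℝ) (hδ : 0 < δ) : (Fin n → ℂ) ≃ₗ[ℂ] (Fin n → ℂ) :=
  LinearEquiv.ofInjectiveEndo
    ({ toFun := fun w => (∑ i, w i) • Pi.single i1 1 + (δ : ℂ) • w
       map_add' := by intro x y; simp only [Pi.add_apply, Finset.sum_add_distrib, smul_add, add_smul]; abel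
       map_smul' := by intro c x; simp only [Pi.smul_apply, ← Finset.smul_sum, smul_add, smul_smul, RingHom.id_apply, smul_eq_mul, ← Finset.mul_sum]; rw [mul_comm c (δ : ℂ)] } : (Fin n → ℂ) →ₗ[ℂ] (Fin n → ℂ))
    (by
      rw [injective_iff_map_eq_zero]
      intro w hw
      have hw' : (∑ i, w i) • Pi.single i1 1 + (δ : ℂ) • w = 0 := hw
      have h1 : ∑ i, ((∑ i, w i) • Pi.single i1 1 + (δ : ℂ) • w : Fin n → ℂ) i = 0 := by rw [hw']; simp
      simp only [Pi.add_apply, Pi.smul_apply, smul_eq_mul, Finset.sum_add_distrib, ← Finset.mul_sum, Finset.sum_pi_single', Finset.mem_univ, if_true, Pi.single_apply, Finset.sum_ite_eq', mul_one] at h1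
      have h2 : (1 + (δ : ℂ)) * ∑ i, w i = 0 := by linear_combination h1
      have h3 : (1 + (δ : ℂ)) ≠ 0 := by exact_mod_cast (by positivity : (1 + δ) ≠ 0)
      have h4 := (mul_eq_zero.1 h2).resolve_left h3
      rw [h4, zero_smul, zero_add] at hw'
      exact (smul_eq_zero.1 hw').resolve_left (by exact_mod_cast hδ.ne'))

theorem lam_single {n : ℕ} (i1 : Fin n) (δ : ℝ) (hδ : 0 < δ) (i : Fin n) : lam i1 δ hδ (Pi.single i 1) = Pi.single i1 1 + (δ : ℂ) • Pi.single i 1 := by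
  have : lam i1 δ hδ (Pi.single i 1) = (∑ j, (Pi.single i 1 : Fin n → ℂ) j) • Pi.single i1 1 + (δ : ℂ) • Pi.single i 1 := rfl
  rw [this]; simp

theorem rat_local {p q p' q' : ℕ} (h2p : 2 ≤ p) {f : Matrix (Fin p) (Fin q) ℂ → Matrix (Fin p') (Fin q') ℂ}
    (hf : DifferentiableOn ℂ f (typeIDomain p q)) (hV1 : ∀ x ∈ genBallCone p q, ∃ C : Fin p' → ℂ, C ≠ 0 ∧ InV f x C)
    (U0 : Set (PX p q)) (hU0o : IsOpen U0) (hU0d : genBallCone p q ⊆ closure U0)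
    (hU0u : ∀ x ∈ U0, ∃ C0 : Fin p' → ℂ, C0 ≠ 0 ∧ ∀ C, InV f x C → ∃ c : ℂ, C = c • C0) (hU0s : U0 ⊆ genBallCone p q) :
    ∃ (k : Fin p') (P1 : Fin p' → MvPolynomial (Fin (p+q)) ℂ) (P2 : Fin q' → MvPolynomial (Fin (p+q)) ℂ), P1 k ≠ 0 ∧
      ∃ O : Set (Fin (p+q) → ℂ), IsOpen O ∧ O.Nonempty ∧ ∀ y ∈ O, spl y ∈ genBallCone p q ∧ ∀ Z ∈ typeIDomain p q, (spl y).1 ᵥ* Z = (spl y).2 →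
        (fun i => MvPolynomial.eval y (P1 i)) ᵥ* f Z = fun j => MvPolynomial.eval y (P2 j) := by
  let i0 : Fin p := ⟨0, by omega⟩
  let i1 : Fin p := ⟨1, by omega⟩
  obtain ⟨ε, hε, hgp⟩ := good_pair (p := p) q i0 i1 (by simp [i0, i1])
  have he0 : ((Pi.single i0 1, 0) : PX p q) ∈ genBallCone p q := by
    rw [mem_cone]
    rw [nsq_zero]
    refine nsq_pos ?_
    intro h
    have := congrFun h i0
    simp at this
  obtain ⟨x0, hx0b, hx0U⟩ := mem_closure_iff.1 (hU0d he0) (Metric.ball _ ε) Metric.isOpen_ball (Metric.mem_ball_self hε)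
  obtain ⟨C0, hC0, hC0u⟩ := hU0u x0 hx0U
  obtain ⟨k, hk⟩ := Function.ne_iff.1 hC0
  obtain ⟨N, hN, hx0N, hNc, h, g, hhc, hgc, hh⟩ := cont_sel hf hV1 x0 (hU0s hx0U) C0 k hk hC0u
  let N' : Set (Fin (p+q) → ℂ) := spl ⁻¹' (N ∩ U0 ∩ Metric.ball (Pi.single i0 1, 0) ε)
  have hN' : IsOpen N' := ((hN.inter hU0o).inter Metric.isOpen_ball).preimage spl_cont
  have hN'ne : N'.Nonempty := ⟨Fin.append x0.1 x0.2, by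
    simp only [N', Set.mem_preimage, spl_append]; exact ⟨⟨hx0N, hx0U⟩, hx0b⟩⟩
  have hδ : 0 < ε / 2 := half_pos hε
  let e := lam (Fin.castAdd q i1) (ε/2) hδ
  have hev : ∀ i, dist (spl (e (Pi.single i 1)) : PX p q) (Pi.single i1 1, 0) < ε := by
    intro i
    have e1 : (spl (e (Pi.single i 1)) : PX p q) = (Pi.single i1 1, 0) + ((ε/2 : ℝ) : ℂ) • spl (Pi.single i 1) := by
      simp only [e]
      rw [lam_single]
      have : (spl (Pi.single (Fin.castAdd q i1) 1) : PX p q) = (Pi.single i1 1, 0) := by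
        ext j
        · simp [spl, Pi.single_apply]
        · simp [spl, Pi.single_apply, Fin.ext_iff]; omega
      rw [← this]; rfl
    rw [e1, dist_eq_norm, add_sub_cancel_left, norm_smul]
    have e2 : ‖(spl (Pi.single i 1) : PX p q)‖ ≤ 1 := by
      refine norm_prod_le_iff.2 ⟨(pi_norm_le_iff_of_nonneg zero_le_one).2 fun j => ?_, (pi_norm_le_iff_of_nonneg zero_le_one).2 fun j => ?_⟩ <;>
      · simp only [spl, Pi.single_apply]; split_ifs <;> simp
    rw [Complex.norm_real, Real.norm_of_nonneg hδ.le]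
    nlinarith
  let F : Fin p' ⊕ Fin q' → (Fin (p+q) → ℂ) → ℂ := fun m y => Sum.elim (h (spl y)) (g (spl y)) m
  have hsub : Set.MapsTo spl N' N := fun y hy => hy.1.1
  have hFc : ∀ m, ContinuousOn (F m) N' := by
    rintro (m | m)
    · exact (continuousOn_pi.1 hhc m).comp spl_cont.continuousOn hsub
    · exact (continuousOn_pi.1 hgc m).comp spl_cont.continuousOn hsub
  have hFr : ∀ m, ∀ y ∈ N', ∀ i, ∃ a b : Polynomial ℂ, b ≠ 0 ∧ ∀ t : ℂ, y + t • e (Pi.single i 1) ∈ N' → b.eval t * F m (y + t • e (Pi.single i 1)) = a.eval t := by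
    intro m y hy i
    obtain ⟨κ, Z0, hZ0, hκx, hκv, hxZ, hvZ⟩ := hgp (spl y) (spl (e (Pi.single i 1))) hy.2 (hev i)
    obtain ⟨C1, hC1, hC1u⟩ := hU0u _ hy.1.2
    have hk1 : C1 k ≠ 0 := by
      obtain ⟨c, hc⟩ := hC1u _ (hh _ hy.1.1).1
      have h1 := (hh _ hy.1.1).2.1
      rw [hc] at h1
      intro h0
      simp [h0] at h1
    obtain ⟨b, a, a2, hb, hab⟩ := line_rat hf (spl y) (spl (e (Pi.single i 1))) hZ0 hxZ hvZ κ hκx hκv 0 C1 k hk1 (by simpa using hC1u)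
    have hspl : ∀ t : ℂ, spl (y + t • e (Pi.single i 1)) = spl y + t • spl (e (Pi.single i 1)) := fun t => rfl
    rcases m with m | m
    · refine ⟨a m, b, hb, fun t ht => ?_⟩
      have := hh _ ht.1.1
      exact ((hab t (h (spl y + t • spl (e (Pi.single i 1)))) this.2.1 this.1).1 m)
    · refine ⟨a2 m, b, hb, fun t ht => ?_⟩
      have h1 := hh _ ht.1.1
      obtain ⟨Z1, hZ1, hZ1x⟩ := fiber_nonempty _ _ (hNc ht.1.1)
      have h2 := (hab t (h (spl y + t • spl (e (Pi.single i 1)))) h1.2.1 h1.1).2 Z1 hZ1 hZ1x m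
      rw [← h2]
      have h3 := h1.2.2 Z1 hZ1 hZ1x
      have h4 : F (Sum.inr m) (y + t • e (Pi.single i 1)) = g (spl (y + t • e (Pi.single i 1))) m := rfl
      rw [h4, ← h3]; rfl
  obtain ⟨O, hON, hO, hOne, a, b, hb, hab⟩ := hurwitz_fin e Finset.univ hN' hN'ne F hFc hFr
  refine ⟨k, fun i => a (Sum.inl i), fun j => a (Sum.inr j), ?_, O, hO, hOne, fun y hy => ⟨hNc (hON hy).1.1, fun Z hZ hyZ => ?_⟩⟩
  · intro h0
    apply hb
    refine mvpoly_open hO hOne b fun w hw => ?_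
    have := hab (Sum.inl k) (Finset.mem_univ _) w hw
    simp only [h0, map_zero] at this
    have h1 : F (Sum.inl k) w = 1 := (hh _ (hON hw).1.1).2.1
    rwa [h1, mul_one] at this
  · have h1 := (hh _ (hON hy).1.1).2.2 Z hZ hyZ
    have e1 : (fun i => MvPolynomial.eval y (a (Sum.inl i))) = MvPolynomial.eval y b • h (spl y) := by
      ext i
      exact (hab (Sum.inl i) (Finset.mem_univ _) y hy).symm
    have e2 : (fun i => MvPolynomial.eval y (a (Sum.inr i))) = MvPolynomial.eval y b • g (spl y) := by
      ext i
      exact (hab (Sum.inr i) (Finset.mem_univ _) y hy).symm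
    rw [e1, e2, smul_vecMul, h1]

theorem mvpoly_diff {n : ℕ} {E : Type*} [NormedAddCommGroup E] [NormedSpace ℂ E] {D : Set E} {Y : E → Fin n → ℂ} (hY : DifferentiableOn ℂ Y D) (P : MvPolynomial (Fin n) ℂ) :
    DifferentiableOn ℂ (fun e => MvPolynomial.eval (Y e) P) D := by
  induction P using MvPolynomial.induction_on with
  | C a => simpa using differentiableOn_const a
  | add a b ha hb => simp only [map_add]; exact ha.fun_add hb
  | mul_X a i ha => simp only [map_mul, MvPolynomial.eval_X]; exact ha.fun_mul (differentiableOn_pi.1 hY i)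

/-- the evaluation polynomials vector -/
noncomputable def ev {n m : ℕ} (P : Fin m → MvPolynomial (Fin n) ℂ) (y : Fin n → ℂ) : Fin m → ℂ := fun i => MvPolynomial.eval y (P i)

theorem ev_cont {n m : ℕ} (P : Fin m → MvPolynomial (Fin n) ℂ) : Continuous (ev P) := continuous_pi fun i => mvpoly_cont (P i)

theorem ev_diff {n m : ℕ} {E : Type*} [NormedAddCommGroup E] [NormedSpace ℂ E] {D : Set E} {Y : E → Fin n → ℂ} (hY : DifferentiableOn ℂ Y D) (P : Fin m → MvPolynomial (Fin n) ℂ) :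
    DifferentiableOn ℂ (fun e => ev P (Y e)) D := differentiableOn_pi.2 fun i => mvpoly_diff hY (P i)

theorem glob {p q p' q' : ℕ} {f : Matrix (Fin p) (Fin q) ℂ → Matrix (Fin p') (Fin q') ℂ}
    (hf : DifferentiableOn ℂ f (typeIDomain p q)) (P1 : Fin p' → MvPolynomial (Fin (p+q)) ℂ) (P2 : Fin q' → MvPolynomial (Fin (p+q)) ℂ)
    (O : Set (Fin (p+q) → ℂ)) (hO : IsOpen O) (hne : O.Nonempty) (h : ∀ y ∈ O, spl y ∈ genBallCone p q ∧ ∀ Z ∈ typeIDomain p q, (spl y).1 ᵥ* Z = (spl y).2 →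
        (fun i => MvPolynomial.eval y (P1 i)) ᵥ* f Z = fun j => MvPolynomial.eval y (P2 j)) :
    ∀ A : Fin p → ℂ, ∀ Z ∈ typeIDomain p q, ev P1 (Fin.append A (A ᵥ* Z)) ᵥ* f Z = ev P2 (Fin.append A (A ᵥ* Z)) := by
  intro A Z hZ
  ext j
  let Y : (Fin p → ℂ) × Matrix (Fin p) (Fin q) ℂ → (Fin (p+q) → ℂ) := fun e => Fin.append e.1 (e.1 ᵥ* e.2)
  have hYd : Differentiable ℂ Y := by
    refine differentiable_pi.2 fun i => ?_
    refine Fin.addCases (fun i => ?_) (fun j => ?_) i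
    · simp only [Y, Fin.append_left]; fun_prop
    · simp only [Y, Fin.append_right, vecMul, dotProduct]
      refine Differentiable.fun_sum fun i _ => ?_
      have h1 : Differentiable ℂ fun e : (Fin p → ℂ) × Matrix (Fin p) (Fin q) ℂ => e.2 i j := by
        have := differentiable_pi.1 (differentiable_pi.1 (differentiable_snd (𝕜 := ℂ) (E := Fin p → ℂ) (F := Matrix (Fin p) (Fin q) ℂ)) i) j
        exact this
      have h2 : Differentiable ℂ fun e : (Fin p → ℂ) × Matrix (Fin p) (Fin q) ℂ => e.1 i := by fun_prop
      exact h2.fun_mul h1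
  let D : Set ((Fin p → ℂ) × Matrix (Fin p) (Fin q) ℂ) := Set.univ ×ˢ typeIDomain p q
  have hD : IsOpen D := isOpen_univ.prod (dom_open p q)
  let u : (Fin p → ℂ) × Matrix (Fin p) (Fin q) ℂ → ℂ := fun e => ∑ i, MvPolynomial.eval (Y e) (P1 i) * fcol f j e.2 i - MvPolynomial.eval (Y e) (P2 j)
  have hu : DifferentiableOn ℂ u D := by
    refine DifferentiableOn.fun_sub (DifferentiableOn.fun_sum fun i _ => (mvpoly_diff hYd.differentiableOn _).fun_mul ?_) (mvpoly_diff hYd.differentiableOn _)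
    have h1 := (fcol_diff hf j).comp (s := D) (differentiable_snd (𝕜 := ℂ) (E := Fin p → ℂ) (F := Matrix (Fin p) (Fin q) ℂ)).differentiableOn (fun e he => he.2)
    exact differentiableOn_pi.1 h1 i
  obtain ⟨y0, hy0⟩ := hne
  obtain ⟨Z0, hZ0, hyZ0⟩ := fiber_nonempty _ _ (h y0 hy0).1
  have hY0 : Y ((spl y0).1, Z0) = y0 := by
    simp only [Y]; rw [hyZ0, append_spl]
  have := ident_star hD hu ((spl y0).1, Z0) ⟨trivial, hZ0⟩ (by
      intro X hX t h0 h1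
      exact ⟨trivial, dom_star hZ0 X.2 hX.2 t h0 h1⟩) (by
      have h1 : ∀ᶠ e in nhds ((spl y0).1, Z0), Y e ∈ O := by
        refine hYd.continuous.continuousAt.eventually_mem (hO.mem_nhds ?_)
        rw [hY0]; exact hy0
      filter_upwards [h1, hD.mem_nhds (show ((spl y0).1, Z0) ∈ D from ⟨trivial, hZ0⟩)] with e he he2
      have h2 := (h _ he).2 e.2 he2.2 (by
        have : spl (Y e) = (e.1, e.1 ᵥ* e.2) := spl_append (p := p) (q := q) (e.1, e.1 ᵥ* e.2)
        rw [this])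
      have h3 := congrFun h2 j
      exact sub_eq_zero.2 h3) (A, Z) ⟨trivial, hZ⟩
  exact sub_eq_zero.1 this

theorem homog_smul {n : ℕ} {P : MvPolynomial (Fin n) ℂ} {d : ℕ} (hP : P.IsHomogeneous d) (c : ℂ) (y : Fin n → ℂ) :
    MvPolynomial.eval (c • y) P = c ^ d * MvPolynomial.eval y P := by
  rw [MvPolynomial.eval_eq', MvPolynomial.eval_eq', Finset.mul_sum]
  refine Finset.sum_congr rfl fun m hm => ?_
  have h1 := hP (MvPolynomial.mem_support_iff.1 hm)
  have h2 : ∑ i, m i = d := by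
    rw [← h1, Finsupp.weight_apply, Finsupp.sum_fintype _ _ (by simp)]; simp
  simp only [Pi.smul_apply, smul_eq_mul, mul_pow, Finset.prod_mul_distrib, Finset.prod_pow_eq_pow_sum, h2]
  ring

theorem hom_sum {n : ℕ} (P : MvPolynomial (Fin n) ℂ) (M : ℕ) (hM : P.totalDegree < M) : P = ∑ d ∈ Finset.range M, MvPolynomial.homogeneousComponent d P := by
  conv_lhs => rw [← MvPolynomial.sum_homogeneousComponent P]
  refine Finset.sum_subset (by intro; simp; omega) fun d _ hd => MvPolynomial.homogeneousComponent_eq_zero _ _ (by simp at hd; omega)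

theorem homog {p q p' q' : ℕ} {f : Matrix (Fin p) (Fin q) ℂ → Matrix (Fin p') (Fin q') ℂ}
    (P1 : Fin p' → MvPolynomial (Fin (p+q)) ℂ) (P2 : Fin q' → MvPolynomial (Fin (p+q)) ℂ) (d : ℕ)
    (h : ∀ A : Fin p → ℂ, ∀ Z ∈ typeIDomain p q, ev P1 (Fin.append A (A ᵥ* Z)) ᵥ* f Z = ev P2 (Fin.append A (A ᵥ* Z))) :
    ∀ A : Fin p → ℂ, ∀ Z ∈ typeIDomain p q, ev (fun i => MvPolynomial.homogeneousComponent d (P1 i)) (Fin.append A (A ᵥ* Z)) ᵥ* f Z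
      = ev (fun i => MvPolynomial.homogeneousComponent d (P2 i)) (Fin.append A (A ᵥ* Z)) := by
  intro A Z hZ
  ext j
  set y := Fin.append A (A ᵥ* Z) with hy
  let M := d + 1 + (∑ i, (P1 i).totalDegree) + (P2 j).totalDegree
  have hM1 : ∀ i, (P1 i).totalDegree < M := fun i => by
    have := Finset.single_le_sum (f := fun i => (P1 i).totalDegree) (fun _ _ => Nat.zero_le _) (Finset.mem_univ i)
    simp only [M] at *; omega
  have hM2 : (P2 j).totalDegree < M := by simp only [M]; omega
  let R : ℕ → ℂ := fun d => ∑ i, MvPolynomial.eval y (MvPolynomial.homogeneousComponent d (P1 i)) * f Z i j - MvPolynomial.eval y (MvPolynomial.homogeneousComponent d (P2 j))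
  let pol : Polynomial ℂ := ∑ m ∈ Finset.range M, Polynomial.C (R m) * Polynomial.X ^ m
  have key : ∀ (P : MvPolynomial (Fin (p+q)) ℂ) (hP : P.totalDegree < M) (c : ℂ), MvPolynomial.eval (c • y) P = ∑ m ∈ Finset.range M, c ^ m * MvPolynomial.eval y (MvPolynomial.homogeneousComponent m P) := by
    intro P hP c
    conv_lhs => rw [hom_sum P M hP]
    rw [map_sum]
    exact Finset.sum_congr rfl fun m _ => homog_smul (MvPolynomial.homogeneousComponent_isHomogeneous _ _) c y
  have hpol : pol = 0 := by
    refine Polynomial.funext fun c => ?_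
    have h1 := congrFun (h (c • A) Z hZ) j
    have e1 : Fin.append (c • A) ((c • A) ᵥ* Z) = c • y := by
      rw [hy, smul_vecMul]
      ext i
      refine Fin.addCases (fun i => ?_) (fun j => ?_) i <;> simp
    rw [e1] at h1
    have h2 : ∑ i, MvPolynomial.eval (c • y) (P1 i) * f Z i j = MvPolynomial.eval (c • y) (P2 j) := h1
    simp only [pol, Polynomial.eval_finsetSum, Polynomial.eval_mul, Polynomial.eval_C, Polynomial.eval_pow, Polynomial.eval_X, Polynomial.eval_zero, R, sub_mul, Finset.sum_sub_distrib, Finset.sum_mul]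
    rw [sub_eq_zero, Finset.sum_comm]
    calc _ = ∑ i, MvPolynomial.eval (c • y) (P1 i) * f Z i j := by
            refine Finset.sum_congr rfl fun i _ => ?_
            rw [key _ (hM1 i), Finset.sum_mul]
            exact Finset.sum_congr rfl fun m _ => by ring
      _ = _ := by
            rw [h2, key _ hM2]
            exact Finset.sum_congr rfl fun m _ => by ring
  have h3 := congrArg (fun r => Polynomial.coeff r d) hpol
  have hdM : d < M := by simp only [M]; omega
  simp only [pol, Polynomial.finsetSum_coeff, Polynomial.coeff_C_mul_X_pow, Polynomial.coeff_zero, Finset.sum_ite_eq, Finset.mem_range, hdM, if_true] at h3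
  exact sub_eq_zero.1 h3

theorem nsq_smul_ne {n : ℕ} {v : Fin n → ℂ} (h : 0 < nsq v) : v ≠ 0 := by
  rintro rfl; simp at h

theorem uniq_of {p q p' q' : ℕ} {f : Matrix (Fin p) (Fin q) ℂ → Matrix (Fin p') (Fin q') ℂ}
    (hfm : Set.MapsTo f (typeIDomain p q) (typeIDomain p' q'))
    (hfip : ∀ x ∈ genBallCone p q, ∃ y ∈ genBallCone p' q',
      ∀ Z ∈ typeIDomain p q, x.1 ᵥ* Z = x.2 → y.1 ᵥ* f Z = y.2)
    (x : PX p q) (hx : x ∈ genBallCone p q)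
    (huniq : ∀ y ∈ genBallCone p' q', ∀ y' ∈ genBallCone p' q',
      (∀ Z ∈ typeIDomain p q, x.1 ᵥ* Z = x.2 → y.1 ᵥ* f Z = y.2) →
      (∀ Z ∈ typeIDomain p q, x.1 ᵥ* Z = x.2 → y'.1 ᵥ* f Z = y'.2) →
      ∃ c : ℂ, c ≠ 0 ∧ y' = c • y) :
    ∃ C0 : Fin p' → ℂ, C0 ≠ 0 ∧ InV f x C0 ∧ ∀ C, InV f x C → ∃ c : ℂ, C = c • C0 := by
  obtain ⟨y, hy, hy2⟩ := hfip x hx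
  refine ⟨y.1, nsq_smul_ne ((nsq_nonneg _).trans_lt hy), fun Z hZ Z' hZ' h1 h2 => by rw [hy2 Z hZ h1, hy2 Z' hZ' h2], fun C hC => ?_⟩
  by_cases hC0 : C = 0
  · exact ⟨0, by simp [hC0]⟩
  obtain ⟨Z, hZ, hxZ⟩ := fiber_nonempty _ _ hx
  obtain ⟨c, _, hc⟩ := huniq y hy (C, C ᵥ* f Z) ((mem_dom_iff' _).1 (hfm hZ) C hC0) hy2 (fun Z' hZ' h' => hC Z' hZ' Z hZ h' hxZ)
  exact ⟨c, congrArg Prod.fst hc⟩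

theorem part1 {p q p' q' : ℕ} (h2p : 2 ≤ p) {f : Matrix (Fin p) (Fin q) ℂ → Matrix (Fin p') (Fin q') ℂ}
    (hf : DifferentiableOn ℂ f (typeIDomain p q)) (hV1 : ∀ x ∈ genBallCone p q, ∃ C : Fin p' → ℂ, C ≠ 0 ∧ InV f x C)
    (U0 : Set (PX p q)) (hU0o : IsOpen U0) (hU0d : genBallCone p q ⊆ closure U0)
    (hU0u : ∀ x ∈ U0, ∃ C0 : Fin p' → ℂ, C0 ≠ 0 ∧ InV f x C0 ∧ ∀ C, InV f x C → ∃ c : ℂ, C = c • C0) (hU0s : U0 ⊆ genBallCone p q) :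
    ∃ (d : ℕ) (k : Fin p') (P1 : Fin p' → MvPolynomial (Fin (p+q)) ℂ) (P2 : Fin q' → MvPolynomial (Fin (p+q)) ℂ), P1 k ≠ 0 ∧
      (∀ i, (P1 i).IsHomogeneous d) ∧ (∀ i, (P2 i).IsHomogeneous d) ∧ 
      ∀ A : Fin p → ℂ, ∀ Z ∈ typeIDomain p q, ev P1 (Fin.append A (A ᵥ* Z)) ᵥ* f Z = ev P2 (Fin.append A (A ᵥ* Z)) := by
  obtain ⟨k, P1, P2, hP, O, hO, hne, h⟩ := rat_local h2p hf hV1 U0 hU0o hU0d (fun x hx => by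
    obtain ⟨C0, h1, h2, h3⟩ := hU0u x hx
    exact ⟨C0, h1, h3⟩) hU0s
  have hg := glob hf P1 P2 O hO hne h
  obtain ⟨d, hd⟩ : ∃ d, MvPolynomial.homogeneousComponent d (P1 k) ≠ 0 := by
    by_contra! hcon
    apply hP
    rw [← MvPolynomial.sum_homogeneousComponent (P1 k)]
    exact Finset.sum_eq_zero fun d _ => hcon d
  exact ⟨d, k, fun i => MvPolynomial.homogeneousComponent d (P1 i), fun i => MvPolynomial.homogeneousComponent d (P2 i), hd,
    fun i => MvPolynomial.homogeneousComponent_isHomogeneous _ _, fun i => MvPolynomial.homogeneousComponent_isHomogeneous _ _, homog P1 P2 d hg⟩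

theorem part1_U {p q p' q' : ℕ} {f : Matrix (Fin p) (Fin q) ℂ → Matrix (Fin p') (Fin q') ℂ}
    (hfm : Set.MapsTo f (typeIDomain p q) (typeIDomain p' q')) (k : Fin p') (P1 : Fin p' → MvPolynomial (Fin (p+q)) ℂ) (P2 : Fin q' → MvPolynomial (Fin (p+q)) ℂ) (hP : P1 k ≠ 0)
    (h : ∀ A : Fin p → ℂ, ∀ Z ∈ typeIDomain p q, ev P1 (Fin.append A (A ᵥ* Z)) ᵥ* f Z = ev P2 (Fin.append A (A ᵥ* Z))) :
    ∃ U : Set (PX p q), IsOpen U ∧ U ⊆ genBallCone p q ∧ genBallCone p q ⊆ closure U ∧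
        ∀ x ∈ U, ev P1 (Fin.append x.1 x.2) ≠ 0 ∧ (ev P1 (Fin.append x.1 x.2), ev P2 (Fin.append x.1 x.2)) ∈ genBallCone p' q' ∧ 
          ∀ Z ∈ typeIDomain p q, x.1 ᵥ* Z = x.2 → ev P1 (Fin.append x.1 x.2) ᵥ* f Z = ev P2 (Fin.append x.1 x.2) := by
  have hcont : Continuous fun x : PX p q => ev P1 (Fin.append x.1 x.2) := (ev_cont P1).comp append_cont
  refine ⟨genBallCone p q ∩ {x | ev P1 (Fin.append x.1 x.2) ≠ 0}, (cone_open p q).inter (isOpen_ne_fun hcont continuous_const), Set.inter_subset_left, ?_, ?_⟩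
  · intro x hx
    refine mem_closure_iff.2 fun o ho hxo => ?_
    by_contra hcon
    apply hP
    refine mvpoly_open (S := spl ⁻¹' (o ∩ genBallCone p q)) ((ho.inter (cone_open p q)).preimage spl_cont) ⟨Fin.append x.1 x.2, by
      simp only [Set.mem_preimage, spl_append]; exact ⟨hxo, hx⟩⟩ _ fun w hw => ?_
    by_contra hne
    refine hcon ⟨spl w, hw.1, hw.2, fun h0 => hne ?_⟩
    rw [append_spl] at h0
    exact congrFun h0 k
  · rintro x ⟨hx, hx0⟩
    have h3 : ∀ Z ∈ typeIDomain p q, x.1 ᵥ* Z = x.2 → ev P1 (Fin.append x.1 x.2) ᵥ* f Z = ev P2 (Fin.append x.1 x.2) := by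
      intro Z hZ hxZ
      rw [← hxZ]; exact h x.1 Z hZ
    refine ⟨hx0, ?_, h3⟩
    obtain ⟨Z, hZ, hxZ⟩ := fiber_nonempty _ _ hx
    have h4 := (mem_dom_iff' _).1 (hfm hZ) _ hx0
    rw [h3 Z hZ hxZ] at h4
    exact h4

theorem sc_lemma {n : ℕ} {X : Type*} (K : X → Submodule ℂ (Fin n → ℂ)) (Kx J : Submodule ℂ (Fin n → ℂ)) (l : Filter X) (r : ℕ)
    (hcl : ∀ (𝒰 : Ultrafilter X) (c : X → (Fin n → ℂ)) (C : Fin n → ℂ), (𝒰 : Filter X) ≤ l → Filter.Tendsto c 𝒰 (nhds C) →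
      (∀ᶠ y in (𝒰 : Filter X), c y ∈ K y) → C ∈ Kx)
    (hfr : ∃ᶠ y in l, K y ≤ J ∧ r ≤ Module.finrank ℂ (K y)) : r ≤ Module.finrank ℂ (Kx ⊓ J : Submodule ℂ (Fin n → ℂ)) := by
  by_contra! hlt
  obtain ⟨L, hL⟩ := Submodule.exists_isCompl (Kx ⊓ J)
  have hdim := Submodule.finrank_add_eq_of_isCompl hL
  let S : Set X := {y | K y ≤ J ∧ r ≤ Module.finrank ℂ (K y)}
  have hex : ∀ y, ∃ c : Fin n → ℂ, y ∈ S → c ∈ K y ∧ c ∈ L ∧ ‖c‖ = 1 := by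
    intro y
    by_cases hy : y ∈ S
    · have hne : K y ⊓ L ≠ ⊥ := by
        intro h0
        have h1 := Submodule.finrank_sup_add_finrank_inf_eq (K y) L
        rw [h0, finrank_bot] at h1
        have h2 := Submodule.finrank_le (K y ⊔ L)
        have := hy.2
        omega
      obtain ⟨c, hc, hc0⟩ := Submodule.exists_mem_ne_zero_of_ne_bot hne
      have hn : ‖c‖ ≠ 0 := norm_ne_zero_iff.2 hc0
      refine ⟨((‖c‖⁻¹ : ℝ) : ℂ) • c, fun _ => ⟨(K y).smul_mem _ hc.1, L.smul_mem _ hc.2, ?_⟩⟩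
      rw [norm_smul, Complex.norm_real, norm_inv, norm_norm, inv_mul_cancel₀ hn]
    · exact ⟨0, fun h => absurd h hy⟩
  choose c hc using hex
  have hne : (l ⊓ Filter.principal S).NeBot := Filter.frequently_mem_iff_neBot.1 hfr
  let 𝒰 := Ultrafilter.of (l ⊓ Filter.principal S)
  have h𝒰 : (𝒰 : Filter X) ≤ l ⊓ Filter.principal S := Ultrafilter.of_le _
  have hS : ∀ᶠ y in (𝒰 : Filter X), y ∈ S := h𝒰.trans inf_le_right (Filter.mem_principal_self S)
  obtain ⟨C, hC1, hC⟩ := (isCompact_sphere (0 : Fin n → ℂ) 1).ultrafilter_le_nhds (𝒰.map c) (by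
    rw [Filter.le_principal_iff]
    show ∀ᶠ y in (𝒰 : Filter X), c y ∈ Metric.sphere (0 : Fin n → ℂ) 1
    filter_upwards [hS] with y hy
    rw [mem_sphere_zero_iff_norm]; exact (hc y hy).2.2)
  have hCt : Filter.Tendsto c 𝒰 (nhds C) := hC
  have h1 : C ∈ Kx := hcl 𝒰 c C (h𝒰.trans inf_le_left) hCt (hS.mono fun y hy => (hc y hy).1)
  have h2 : C ∈ L := (Submodule.closed_of_finiteDimensional L).mem_of_tendsto hCt (hS.mono fun y hy => (hc y hy).2.1)
  have h3 : C ∈ J := (Submodule.closed_of_finiteDimensional J).mem_of_tendsto hCt (hS.mono fun y hy => hy.1 (hc y hy).1)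
  have h4 : C ∈ (Kx ⊓ J) ⊓ L := ⟨⟨h1, h3⟩, h2⟩
  rw [hL.inf_eq_bot, Submodule.mem_bot] at h4
  rw [mem_sphere_zero_iff_norm, h4] at hC1
  simp at hC1

theorem not_mem_freq {n : ℕ} (E : Submodule ℂ (Fin n → ℂ)) (hE : E ≠ ⊤) (G : Fin n → ℂ) : ∃ᶠ G' in nhds G, G' ∉ E := by
  intro h
  apply hE
  refine Submodule.eq_top_of_nonempty_interior' E ⟨G, ?_⟩
  rw [mem_interior_iff_mem_nhds]
  filter_upwards [h] with y hy
  exact not_not.1 hy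

/-- a row vector killing `E` and equal to 1 on `G`. -/
theorem exists_row {n : ℕ} (E : Submodule ℂ (Fin n → ℂ)) (G : Fin n → ℂ) (hG : G ∉ E) : ∃ w : Fin n → ℂ, w ⬝ᵥ G = 1 ∧ ∀ g ∈ E, w ⬝ᵥ g = 0 := by
  obtain ⟨φ, hφ1, hφ2⟩ := Submodule.exists_le_ker_of_notMem hG
  have key : ∀ g : Fin n → ℂ, φ g = (fun i => φ (Pi.single i 1)) ⬝ᵥ g := by
    intro g
    conv_lhs => rw [pi_eq_sum_univ' g]
    simp [map_sum, dotProduct, mul_comm]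
  refine ⟨(φ G)⁻¹ • fun i => φ (Pi.single i 1), ?_, fun g hg => ?_⟩
  · rw [smul_dotProduct, ← key, smul_eq_mul, inv_mul_cancel₀ hφ1]
  · rw [smul_dotProduct, ← key, hφ2 hg, smul_zero]

/-- the functionals constant on `{Y' ∈ x^♯ : Y' G = Y G}`. -/
def KK {p q p' q' : ℕ} (f : Matrix (Fin p) (Fin q) ℂ → Matrix (Fin p') (Fin q') ℂ) (x : PX p q) (Y : Matrix (Fin p) (Fin q) ℂ) (G : Fin q → ℂ) :
    Submodule ℂ (Fin p' → ℂ) where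
  carrier := {C | ∀ Y' ∈ typeIDomain p q, x.1 ᵥ* Y' = x.2 → Y' *ᵥ G = Y *ᵥ G → C ᵥ* f Y' = C ᵥ* f Y}
  add_mem' := by
    intro a b ha hb Y' h1 h2 h3
    rw [add_vecMul, add_vecMul, ha Y' h1 h2 h3, hb Y' h1 h2 h3]
  zero_mem' := by intro Y' _ _ _; simp
  smul_mem' := by
    intro c a ha Y' h1 h2 h3
    rw [smul_vecMul, smul_vecMul, ha Y' h1 h2 h3]

theorem mem_KK {p q p' q' : ℕ} {f : Matrix (Fin p) (Fin q) ℂ → Matrix (Fin p') (Fin q') ℂ} {x : PX p q} {Y : Matrix (Fin p) (Fin q) ℂ} {G : Fin q → ℂ} {C : Fin p' → ℂ} :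
    C ∈ KK f x Y G ↔ ∀ Y' ∈ typeIDomain p q, x.1 ᵥ* Y' = x.2 → Y' *ᵥ G = Y *ᵥ G → C ᵥ* f Y' = C ᵥ* f Y := Iff.rfl

theorem KK_congr {p q p' q' : ℕ} {f : Matrix (Fin p) (Fin q) ℂ → Matrix (Fin p') (Fin q') ℂ} {x : PX p q} {Y Y1 : Matrix (Fin p) (Fin q) ℂ} {G : Fin q → ℂ} {C : Fin p' → ℂ}
    (hY : Y ∈ typeIDomain p q) (hY1 : Y1 ∈ typeIDomain p q) (hxY : x.1 ᵥ* Y = x.2) (hxY1 : x.1 ᵥ* Y1 = x.2) (h : Y *ᵥ G = Y1 *ᵥ G) (hC : C ∈ KK f x Y G) : C ∈ KK f x Y1 G := by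
  intro Y' h1 h2 h3
  rw [hC Y' h1 h2 (h3.trans h.symm), hC Y1 hY1 hxY1 h.symm]

theorem entry_cont (p q : ℕ) (i : Fin p) (j : Fin q) : Continuous fun Z : Matrix (Fin p) (Fin q) ℂ => Z i j :=
  (continuous_apply j).comp (continuous_apply (A := fun _ => Fin q → ℂ) i)

theorem mulVec_cont (p q : ℕ) : Continuous fun z : Matrix (Fin p) (Fin q) ℂ × (Fin q → ℂ) => z.1 *ᵥ z.2 := by
  refine continuous_pi fun i => ?_
  simp only [mulVec, dotProduct]
  refine continuous_finsetSum _ fun j _ => ?_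
  have h1 := (entry_cont p q i j).comp (continuous_fst (X := Matrix (Fin p) (Fin q) ℂ) (Y := Fin q → ℂ))
  have h2 : Continuous fun z : Matrix (Fin p) (Fin q) ℂ × (Fin q → ℂ) => z.2 j := (continuous_apply j).comp continuous_snd
  exact h1.mul h2

theorem vecMul_cont (p q : ℕ) : Continuous fun z : (Fin p → ℂ) × Matrix (Fin p) (Fin q) ℂ => z.1 ᵥ* z.2 := by
  refine continuous_pi fun j => ?_
  simp only [vecMul, dotProduct]
  refine continuous_finsetSum _ fun i _ => ?_
  have h1 := (entry_cont p q i j).comp (continuous_snd (Y := Matrix (Fin p) (Fin q) ℂ) (X := Fin p → ℂ))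
  have h2 : Continuous fun z : (Fin p → ℂ) × Matrix (Fin p) (Fin q) ℂ => z.1 i := (continuous_apply i).comp continuous_fst
  exact h2.mul h1

theorem vecMulVec_cont (p q : ℕ) : Continuous fun z : (Fin p → ℂ) × (Fin q → ℂ) => vecMulVec z.1 z.2 := by
  refine continuous_pi fun i => continuous_pi fun j => ?_
  simp only [vecMulVec_apply]
  fun_prop

theorem tendsto_entry {p q : ℕ} {X : Type*} {l : Filter X} {Yj : X → Matrix (Fin p) (Fin q) ℂ} {Y : Matrix (Fin p) (Fin q) ℂ} (h : Filter.Tendsto Yj l (nhds Y)) (i : Fin p) (j : Fin q) :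
    Filter.Tendsto (fun y => Yj y i j) l (nhds (Y i j)) := by
  have := ((entry_cont p q i j).tendsto Y).comp h
  exact this

theorem tendsto_mat {p q : ℕ} {X : Type*} {l : Filter X} {Yj : X → Matrix (Fin p) (Fin q) ℂ} {Y : Matrix (Fin p) (Fin q) ℂ} (h : ∀ i j, Filter.Tendsto (fun y => Yj y i j) l (nhds (Y i j))) : 
    Filter.Tendsto Yj l (nhds Y) := 
  tendsto_pi_nhds.2 fun i => tendsto_pi_nhds.2 fun j => h i j

theorem tendsto_mulVec {p q : ℕ} {X : Type*} {l : Filter X} {Yj : X → Matrix (Fin p) (Fin q) ℂ} {Y : Matrix (Fin p) (Fin q) ℂ} {Gj : X → (Fin q → ℂ)} {G : Fin q → ℂ} 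
    (h : Filter.Tendsto Yj l (nhds Y)) (hG : Filter.Tendsto Gj l (nhds G)) : Filter.Tendsto (fun y => Yj y *ᵥ Gj y) l (nhds (Y *ᵥ G)) := by
  refine tendsto_pi_nhds.2 fun i => ?_
  simp only [mulVec, dotProduct]
  exact tendsto_finsetSum _ fun j _ => (tendsto_entry h i j).mul (tendsto_pi_nhds.1 hG j)

theorem tendsto_vecMul {p q : ℕ} {X : Type*} {l : Filter X} {Yj : X → Matrix (Fin p) (Fin q) ℂ} {Y : Matrix (Fin p) (Fin q) ℂ} {Gj : X → (Fin p → ℂ)} {G : Fin p → ℂ} 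
    (h : Filter.Tendsto Yj l (nhds Y)) (hG : Filter.Tendsto Gj l (nhds G)) : Filter.Tendsto (fun y => Gj y ᵥ* Yj y) l (nhds (G ᵥ* Y)) := by
  refine tendsto_pi_nhds.2 fun i => ?_
  simp only [vecMul, dotProduct]
  exact tendsto_finsetSum _ fun j _ => (tendsto_pi_nhds.1 hG j).mul (tendsto_entry h j i)

theorem KK_closed {p q p' q' : ℕ} {f : Matrix (Fin p) (Fin q) ℂ → Matrix (Fin p') (Fin q') ℂ} (hf : DifferentiableOn ℂ f (typeIDomain p q)) {x : PX p q}
    {X : Type*} (l : Filter X) [l.NeBot] (Yj : X → Matrix (Fin p) (Fin q) ℂ) (Gj : X → (Fin q → ℂ)) (Cj : X → (Fin p' → ℂ))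
    {Y : Matrix (Fin p) (Fin q) ℂ} {G : Fin q → ℂ} {C : Fin p' → ℂ} (hY : Y ∈ typeIDomain p q) (hG : G ≠ 0)
    (hYj : Filter.Tendsto Yj l (nhds Y)) (hGj : Filter.Tendsto Gj l (nhds G)) (hCj : Filter.Tendsto Cj l (nhds C))
    (hx : ∀ᶠ y in l, x.1 ᵥ* Yj y = x.2) (hC : ∀ᶠ y in l, Cj y ∈ KK f x (Yj y) (Gj y)) : C ∈ KK f x Y G := by
  intro Y' hY' hxY' hYG
  have hGG : star G ⬝ᵥ G ≠ 0 := by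
    rw [dotProduct_comm, ← nsq_eq_dot]
    exact_mod_cast (nsq_pos hG).ne'
  let w : X → (Fin q → ℂ) := fun y => (star G ⬝ᵥ Gj y)⁻¹ • star G
  let Y'j : X → Matrix (Fin p) (Fin q) ℂ := fun y => Y' + vecMulVec (Yj y *ᵥ Gj y - Y' *ᵥ Gj y) (w y)
  have hd : Filter.Tendsto (fun y => star G ⬝ᵥ Gj y) l (nhds (star G ⬝ᵥ G)) := 
    ((continuous_const.dotProduct continuous_id : Continuous fun g : Fin q → ℂ => star G ⬝ᵥ g).tendsto G).comp hGj
  have hw : Filter.Tendsto w l (nhds ((star G ⬝ᵥ G)⁻¹ • star G)) := (hd.inv₀ hGG).smul tendsto_const_nhds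
  have hv : Filter.Tendsto (fun y => Yj y *ᵥ Gj y - Y' *ᵥ Gj y) l (nhds 0) := by
    have h1 : Filter.Tendsto (fun y => Yj y *ᵥ Gj y) l (nhds (Y *ᵥ G)) := tendsto_mulVec hYj hGj
    have h2 : Filter.Tendsto (fun y => Y' *ᵥ Gj y) l (nhds (Y' *ᵥ G)) := tendsto_mulVec tendsto_const_nhds hGj
    have h3 := h1.sub h2
    rw [hYG, sub_self] at h3
    exact h3
  have hY'j : Filter.Tendsto Y'j l (nhds Y') := by
    refine tendsto_mat fun i j => ?_
    simp only [Y'j, Matrix.add_apply, vecMulVec_apply]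
    have := (tendsto_const_nhds (x := Y' i j)).add ((tendsto_pi_nhds.1 hv i).mul (tendsto_pi_nhds.1 hw j))
    simpa using this
  have hfc : ∀ Z ∈ typeIDomain p q, Filter.Tendsto f (nhds Z) (nhds (f Z)) := fun Z hZ =>
    (hf.continuousOn.continuousAt ((dom_open p q).mem_nhds hZ))
  have t1 : Filter.Tendsto (fun y => Cj y ᵥ* f (Y'j y)) l (nhds (C ᵥ* f Y')) :=  tendsto_vecMul ((hfc Y' hY').comp hY'j) hCj
  have t2 : Filter.Tendsto (fun y => Cj y ᵥ* f (Yj y)) l (nhds (C ᵥ* f Y)) :=  tendsto_vecMul ((hfc Y hY).comp hYj) hCj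
  refine tendsto_nhds_unique_of_eventuallyEq t1 t2 ?_
  filter_upwards [hx, hC, hd.eventually_ne hGG, hY'j.eventually_mem ((dom_open p q).mem_nhds hY')] with y h1 h2 h3 h4
  refine h2 _ h4 ?_ ?_
  · simp only [Y'j]
    rw [vecMul_add, vecMul_vecMulVec, dotProduct_sub, dotProduct_mulVec, dotProduct_mulVec, h1, hxY', sub_self, zero_smul, add_zero]
  · simp only [Y'j]
    rw [add_mulVec, vecMulVec_mulVec]
    simp only [w, smul_dotProduct, smul_eq_mul, inv_mul_cancel₀ h3]
    simp

/-- the class of functions -/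
structure FF {p q p' q' : ℕ} (f : Matrix (Fin p) (Fin q) ℂ → Matrix (Fin p') (Fin q') ℂ) (x : PX p q) (C0 : Fin p' → ℂ) (𝒴 : Set (Matrix (Fin p) (Fin q) ℂ)) (𝒢 : Set (Fin q → ℂ))
    (u : Matrix (Fin p) (Fin q) ℂ → (Fin p' → ℂ)) : Prop where
  diff : DifferentiableOn ℂ u (typeIDomain p q)
  zero : ∀ Y ∈ 𝒴, ∀ Y' ∈ 𝒴, x.1 ᵥ* Y = x.2 → x.1 ᵥ* Y' = x.2 → C0 ⬝ᵥ u Y = C0 ⬝ᵥ u Y'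
  main : ∀ Y ∈ 𝒴, ∀ Y' ∈ 𝒴, x.1 ᵥ* Y = x.2 → x.1 ᵥ* Y' = x.2 → ∀ G ∈ 𝒢, Y *ᵥ G = Y' *ᵥ G → ∀ C ∈ KK f x Y G, C ⬝ᵥ u Y = C ⬝ᵥ u Y'

theorem FO {p q p' q' : ℕ} (hpq : p' ≤ q) {f : Matrix (Fin p) (Fin q) ℂ → Matrix (Fin p') (Fin q') ℂ} (hf : DifferentiableOn ℂ f (typeIDomain p q)) {x : PX p q} {C0 : Fin p' → ℂ} (hC0 : C0 ≠ 0)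
    {𝒴 : Set (Matrix (Fin p) (Fin q) ℂ)} {𝒢 : Set (Fin q → ℂ)} (h𝒴 : IsOpen 𝒴) (h𝒴D : 𝒴 ⊆ typeIDomain p q) (h𝒢 : IsOpen 𝒢) (h𝒢0 : (0 : Fin q → ℂ) ∉ 𝒢) (r : ℕ)
    (hr : ∀ Y ∈ 𝒴, x.1 ᵥ* Y = x.2 → ∀ G ∈ 𝒢, Module.finrank ℂ (KK f x Y G) = r)
    {u : Matrix (Fin p) (Fin q) ℂ → (Fin p' → ℂ)} (hu : FF f x C0 𝒴 𝒢 u) (H : Matrix (Fin p) (Fin q) ℂ) (hH : x.1 ᵥ* H = 0)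
    {Y : Matrix (Fin p) (Fin q) ℂ} (hY : Y ∈ 𝒴) (hxY : x.1 ᵥ* Y = x.2) :
    C0 ⬝ᵥ dd H u Y = 0 ∧ ∀ G ∈ 𝒢, ∀ C ∈ KK f x Y G, C ⬝ᵥ dd H u Y = 0 := by
  have hzero : ∀ H : Matrix (Fin p) (Fin q) ℂ, x.1 ᵥ* H = 0 → C0 ⬝ᵥ dd H u Y = 0 := by
    intro H hH
    refine taylor_from (dom_open p q) hu.diff (dotL C0) Y H (h𝒴D hY) ?_ 1 le_rfl
    filter_upwards [line_near h𝒴 hY H] with τ hτ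
    exact hu.zero _ hτ _ hY (by rw [vecMul_add, vecMul_smul, hH, hxY]; simp) hxY
  have hmain : ∀ H : Matrix (Fin p) (Fin q) ℂ, x.1 ᵥ* H = 0 → ∀ G ∈ 𝒢, H *ᵥ G = 0 → ∀ C ∈ KK f x Y G, C ⬝ᵥ dd H u Y = 0 := by
    intro H hH G hG hHG C hC
    refine taylor_from (dom_open p q) hu.diff (dotL C) Y H (h𝒴D hY) ?_ 1 le_rfl
    filter_upwards [line_near h𝒴 hY H] with τ hτ
    exact (hu.main _ hY _ hτ hxY (by rw [vecMul_add, vecMul_smul, hH, hxY]; simp) G hG (by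
      rw [add_mulVec, smul_mulVec, hHG]; simp) C hC).symm
  refine ⟨hzero H hH, ?_⟩
  let S : Set (Fin p' → ℂ) := {C0} ∪ ⋃ G ∈ 𝒢, (KK f x Y G : Set (Fin p' → ℂ))
  obtain ⟨b, hbS, hb0, hSb, hbi⟩ := exists_linearIndepOn_id_extension (K := ℂ) (V := Fin p' → ℂ) (s := {C0}) (t := S) (LinearIndepOn.singleton (v := id) hC0) Set.subset_union_left
  have hbfin : b.Finite := LinearIndependent.setFinite hbi 
  have hsel : ∀ c : Fin p' → ℂ, ∃ G : Fin q → ℂ, c ∈ b → c ≠ C0 → G ∈ 𝒢 ∧ c ∈ KK f x Y G := by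
    intro c
    by_cases hc : c ∈ b ∧ c ≠ C0
    · rcases hbS hc.1 with h | h
      · exact absurd h hc.2
      · simp only [Set.mem_iUnion] at h
        obtain ⟨G, hG, h⟩ := h
        exact ⟨G, fun _ _ => ⟨hG, h⟩⟩
    · exact ⟨0, fun h1 h2 => absurd ⟨h1, h2⟩ hc⟩
  choose g hg using hsel
  let bf : Finset (Fin p' → ℂ) := hbfin.toFinset.erase C0
  have hcard : bf.card < q := by
    have h1 : hbfin.toFinset.card ≤ p' := by
      have h2 : LinearIndependent ℂ ((↑) : hbfin.toFinset → (Fin p' → ℂ)) := by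
        have : LinearIndepOn ℂ id (hbfin.toFinset : Set (Fin p' → ℂ)) := by simpa using hbi
        exact this
      have h3 := h2.fintype_card_le_finrank
      simpa using h3
    have h4 : bf.card + 1 = hbfin.toFinset.card := Finset.card_erase_add_one (by simpa using hb0 rfl)
    omega
  let E : Submodule ℂ (Fin q → ℂ) := Submodule.span ℂ (bf.image g : Set (Fin q → ℂ))
  have hE : E ≠ ⊤ := by
    intro h
    have h1 := finrank_span_finset_le_card (R := ℂ) (bf.image g)
    have h2 : Module.finrank ℂ E = q := by rw [h]; simp
    have h3 := Finset.card_image_le (s := bf) (f := g)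
    have h4 : Module.finrank ℂ E ≤ (bf.image g).card := h1
    omega
  have hgen : ∀ G ∈ 𝒢, G ∉ E → ∀ C ∈ KK f x Y G, ∀ H : Matrix (Fin p) (Fin q) ℂ, x.1 ᵥ* H = 0 → C ⬝ᵥ dd H u Y = 0 := by
    intro G hG hGE C hC H hH
    obtain ⟨w, hw1, hw0⟩ := exists_row E G hGE
    let H' := vecMulVec (H *ᵥ G) w
    have hH' : x.1 ᵥ* H' = 0 := by
      simp only [H']; rw [vecMul_vecMulVec, dotProduct_mulVec, hH]; simp
    have hb' : ∀ c ∈ b, c ⬝ᵥ dd H' u Y = 0 := by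
      intro c hc
      by_cases hc0 : c = C0
      · rw [hc0]; exact hzero H' hH'
      · obtain ⟨h1, h2⟩ := hg c hc hc0
        refine hmain H' hH' (g c) h1 ?_ c h2
        simp only [H']
        rw [vecMulVec_mulVec, hw0 (g c) (Submodule.subset_span (by
          rw [Finset.mem_coe]
          exact Finset.mem_image_of_mem _ (by simp [bf, hc0, hc])))]
        simp
    have hCb : C ∈ Submodule.span ℂ b := hSb (Or.inr (Set.mem_biUnion hG hC))
    have e1 : C ⬝ᵥ dd H' u Y = 0 := by
      clear hC
      induction hCb using Submodule.span_induction with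
      | mem c hc => exact hb' c hc
      | zero => simp
      | add a b _ _ ha hb => 
        rw [add_dotProduct, ha, hb, add_zero]
      | smul c a _ ha => rw [smul_dotProduct, ha, smul_zero]
    have e2 : C ⬝ᵥ dd (H - H') u Y = 0 := by
      refine hmain _ (by rw [vecMul_sub, hH, hH', sub_self]) G hG ?_ C hC
      simp only [H']
      rw [sub_mulVec, vecMulVec_mulVec, hw1]; simp
    have e3 : dd H u Y = dd (H - H') u Y + dd H' u Y := by
      simp only [dd]; rw [← map_add, sub_add_cancel]
    rw [e3, dotProduct_add, e1, e2, add_zero]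
  intro G hG C hC
  let J : Submodule ℂ (Fin p' → ℂ) := 
    { carrier := {C | C ⬝ᵥ dd H u Y = 0}
      add_mem' := by intro a b ha hb; simp only [Set.mem_setOf_eq] at *; rw [add_dotProduct, ha, hb, add_zero]
      zero_mem' := by simp
      smul_mem' := by intro c a ha; simp only [Set.mem_setOf_eq] at *; rw [smul_dotProduct, ha, smul_zero] }
  have hsc := sc_lemma (fun G' => KK f x Y G') (KK f x Y G) J (nhds G) r (by
      intro 𝒰 c C h𝒰 hc hcK
      exact KK_closed hf (𝒰 : Filter (Fin q → ℂ)) (fun _ => Y) id c (h𝒴D hY) (fun h => h𝒢0 (h ▸ hG)) tendsto_const_nhds h𝒰 hc (Filter.Eventually.of_forall fun _ => hxY) hcK)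
    (((not_mem_freq E hE G).and_eventually (h𝒢.mem_nhds hG)).mono fun G' hG' => ⟨fun C hC => hgen G' hG'.2 hG'.1 C hC H hH, (hr Y hY hxY G' hG'.2).ge⟩)
  rw [← hr Y hY hxY G hG] at hsc
  have heq := Submodule.eq_of_le_of_finrank_le (inf_le_left : KK f x Y G ⊓ J ≤ KK f x Y G) hsc
  rw [← heq] at hC
  exact hC.2

theorem KK_semi {p q p' q' : ℕ} {f : Matrix (Fin p) (Fin q) ℂ → Matrix (Fin p') (Fin q') ℂ} (hf : DifferentiableOn ℂ f (typeIDomain p q)) {x : PX p q}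
    {Y : Matrix (Fin p) (Fin q) ℂ} {G : Fin q → ℂ} (hY : Y ∈ typeIDomain p q) (hG : G ≠ 0) :
    ∀ᶠ z in (nhds Y) ×ˢ (nhds G), x.1 ᵥ* z.1 = x.2 → Module.finrank ℂ (KK f x z.1 z.2) ≤ Module.finrank ℂ (KK f x Y G) := by
  by_contra hcon
  rw [Filter.not_eventually] at hcon
  have := sc_lemma (X := Matrix (Fin p) (Fin q) ℂ × (Fin q → ℂ)) (fun z => KK f x z.1 z.2) (KK f x Y G) ⊤ (((nhds Y) ×ˢ (nhds G)) ⊓ Filter.principal {z | x.1 ᵥ* z.1 = x.2}) (Module.finrank ℂ (KK f x Y G) + 1) (by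
      intro 𝒰 c C h𝒰 hc hcK
      have h1 : Filter.Tendsto (fun z : Matrix (Fin p) (Fin q) ℂ × (Fin q → ℂ) => z.1) 𝒰 (nhds Y) := Filter.tendsto_fst.mono_left (h𝒰.trans inf_le_left)
      have h2 : Filter.Tendsto (fun z : Matrix (Fin p) (Fin q) ℂ × (Fin q → ℂ) => z.2) 𝒰 (nhds G) := Filter.tendsto_snd.mono_left (h𝒰.trans inf_le_left)
      have h3 : ∀ᶠ z in (𝒰 : Filter (Matrix (Fin p) (Fin q) ℂ × (Fin q → ℂ))), x.1 ᵥ* z.1 = x.2 := h𝒰.trans inf_le_right (Filter.mem_principal_self _)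
      exact KK_closed hf (𝒰 : Filter (Matrix (Fin p) (Fin q) ℂ × (Fin q → ℂ))) (fun z => z.1) (fun z => z.2) c hY hG h1 h2 hc h3 hcK) (by
      rw [Filter.frequently_inf_principal]
      refine hcon.mono fun z hz => ?_
      push Not at hz
      exact ⟨hz.1, le_top, hz.2⟩)
  rw [inf_top_eq] at this
  omega

theorem final_contra {p q p' q' : ℕ} (hpq : p' ≤ q) {f : Matrix (Fin p) (Fin q) ℂ → Matrix (Fin p') (Fin q') ℂ} (hf : DifferentiableOn ℂ f (typeIDomain p q)) {x : PX p q} {C0 : Fin p' → ℂ} (hC0 : C0 ≠ 0)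
    (hC0V : InV f x C0) (hu : ∀ C, InV f x C → ∃ c : ℂ, C = c • C0)
    {𝒴 : Set (Matrix (Fin p) (Fin q) ℂ)} {𝒢 : Set (Fin q → ℂ)} (h𝒴 : IsOpen 𝒴) (h𝒴D : 𝒴 ⊆ typeIDomain p q) (h𝒢 : IsOpen 𝒢) (h𝒢0 : (0 : Fin q → ℂ) ∉ 𝒢) 
    {Y0 : Matrix (Fin p) (Fin q) ℂ} (hY0 : Y0 ∈ 𝒴) (hxY0 : x.1 ᵥ* Y0 = x.2) {G0 : Fin q → ℂ} (hG0 : G0 ∈ 𝒢)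
    (hK : ∀ Y ∈ 𝒴, x.1 ᵥ* Y = x.2 → ∀ G ∈ 𝒢, ¬ ∀ C ∈ KK f x Y G, ∃ c : ℂ, C = c • C0) : False := by
  classical
  have hex : ∃ r : ℕ, ∃ Y ∈ 𝒴, x.1 ᵥ* Y = x.2 ∧ ∃ G ∈ 𝒢, Module.finrank ℂ (KK f x Y G) = r := ⟨_, Y0, hY0, hxY0, G0, hG0, rfl⟩
  obtain ⟨r0, ⟨Y, hY, hxY, G, hG, hr⟩, hmin⟩ : ∃ r : ℕ, (∃ Y ∈ 𝒴, x.1 ᵥ* Y = x.2 ∧ ∃ G ∈ 𝒢, Module.finrank ℂ (KK f x Y G) = r) ∧ 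
      ∀ Y' ∈ 𝒴, x.1 ᵥ* Y' = x.2 → ∀ G' ∈ 𝒢, r ≤ Module.finrank ℂ (KK f x Y' G') :=
    ⟨Nat.find hex, Nat.find_spec hex, fun Y' h1 h2 G' h3 => Nat.find_min' hex ⟨Y', h1, h2, G', h3, rfl⟩⟩
  have hsemi := KK_semi hf (x := x) (h𝒴D hY) (fun h => h𝒢0 (h ▸ hG) : G ≠ 0)
  obtain ⟨t1, ht1, t2, ht2, hsub⟩ := Filter.eventually_prod_iff.1 hsemi
  obtain ⟨O1, hO1, hO1o, hYO⟩ := mem_nhds_iff.1 ht1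
  obtain ⟨O2, hO2, hO2o, hGO⟩ := mem_nhds_iff.1 ht2
  have hreq : ∀ Y' ∈ 𝒴 ∩ O1, x.1 ᵥ* Y' = x.2 → ∀ G' ∈ 𝒢 ∩ O2, Module.finrank ℂ (KK f x Y' G') = r0 := by
    intro Y' hY' hx' G' hG'
    refine le_antisymm ?_ (hmin Y' hY'.1 hx' G' hG'.1)
    have := hsub (hO1 hY'.2) (hO2 hG'.2) hx'
    simp only at this
    exact this.trans hr.le
  have hFO := fun (u : Matrix (Fin p) (Fin q) ℂ → (Fin p' → ℂ)) (hu : FF f x C0 (𝒴 ∩ O1) (𝒢 ∩ O2) u) (H : Matrix (Fin p) (Fin q) ℂ) (hH : x.1 ᵥ* H = 0) (Y' : Matrix (Fin p) (Fin q) ℂ) (hY' : Y' ∈ 𝒴 ∩ O1) (hxY' : x.1 ᵥ* Y' = x.2) =>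
    FO hpq hf hC0 (h𝒴.inter hO1o) (Set.inter_subset_left.trans h𝒴D) (h𝒢.inter hO2o) (fun h => h𝒢0 h.1) r0 hreq hu H hH hY' hxY'
  have hFF0 : ∀ j, FF f x C0 (𝒴 ∩ O1) (𝒢 ∩ O2) (fcol f j) := by
    intro j
    refine ⟨fcol_diff hf j, ?_, ?_⟩
    · intro Y1 h1 Y2 h2 hx1 hx2
      have := congrFun (hC0V Y1 (h𝒴D h1.1) Y2 (h𝒴D h2.1) hx1 hx2) j
      exact this
    · intro Y1 h1 Y2 h2 hx1 hx2 G' hG' he C hC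
      have := congrFun (hC Y2 (h𝒴D h2.1) hx2 he.symm) j
      exact this.symm
  have hstep : ∀ H : Matrix (Fin p) (Fin q) ℂ, x.1 ᵥ* H = 0 → ∀ u, FF f x C0 (𝒴 ∩ O1) (𝒢 ∩ O2) u → FF f x C0 (𝒴 ∩ O1) (𝒢 ∩ O2) (dd H u) := by
    intro H hH u hu
    refine ⟨dd_diff (dom_open p q) hu.diff H, ?_, ?_⟩
    · intro Y1 h1 Y2 h2 hx1 hx2
      rw [(hFO u hu H hH Y1 h1 hx1).1, (hFO u hu H hH Y2 h2 hx2).1]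
    · intro Y1 h1 Y2 h2 hx1 hx2 G' hG' he C hC
      rw [(hFO u hu H hH Y1 h1 hx1).2 G' hG' C hC, (hFO u hu H hH Y2 h2 hx2).2 G' hG' C (KK_congr (h𝒴D h1.1) (h𝒴D h2.1) hx1 hx2 he hC)]
  have hiter : ∀ H : Matrix (Fin p) (Fin q) ℂ, x.1 ᵥ* H = 0 → ∀ k j, FF f x C0 (𝒴 ∩ O1) (𝒢 ∩ O2) ((dd H)^[k] (fcol f j)) := by
    intro H hH k j
    induction k with
    | zero => exact hFF0 j
    | succ k ih => rw [Function.iterate_succ_apply']; exact hstep H hH _ ih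
  refine hK Y hY hxY G hG fun C hC => hu C ?_
  refine InV_of_dd hf (h𝒴D hY) hxY C fun H hH k j => ?_
  rw [Function.iterate_succ_apply']
  exact (hFO _ (hiter H hH k j) H hH Y ⟨hY, hYO⟩ hxY).2 G ⟨hG, hGO⟩ C hC

theorem arc_zero (m : ℂ → ℂ) (hm : DifferentiableOn ℂ m (Metric.ball 0 1)) (M : ℝ) (hM : ∀ ζ ∈ Metric.ball (0:ℂ) 1, ‖m ζ‖ ≤ M)
    (G : Set ℂ) (hG : IsOpen G) (h1 : (1:ℂ) ∈ G) (hlim : ∀ ξ ∈ G, ‖ξ‖ = 1 → Filter.Tendsto m (nhdsWithin ξ (Metric.ball 0 1)) (nhds 0)) : m 0 = 0 := by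
  classical
  let V : Metric.sphere (0:ℂ) 1 → Set ℂ := fun u => {ξ | (u:ℂ) * ξ ∈ G}
  have hun : ∀ u : Metric.sphere (0:ℂ) 1, ‖(u:ℂ)‖ = 1 := fun u => by simpa using u.2
  obtain ⟨F, hF⟩ := (isCompact_sphere (0:ℂ) 1).elim_finite_subcover V (fun u => hG.preimage (by fun_prop)) (by
    intro ξ hξ
    have hξ1 : ‖ξ‖ = 1 := by simpa using hξ
    rw [Set.mem_iUnion]
    refine ⟨⟨ξ⁻¹, by simp [hξ1]⟩, ?_⟩
    show ξ⁻¹ * ξ ∈ G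
    rw [inv_mul_cancel₀ (by rintro rfl; simp at hξ1)]; exact h1)
  have hrot : ∀ u : Metric.sphere (0:ℂ) 1, ∀ ζ ∈ Metric.ball (0:ℂ) 1, (u:ℂ) * ζ ∈ Metric.ball (0:ℂ) 1 := by
    intro u ζ hζ
    rw [mem_ball_zero_iff] at *
    rw [norm_mul, hun u, one_mul]; exact hζ
  let g0 : ℂ → ℂ := fun ζ => ∏ u ∈ F, m ((u:ℂ) * ζ)
  let g : ℂ → ℂ := fun ζ => if ζ ∈ Metric.ball (0:ℂ) 1 then g0 ζ else 0
  have hg0 : DifferentiableOn ℂ g0 (Metric.ball 0 1) := by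
    refine DifferentiableOn.fun_finsetProd fun u _ => ?_
    exact hm.comp (by fun_prop) (hrot u)
  have hgd : DifferentiableOn ℂ g (Metric.ball 0 1) := hg0.congr fun ζ hζ => by simp only [g, if_pos hζ]
  have hg0lim : ∀ ξ ∈ Metric.sphere (0:ℂ) 1, Filter.Tendsto g0 (nhdsWithin ξ (Metric.ball 0 1)) (nhds 0) := by
    intro ξ hξ
    obtain ⟨u, hu⟩ := Set.mem_iUnion.1 (hF hξ)
    obtain ⟨huF, hu⟩ := Set.mem_iUnion.1 hu
    have hξ1 : ‖ξ‖ = 1 := by simpa using hξ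
    have ht : Filter.Tendsto (fun ζ => m ((u:ℂ) * ζ)) (nhdsWithin ξ (Metric.ball 0 1)) (nhds 0) := by
      refine (hlim ((u:ℂ) * ξ) hu (by rw [norm_mul, hun u, hξ1, one_mul])).comp ?_
      refine tendsto_nhdsWithin_of_tendsto_nhds_of_eventually_within _ ?_ ?_
      · exact ((continuous_const.mul continuous_id : Continuous fun ζ : ℂ => (u:ℂ) * ζ).tendsto ξ).mono_left nhdsWithin_le_nhds
      · filter_upwards [self_mem_nhdsWithin] with ζ hζ using hrot u ζ hζ
    have hb : Filter.Tendsto (fun ζ => ‖m ((u:ℂ) * ζ)‖ * ∏ v ∈ F.erase u, M) (nhdsWithin ξ (Metric.ball 0 1)) (nhds 0) := by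
      simpa using ht.norm.mul_const (∏ v ∈ F.erase u, M)
    refine squeeze_zero_norm' ?_ hb
    filter_upwards [self_mem_nhdsWithin] with ζ hζ
    simp only [g0]
    rw [← Finset.mul_prod_erase F _ huF, norm_mul, norm_prod]
    gcongr with v hv
    exact hM _ (hrot v ζ hζ)
  have hgs : ∀ ξ ∈ Metric.sphere (0:ℂ) 1, g ξ = 0 := by
    intro ξ hξ
    simp only [g]
    rw [if_neg]
    have hξ1 : ‖ξ‖ = 1 := by simpa using hξ
    simp [hξ1]
  have hglim : ∀ ξ ∈ Metric.sphere (0:ℂ) 1, Filter.Tendsto g (nhds ξ) (nhds 0) := by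
    intro ξ hξ
    have := hg0lim ξ hξ
    exact Filter.Tendsto.if this tendsto_const_nhds
  have hgc : DiffContOnCl ℂ g (Metric.ball 0 1) := by
    refine ⟨hgd, fun ξ hξ => ?_⟩
    rw [closure_ball _ one_ne_zero] at hξ
    rcases (mem_closedBall_zero_iff.1 hξ).lt_or_eq with h | h
    · have hb : ξ ∈ Metric.ball (0:ℂ) 1 := mem_ball_zero_iff.2 h
      exact (hgd.continuousOn.continuousAt (Metric.isOpen_ball.mem_nhds hb)).continuousWithinAt
    · have hs : ξ ∈ Metric.sphere (0:ℂ) 1 := mem_sphere_zero_iff_norm.2 h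
      have := hglim ξ hs
      rw [← hgs ξ hs] at this
      exact ContinuousAt.continuousWithinAt this
  have hz := Complex.norm_le_of_forall_mem_frontier_norm_le (C := 0) Metric.isBounded_ball hgc (fun ξ hξ => by
    rw [frontier_ball _ one_ne_zero] at hξ
    rw [hgs ξ hξ, norm_zero]) (z := 0) (subset_closure (Metric.mem_ball_self one_pos))
  have : g 0 = 0 := by simpa using hz
  simp only [g, g0, if_pos (Metric.mem_ball_self one_pos), mul_zero, Finset.prod_const] at this
  exact eq_zero_of_pow_eq_zero this

/-- Harnack at 0, 1 in the disc of radius 2 for functions with positive real part -/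
theorem harnack_pos (g : ℂ → ℂ) (hg : DifferentiableOn ℂ g (Metric.ball 0 2)) (hpos : ∀ τ ∈ Metric.ball (0:ℂ) 2, 0 < (g τ).re) : ‖g 1‖ ≤ 3 * ‖g 0‖ := by
  have h0 : (0:ℂ) ∈ Metric.ball (0:ℂ) 2 := by simp
  have h1 : (1:ℂ) ∈ Metric.ball (0:ℂ) 2 := by simp
  set a := g 0 with ha
  have hare := hpos 0 h0
  have hden : ∀ w : ℂ, 0 < w.re → w + (starRingEnd ℂ) a ≠ 0 := by
    intro w hw h
    have := congrArg Complex.re h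
    simp at this
    linarith
  have hlt : ∀ w : ℂ, 0 < w.re → ‖w - a‖ < ‖w + (starRingEnd ℂ) a‖ := by
    intro w hw
    rw [Complex.norm_def, Complex.norm_def]
    refine Real.sqrt_lt_sqrt (Complex.normSq_nonneg _) ?_
    simp only [Complex.normSq_apply, Complex.sub_re, Complex.sub_im, Complex.add_re, Complex.add_im, Complex.conj_re, Complex.conj_im]
    nlinarith [mul_pos hw hare]
  let φ : ℂ → ℂ := fun τ => (g τ - a) / (g τ + (starRingEnd ℂ) a)
  have hφ : DifferentiableOn ℂ φ (Metric.ball 0 2) := by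
    refine DifferentiableOn.div (hg.sub_const _) (hg.add_const _) fun τ hτ => hden _ (hpos τ hτ)
  have hmaps : Set.MapsTo φ (Metric.ball 0 2) (Metric.ball (φ 0) 1) := by
    intro τ hτ
    have : φ 0 = 0 := by simp [φ, ha]
    rw [this, mem_ball_zero_iff]
    simp only [φ]
    rw [norm_div, div_lt_one (norm_pos_iff.2 (hden _ (hpos τ hτ)))]
    exact hlt _ (hpos τ hτ)
  have hs := Complex.dist_le_div_mul_dist_of_mapsTo_ball hφ (hmaps.mono_right Metric.ball_subset_closedBall) h1
  have h00 : φ 0 = 0 := by simp [φ, ha]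
  rw [h00, dist_zero_right, dist_zero_right, norm_one, mul_one] at hs
  simp only [φ] at hs
  rw [norm_div, div_le_iff₀ (norm_pos_iff.2 (hden _ (hpos 1 h1)))] at hs
  have t1 : ‖g 1 + (starRingEnd ℂ) a‖ ≤ ‖g 1‖ + ‖a‖ := (norm_add_le _ _).trans (by simp)
  have t2 : ‖g 1‖ - ‖a‖ ≤ ‖g 1 - a‖ := norm_sub_norm_le _ _
  linarith

theorem harnack (g : ℂ → ℂ) (hg : DifferentiableOn ℂ g (Metric.ball 0 2)) (hpos : ∀ τ ∈ Metric.ball (0:ℂ) 2, 0 ≤ (g τ).re) : ‖g 1‖ ≤ 3 * ‖g 0‖ := by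
  have key : ∀ η : ℝ, 0 < η → ‖g 1‖ ≤ 3 * ‖g 0‖ + 4 * η := by
    intro η hη
    have h := harnack_pos (fun τ => g τ + (η:ℂ)) (hg.add_const _) (fun τ hτ => by
      have := hpos τ hτ
      simp; linarith)
    have e1 : ‖g 0 + (η:ℂ)‖ ≤ ‖g 0‖ + η := (norm_add_le _ _).trans (by simp [abs_of_pos hη])
    have e2 : ‖g 1‖ ≤ ‖g 1 + (η:ℂ)‖ + η := by
      have := norm_sub_le (g 1 + (η:ℂ)) (η:ℂ)
      simpa [abs_of_pos hη] using this
    linarith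
  refine le_of_forall_pos_le_add fun ε hε => ?_
  have := key (ε/4) (by linarith)
  linarith

theorem nsq_add {n : ℕ} (a b : Fin n → ℂ) : nsq (a + b) = nsq a + nsq b + 2 * (a ⬝ᵥ star b).re := by
  simp only [nsq, dotProduct, Complex.re_sum, Finset.mul_sum, ← Finset.sum_add_distrib]
  refine Finset.sum_congr rfl fun i _ => ?_
  simp only [Pi.add_apply, Pi.star_apply, RCLike.star_def, ← Complex.normSq_eq_norm_sq, Complex.normSq_apply, Complex.add_re, Complex.add_im, Complex.mul_re, Complex.conj_re, Complex.conj_im]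
  ring

/-- `κ` -/
noncomputable def kap {p q : ℕ} (A : Fin p → ℂ) (B : Fin q → ℂ) (Z : Matrix (Fin p) (Fin q) ℂ) : Fin p → ℂ := star A - Z *ᵥ star B
/-- `ω` -/
noncomputable def omg {p q : ℕ} (G : Fin q → ℂ) (H : Fin p → ℂ) (Z : Matrix (Fin p) (Fin q) ℂ) : Fin q → ℂ := star G - star H ᵥ* Z
/-- the moving point -/
noncomputable def Phi {p q : ℕ} (A : Fin p → ℂ) (B G : Fin q → ℂ) (H : Fin p → ℂ) (Z : Matrix (Fin p) (Fin q) ℂ) (ζ : ℂ) : Matrix (Fin p) (Fin q) ℂ :=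
  Z + (ζ / ((A + ζ • star H) ⬝ᵥ kap A B Z)) • vecMulVec (kap A B Z) (omg G H Z)

theorem Phi_zero {p q : ℕ} (A : Fin p → ℂ) (B G : Fin q → ℂ) (H : Fin p → ℂ) (Z : Matrix (Fin p) (Fin q) ℂ) : Phi A B G H Z 0 = Z := by
  simp [Phi]

theorem Q_zeta {p q : ℕ} {A : Fin p → ℂ} {B G : Fin q → ℂ} {H : Fin p → ℂ} {Z : Matrix (Fin p) (Fin q) ℂ} (h1 : A ᵥ* Z = B) (h2 : Z *ᵥ G = H) (hs : nsq A - nsq B = nsq G - nsq H) (ζ : ℂ) :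
    nsq (A + ζ • star H) - nsq (B + ζ • star G) = (nsq A - nsq B) * (1 - ‖ζ‖^2) := by
  have e : A ⬝ᵥ H = B ⬝ᵥ G := by rw [← h1, ← h2, dotProduct_mulVec]
  rw [nsq_add, nsq_add, nsq_smul, nsq_smul, nsq_star, nsq_star, star_smul, star_smul, star_star, star_star, dotProduct_smul, dotProduct_smul, e]
  have : nsq G = nsq A - nsq B + nsq H := by linarith
  rw [this]; ring

theorem kap_row {p q : ℕ} {A : Fin p → ℂ} {B G : Fin q → ℂ} {H : Fin p → ℂ} {Z : Matrix (Fin p) (Fin q) ℂ} (h2 : Z *ᵥ G = H) (a : Fin p → ℂ) (ζ : ℂ) :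
    a ⬝ᵥ star (A + ζ • star H) - (a ᵥ* Z) ⬝ᵥ star (B + ζ • star G) = a ⬝ᵥ kap A B Z := by
  rw [kap, star_add, star_add, star_smul, star_smul, star_star, star_star, dotProduct_add, dotProduct_add, dotProduct_sub, dotProduct_smul, dotProduct_smul, ← dotProduct_mulVec,
    ← dotProduct_mulVec, h2]
  ring

theorem den_ne {p q : ℕ} {A : Fin p → ℂ} {B G : Fin q → ℂ} {H : Fin p → ℂ} {Z : Matrix (Fin p) (Fin q) ℂ} (hZ : Z ∈ typeIDomain p q) (h1 : A ᵥ* Z = B) (h2 : Z *ᵥ G = H) (hs : nsq A - nsq B = nsq G - nsq H) 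
    (hpos : nsq B < nsq A) (ζ : ℂ) (hζ : ‖ζ‖ < 1) : (A + ζ • star H) ⬝ᵥ kap A B Z ≠ 0 := by
  intro h
  rw [← kap_row h2 _ ζ, sub_eq_zero, ← nsq_eq_dot] at h
  have hQ := Q_zeta h1 h2 hs ζ
  have hQ' : 0 < (nsq A - nsq B) * (1 - ‖ζ‖^2) := mul_pos (by linarith) (by nlinarith [norm_nonneg ζ])
  have hcs := nsq_cs ((A + ζ • star H) ᵥ* Z) (star (B + ζ • star G))
  rw [← h, nsq_star, Complex.norm_real, Real.norm_eq_abs, sq_abs] at hcs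
  have hA : 0 < nsq (A + ζ • star H) := by have := nsq_nonneg (B + ζ • star G); linarith
  have hne : A + ζ • star H ≠ 0 := by intro h0; rw [h0, nsq_zero] at hA; exact lt_irrefl _ hA
  have hlt := (mem_dom_iff' Z).1 hZ _ hne
  have := nsq_nonneg (B + ζ • star G)
  nlinarith [nsq_nonneg ((A + ζ • star H) ᵥ* Z)]

theorem Phi_fib {p q : ℕ} {A : Fin p → ℂ} {B G : Fin q → ℂ} {H : Fin p → ℂ} {Z : Matrix (Fin p) (Fin q) ℂ} (h1 : A ᵥ* Z = B) (ζ : ℂ) (hden : (A + ζ • star H) ⬝ᵥ kap A B Z ≠ 0) : 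
    (A + ζ • star H) ᵥ* Phi A B G H Z ζ = B + ζ • star G := by
  rw [Phi, vecMul_add, vecMul_smul, vecMul_vecMulVec, smul_smul, div_mul_cancel₀ _ hden, add_vecMul, h1, smul_vecMul, omg, smul_sub]
  abel

theorem Phi_mem {p q : ℕ} {A : Fin p → ℂ} {B G : Fin q → ℂ} {H : Fin p → ℂ} {Z : Matrix (Fin p) (Fin q) ℂ} (hZ : Z ∈ typeIDomain p q) (h1 : A ᵥ* Z = B) (h2 : Z *ᵥ G = H) (hs : nsq A - nsq B = nsq G - nsq H) 
    (hpos : nsq B < nsq A) (ζ : ℂ) (hζ : ‖ζ‖ < 1) : Phi A B G H Z ζ ∈ typeIDomain p q := by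
  have hden := den_ne hZ h1 h2 hs hpos ζ hζ
  have hfib := Phi_fib (G := G) h1 ζ hden
  rw [mem_dom_iff']
  intro a ha
  set x := A + ζ • star H with hx
  set y := B + ζ • star G with hy
  have hQ := Q_zeta h1 h2 hs ζ
  rw [← hx, ← hy] at hQ
  have hQ' : 0 < nsq x - nsq y := by rw [hQ]; exact mul_pos (by linarith) (by nlinarith [norm_nonneg ζ])
  let t := a ⬝ᵥ kap A B Z / (x ⬝ᵥ kap A B Z)
  let a2 := a - t • x
  have ha2 : a2 ⬝ᵥ kap A B Z = 0 := by
    simp only [a2, t]; rw [sub_dotProduct, smul_dotProduct, smul_eq_mul, div_mul_cancel₀ _ hden, sub_self]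
  have ea : a = a2 + t • x := by simp [a2]
  have ea2 : a2 ᵥ* Phi A B G H Z ζ = a2 ᵥ* Z := by
    rw [Phi, vecMul_add, vecMul_smul, vecMul_vecMulVec, ha2, zero_smul, smul_zero, add_zero]
  have hc := kap_row (A := A) (B := B) h2 a2 ζ
  rw [← hx, ← hy, ha2, sub_eq_zero] at hc
  have e1 : nsq a = nsq a2 + ‖t‖^2 * nsq x + 2 * (a2 ⬝ᵥ star (t • x)).re := by
    conv_lhs => rw [ea]
    rw [nsq_add, nsq_smul]
  have e2 : nsq (a ᵥ* Phi A B G H Z ζ) = nsq (a2 ᵥ* Z) + ‖t‖^2 * nsq y + 2 * (a2 ⬝ᵥ star (t • x)).re := by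
    conv_lhs => rw [ea]
    rw [add_vecMul, smul_vecMul, hfib, ea2, nsq_add, nsq_smul, star_smul, star_smul, dotProduct_smul, dotProduct_smul, hc]
  rw [e1, e2]
  by_cases h0 : a2 = 0
  · have ht : t ≠ 0 := by
      intro ht; rw [h0, ht] at ea; simp at ea; exact ha ea
    rw [h0]; simp only [zero_vecMul, nsq_zero, zero_dotProduct]
    have : 0 < ‖t‖^2 := by positivity
    nlinarith
  · have := (mem_dom_iff' Z).1 hZ a2 h0
    nlinarith [sq_nonneg ‖t‖]

theorem Phi_diff {p q : ℕ} {A : Fin p → ℂ} {B G : Fin q → ℂ} {H : Fin p → ℂ} {S : Set ℂ} {Zt : ℂ → Matrix (Fin p) (Fin q) ℂ} {ζt : ℂ → ℂ} (hZ : DifferentiableOn ℂ Zt S) (hζ : DifferentiableOn ℂ ζt S)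
    (hden : ∀ τ ∈ S, (A + ζt τ • star H) ⬝ᵥ kap A B (Zt τ) ≠ 0) : DifferentiableOn ℂ (fun τ => Phi A B G H (Zt τ) (ζt τ)) S := by
  have hZe : ∀ i j, DifferentiableOn ℂ (fun τ => Zt τ i j) S := fun i j => differentiableOn_pi.1 (differentiableOn_pi.1 hZ i) j
  have hk : ∀ i, DifferentiableOn ℂ (fun τ => kap A B (Zt τ) i) S := by
    intro i
    simp only [kap, Pi.sub_apply, mulVec, dotProduct]
    exact (differentiableOn_const _).fun_sub (DifferentiableOn.fun_sum fun j _ => (hZe i j).fun_mul (differentiableOn_const _))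
  have ho : ∀ j, DifferentiableOn ℂ (fun τ => omg G H (Zt τ) j) S := by
    intro i
    simp only [omg, Pi.sub_apply, vecMul, dotProduct]
    exact (differentiableOn_const _).fun_sub (DifferentiableOn.fun_sum fun j _ => (differentiableOn_const _).fun_mul (hZe j i))
  have hd : DifferentiableOn ℂ (fun τ => (A + ζt τ • star H) ⬝ᵥ kap A B (Zt τ)) S := by
    simp only [dotProduct]
    refine DifferentiableOn.fun_sum fun i _ => DifferentiableOn.fun_mul ?_ (hk i)
    simp only [Pi.add_apply, Pi.smul_apply, smul_eq_mul]
    exact (differentiableOn_const _).fun_add (hζ.fun_mul (differentiableOn_const _))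
  refine differentiableOn_pi.2 fun i => differentiableOn_pi.2 fun j => ?_
  have : ∀ τ, Phi A B G H (Zt τ) (ζt τ) i j = Zt τ i j + (ζt τ / ((A + ζt τ • star H) ⬝ᵥ kap A B (Zt τ))) * (kap A B (Zt τ) i * omg G H (Zt τ) j) := by
    intro τ; simp [Phi, vecMulVec_apply]
  simp only [this]
  exact (hZe i j).fun_add ((hζ.fun_div hd hden).fun_mul ((hk i).fun_mul (ho j)))

theorem span_ann {p q p' q' : ℕ} {f : Matrix (Fin p) (Fin q) ℂ → Matrix (Fin p') (Fin q') ℂ} (hf : DifferentiableOn ℂ f (typeIDomain p q)) {x : PX p q}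
    {Y : Matrix (Fin p) (Fin q) ℂ} {G : Fin q → ℂ} (hY : Y ∈ typeIDomain p q) (hxY : x.1 ᵥ* Y = x.2) (C : Fin p' → ℂ)
    (h : ∀ H : Matrix (Fin p) (Fin q) ℂ, x.1 ᵥ* H = 0 → H *ᵥ G = 0 → (∀ τ ∈ Metric.ball (0:ℂ) 2, Y + τ • H ∈ typeIDomain p q) → ∀ j, C ⬝ᵥ (fcol f j (Y + H) - fcol f j Y) = 0) :
    C ∈ KK f x Y G := by
  intro Y' hY' hx' hG'
  ext j
  have hH1 : x.1 ᵥ* (Y' - Y) = 0 := by rw [vecMul_sub, hxY, hx', sub_self]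
  have hH2 : (Y' - Y) *ᵥ G = 0 := by rw [sub_mulVec, hG', sub_self]
  have hev : ∀ᶠ τ : ℂ in nhds 0, dotL C (fcol f j (Y + τ • (Y' - Y))) = dotL C (fcol f j Y) := by
    obtain ⟨δ, hδ, hb⟩ := Metric.eventually_nhds_iff_ball.1 (line_near (dom_open p q) hY (Y' - Y))
    filter_upwards [Metric.ball_mem_nhds (0:ℂ) (half_pos hδ)] with τ hτ
    have := h (τ • (Y' - Y)) (by rw [vecMul_smul, hH1, smul_zero]) (by rw [smul_mulVec, hH2, smul_zero]) (by
      intro σ hσ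
      rw [smul_smul]
      refine hb _ ?_
      rw [mem_ball_zero_iff] at *
      rw [norm_mul]
      have := mul_lt_mul'' hσ hτ (norm_nonneg _) (norm_nonneg _)
      linarith) j
    rw [dotProduct_sub, sub_eq_zero] at this
    exact this
  have := taylor_to (dom_open p q) (fcol_diff hf j) (dotL C) Y (Y' - Y) hY (dom_star hY) (fun k hk => taylor_from (dom_open p q) (fcol_diff hf j) (dotL C) Y (Y' - Y) hY hev k hk) 1 (by
    rw [one_smul, add_sub_cancel]; exact hY')
  rw [one_smul, add_sub_cancel] at this
  exact this

theorem bdry_not_mem {p q p' q' : ℕ} {f : Matrix (Fin p) (Fin q) ℂ → Matrix (Fin p') (Fin q') ℂ} (hfp : ProperOn f (typeIDomain p q) (typeIDomain p' q'))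
    {X : Type*} (𝒰 : Ultrafilter X) (Zt : X → Matrix (Fin p) (Fin q) ℂ) (At : X → (Fin p → ℂ)) (Bt : X → (Fin q → ℂ)) {A : Fin p → ℂ} {B : Fin q → ℂ} 
    (hZ : ∀ᶠ y in (𝒰 : Filter X), Zt y ∈ typeIDomain p q) (hAB : ∀ᶠ y in (𝒰 : Filter X), At y ᵥ* Zt y = Bt y) (hA : Filter.Tendsto At 𝒰 (nhds A)) (hB : Filter.Tendsto Bt 𝒰 (nhds B))
    (hA0 : A ≠ 0) (hnull : nsq A = nsq B) {W : Matrix (Fin p') (Fin q') ℂ} (hW : Filter.Tendsto (fun y => f (Zt y)) 𝒰 (nhds W)) : W ∉ typeIDomain p' q' := by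
  intro hWD
  haveI : LocallyCompactSpace (Matrix (Fin p') (Fin q') ℂ) := inferInstanceAs (LocallyCompactSpace (Fin p' → Fin q' → ℂ))
  obtain ⟨K, hK, hWK, hKD⟩ := exists_compact_subset (dom_open p' q') hWD
  have hcomp := hfp.2 K hKD hK
  have hev : ∀ᶠ y in (𝒰 : Filter X), Zt y ∈ typeIDomain p q ∩ f ⁻¹' K := by
    filter_upwards [hZ, hW.eventually (mem_interior_iff_mem_nhds.1 hWK)] with y h1 h2 using ⟨h1, h2⟩
  obtain ⟨Zl, hZl, hlim⟩ := hcomp.ultrafilter_le_nhds (𝒰.map Zt) (by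
    rw [Filter.le_principal_iff]; exact hev)
  have hlim' : Filter.Tendsto Zt 𝒰 (nhds Zl) := hlim
  have h1 := tendsto_vecMul hlim' hA
  have h2 : A ᵥ* Zl = B := tendsto_nhds_unique_of_eventuallyEq h1 hB hAB
  have h3 := (mem_dom_iff' _).1 hZl.1 A hA0
  rw [h2, hnull] at h3
  exact lt_irrefl _ h3

theorem lim_contr {p q : ℕ} {X : Type*} {l : Filter X} [l.NeBot] {Wt : X → Matrix (Fin p) (Fin q) ℂ} {W : Matrix (Fin p) (Fin q) ℂ} (hW : Filter.Tendsto Wt l (nhds W)) 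
    (h : ∀ᶠ y in l, Wt y ∈ typeIDomain p q) : (∀ v, nsq (W *ᵥ v) ≤ nsq v) ∧ ∀ a, nsq (a ᵥ* W) ≤ nsq a := by
  constructor
  · intro v
    have h1 := (nsq_continuous.tendsto (W *ᵥ v)).comp (tendsto_mulVec hW (tendsto_const_nhds (x := v)))
    refine le_of_tendsto h1 ?_
    filter_upwards [h] with y hy
    by_cases hv : v = 0
    · simp [hv]
    · exact ((mem_dom_iff _).1 hy v hv).le
  · intro v
    have h1 := (nsq_continuous.tendsto (v ᵥ* W)).comp (tendsto_vecMul hW (tendsto_const_nhds (x := v)))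
    refine le_of_tendsto h1 ?_
    filter_upwards [h] with y hy
    by_cases hv : v = 0
    · simp [hv]
    · exact ((mem_dom_iff' _).1 hy v hv).le

theorem exists_ec {p q : ℕ} {W : Matrix (Fin p) (Fin q) ℂ} (h1 : ∀ v, nsq (W *ᵥ v) ≤ nsq v) (h2 : W ∉ typeIDomain p q) : ∃ e : Fin q → ℂ, e ≠ 0 ∧ nsq (W *ᵥ e) = nsq e := by
  rw [mem_dom_iff] at h2
  push Not at h2
  obtain ⟨e, he, h⟩ := h2
  exact ⟨e, he, le_antisymm (h1 e) h⟩

theorem rigid_row {p q : ℕ} {W : Matrix (Fin p) (Fin q) ℂ} (h2 : ∀ a, nsq (a ᵥ* W) ≤ nsq a) (e : Fin q → ℂ) (c : Fin p → ℂ) (hce : nsq c = nsq e) (h : c ⬝ᵥ (W *ᵥ e) = (nsq e : ℝ)) : c ᵥ* W = star e := by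
  have h3 : nsq (c ᵥ* W + (-star e)) ≤ 0 := by
    rw [nsq_add]
    have e1 : nsq (-star e) = nsq e := by simp [nsq]
    have e2 : (c ᵥ* W) ⬝ᵥ star (-star e) = -((nsq e : ℝ) : ℂ) := by
      rw [star_neg, star_star, dotProduct_neg, ← dotProduct_mulVec, h]
    rw [e1, e2]
    have := h2 c
    simp
    linarith
  have h4 := nsq_eq_zero.1 (le_antisymm h3 (nsq_nonneg _))
  rwa [add_neg_eq_zero] at h4

theorem harn_lim {p q : ℕ} {X : Type*} {l : Filter X} [l.NeBot] (u : X → ℂ → Matrix (Fin p) (Fin q) ℂ) {W W1 : Matrix (Fin p) (Fin q) ℂ}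
    (hu : ∀ᶠ y in l, DifferentiableOn ℂ (u y) (Metric.ball 0 2) ∧ ∀ τ ∈ Metric.ball (0:ℂ) 2, u y τ ∈ typeIDomain p q)
    (h0 : Filter.Tendsto (fun y => u y 0) l (nhds W)) (h1 : Filter.Tendsto (fun y => u y 1) l (nhds W1))
    (e : Fin q → ℂ) (he : nsq (W *ᵥ e) = nsq e) : star (W *ᵥ e) ᵥ* W1 = star e := by
  set c := star (W *ᵥ e) with hc
  have hce : nsq c = nsq e := by rw [hc, nsq_star, he]
  have h11 : (1:ℂ) ∈ Metric.ball (0:ℂ) 2 := by simp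
  refine rigid_row (lim_contr h1 (hu.mono fun y hy => hy.2 1 h11)).2 e c hce ?_
  have t : ∀ (V : X → Matrix (Fin p) (Fin q) ℂ) (V0 : Matrix (Fin p) (Fin q) ℂ), Filter.Tendsto V l (nhds V0) → Filter.Tendsto (fun y => ‖((nsq e : ℝ) : ℂ) - c ⬝ᵥ (V y *ᵥ e)‖) l (nhds ‖((nsq e : ℝ) : ℂ) - c ⬝ᵥ (V0 *ᵥ e)‖) := by
    intro V V0 hV
    have h := tendsto_mulVec hV (tendsto_const_nhds (x := e))
    have h2 := ((continuous_const.dotProduct continuous_id : Continuous fun g : Fin p → ℂ => c ⬝ᵥ g).tendsto (V0 *ᵥ e)).comp h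
    exact (h2.const_sub _).norm
  have hle := le_of_tendsto_of_tendsto (t _ _ h1) ((t _ _ h0).const_mul 3) (by
    filter_upwards [hu] with y hy
    refine harnack (fun τ => ((nsq e : ℝ) : ℂ) - c ⬝ᵥ (u y τ *ᵥ e)) ?_ ?_
    · refine (differentiableOn_const _).fun_sub ?_
      simp only [mulVec, dotProduct]
      refine DifferentiableOn.fun_sum fun i _ => (differentiableOn_const _).fun_mul (DifferentiableOn.fun_sum fun j _ => DifferentiableOn.fun_mul ?_ (differentiableOn_const _))
      exact differentiableOn_pi.1 (differentiableOn_pi.1 hy.1 i) j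
    · intro τ hτ
      have hcs := nsq_cs c (u y τ *ᵥ e)
      have hle : nsq (u y τ *ᵥ e) ≤ nsq e := by
        by_cases h0 : e = 0
        · simp [h0]
        · exact ((mem_dom_iff _).1 (hy.2 τ hτ) e h0).le
      rw [hce] at hcs
      have h5 : ‖c ⬝ᵥ (u y τ *ᵥ e)‖ ^ 2 ≤ nsq e ^ 2 := hcs.trans (by nlinarith [nsq_nonneg e])
      have h6 := abs_le_of_sq_le_sq h5 (nsq_nonneg e)
      have h7 := Complex.re_le_norm (c ⬝ᵥ (u y τ *ᵥ e))
      simp only [Complex.sub_re, Complex.ofReal_re]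
      linarith [(le_abs_self _).trans h6])
  have hz : ((nsq e : ℝ) : ℂ) - c ⬝ᵥ (W *ᵥ e) = 0 := by
    rw [hc, dotProduct_comm, ← nsq_eq_dot, he, sub_self]
  rw [hz, norm_zero, mul_zero] at hle
  have := norm_le_zero_iff.1 hle
  rw [sub_eq_zero] at this
  exact this.symm

theorem exists_lim {p q : ℕ} {X : Type*} (𝒰 : Ultrafilter X) (Wt : X → Matrix (Fin p) (Fin q) ℂ) (h : ∀ᶠ y in (𝒰 : Filter X), Wt y ∈ typeIDomain p q) :
    ∃ W, Filter.Tendsto Wt 𝒰 (nhds W) := by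
  have : ∀ i j, ∃ w : ℂ, Filter.Tendsto (fun y => Wt y i j) 𝒰 (nhds w) := by
    intro i j
    obtain ⟨w, _, hw⟩ := (isCompact_closedBall (0:ℂ) 1).ultrafilter_le_nhds (𝒰.map fun y => Wt y i j) (by
      rw [Filter.le_principal_iff]
      show ∀ᶠ y in (𝒰 : Filter X), Wt y i j ∈ Metric.closedBall (0:ℂ) 1
      filter_upwards [h] with y hy
      rw [mem_closedBall_zero_iff]; exact dom_entry hy i j)
    exact ⟨w, hw⟩
  choose w hw using this
  exact ⟨Matrix.of w, tendsto_mat hw⟩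

theorem det_bound {n : ℕ} (M : Matrix (Fin n) (Fin n) ℂ) (b : ℝ) (h : ∀ i j, ‖M i j‖ ≤ b) : ‖M.det‖ ≤ Nat.factorial n • b ^ n := by
  have := Matrix.det_le (abv := NormedField.toAbsoluteValue ℂ) (A := M) (x := b) h
  rw [Fintype.card_fin] at this
  exact this

theorem det_diff {n : ℕ} {S : Set ℂ} (M : ℂ → Matrix (Fin n) (Fin n) ℂ) (h : ∀ i j, DifferentiableOn ℂ (fun ζ => M ζ i j) S) : DifferentiableOn ℂ (fun ζ => (M ζ).det) S := by
  simp only [Matrix.det_apply']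
  exact DifferentiableOn.fun_sum fun σ _ => (differentiableOn_const _).fun_mul (DifferentiableOn.fun_finsetProd fun i _ => h _ _)

theorem det_tendsto {n : ℕ} {X : Type*} {l : Filter X} (M : X → Matrix (Fin n) (Fin n) ℂ) (M0 : Matrix (Fin n) (Fin n) ℂ) (h : ∀ i j, Filter.Tendsto (fun ζ => M ζ i j) l (nhds (M0 i j))) : 
    Filter.Tendsto (fun ζ => (M ζ).det) l (nhds M0.det) := by
  simp only [Matrix.det_apply']
  exact tendsto_finsetSum _ fun σ _ => tendsto_const_nhds.mul (tendsto_finsetProd _ fun i _ => h _ _)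

theorem exists_y {p q : ℕ} (k : Fin p) (c π1 : Fin p → ℂ) (π2 e : Fin q → ℂ) (W : Matrix (Fin p) (Fin q) ℂ) (hc0 : c ≠ 0) (hce : nsq c = nsq e) (hc : c ᵥ* W = star e) (hπ : π1 ᵥ* W = π2) (hlt : nsq π2 < nsq π1) :
    ∃ y : Fin p → ℂ, y ≠ 0 ∧ y k = 0 ∧ ∃ a b : ℂ, y = a • c + b • π1 := by
  by_cases hk : c k = 0
  · exact ⟨c, hc0, hk, 1, 0, by simp⟩
  · refine ⟨(-(π1 k / c k)) • c + (1:ℂ) • π1, ?_, ?_, _, _, rfl⟩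
    · intro h
      have h1 : π1 = (π1 k / c k) • c := by
        rw [neg_smul, one_smul, neg_add_eq_zero] at h; exact h.symm
      have h2 : π2 = (π1 k / c k) • star e := by rw [← hπ, ← hc, ← smul_vecMul, ← h1]
      have h3 : nsq π1 = ‖π1 k / c k‖^2 * nsq c := by rw [← nsq_smul, ← h1]
      rw [h2, nsq_smul, nsq_star, h3, hce] at hlt
      exact lt_irrefl _ hlt
    · simp [hk]

theorem L1 {p q p' q' : ℕ} {f : Matrix (Fin p) (Fin q) ℂ → Matrix (Fin p') (Fin q') ℂ} (hf : DifferentiableOn ℂ f (typeIDomain p q)) (hfp : ProperOn f (typeIDomain p q) (typeIDomain p' q'))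
    (P1 : Fin p' → MvPolynomial (Fin (p+q)) ℂ) (P2 : Fin q' → MvPolynomial (Fin (p+q)) ℂ)
    (hP : ∀ A : Fin p → ℂ, ∀ Z ∈ typeIDomain p q, ev P1 (Fin.append A (A ᵥ* Z)) ᵥ* f Z = ev P2 (Fin.append A (A ᵥ* Z)))
    (x : PX p q) (Y : Matrix (Fin p) (Fin q) ℂ) (G : Fin q → ℂ) (hY : Y ∈ typeIDomain p q) (hxY : x.1 ᵥ* Y = x.2) (hs : nsq x.1 - nsq x.2 = nsq G - nsq (Y *ᵥ G)) (hpos : nsq x.2 < nsq x.1)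
    (hb0 : x.1 + star (Y *ᵥ G) ≠ 0) (hb : nsq (ev P2 (Fin.append (x.1 + star (Y *ᵥ G)) (x.2 + star G))) < nsq (ev P1 (Fin.append (x.1 + star (Y *ᵥ G)) (x.2 + star G))))
    (C0 : Fin p' → ℂ) (hC0 : C0 ≠ 0) : ¬ ∀ C ∈ KK f x Y G, ∃ c : ℂ, C = c • C0 := by
  intro hK
  obtain ⟨k, hk⟩ : ∃ k, C0 k ≠ 0 := Function.ne_iff.1 hC0
  set H := Y *ᵥ G with hH
  let J := {N : Matrix (Fin p) (Fin q) ℂ // x.1 ᵥ* N = 0 ∧ N *ᵥ G = 0 ∧ ∀ τ ∈ Metric.ball (0:ℂ) 2, Y + τ • N ∈ typeIDomain p q} × Fin q'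
  have h11 : (1:ℂ) ∈ Metric.ball (0:ℂ) 2 := by simp
  obtain ⟨s, hdet⟩ := exists_det_of_ann_opt (fun N : J => fcol f N.2 (Y + N.1.1) - fcol f N.2 Y) C0 k hk (by
    intro C hC
    refine hK C (span_ann hf hY hxY C fun N h1 h2 h3 j => hC (⟨N, h1, h2, h3⟩, j)))
  -- properties of points
  have hpt : ∀ (N : {N : Matrix (Fin p) (Fin q) ℂ // x.1 ᵥ* N = 0 ∧ N *ᵥ G = 0 ∧ ∀ τ ∈ Metric.ball (0:ℂ) 2, Y + τ • N ∈ typeIDomain p q}) (τ : ℂ), τ ∈ Metric.ball (0:ℂ) 2 →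
      Y + τ • N.1 ∈ typeIDomain p q ∧ x.1 ᵥ* (Y + τ • N.1) = x.2 ∧ (Y + τ • N.1) *ᵥ G = H := by
    intro N τ hτ
    refine ⟨N.2.2.2 τ hτ, ?_, ?_⟩
    · rw [vecMul_add, vecMul_smul, N.2.1, hxY]; simp
    · rw [add_mulVec, smul_mulVec, N.2.2.1, hH]; simp
  let Ψ : Matrix (Fin p) (Fin q) ℂ → ℂ → Matrix (Fin p) (Fin q) ℂ := fun Z ζ => Phi x.1 x.2 G H Z ζ
  have hΨm : ∀ Z ∈ typeIDomain p q, x.1 ᵥ* Z = x.2 → Z *ᵥ G = H → ∀ ζ ∈ Metric.ball (0:ℂ) 1, Ψ Z ζ ∈ typeIDomain p q := by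
    intro Z h1 h2 h3 ζ hζ
    exact Phi_mem h1 h2 h3 hs hpos ζ (mem_ball_zero_iff.1 hζ)
  have hΨd : ∀ Z ∈ typeIDomain p q, x.1 ᵥ* Z = x.2 → Z *ᵥ G = H → DifferentiableOn ℂ (fun ζ => f (Ψ Z ζ)) (Metric.ball 0 1) := by
    intro Z h1 h2 h3
    refine hf.comp (Phi_diff (Zt := fun _ => Z) (ζt := fun ζ => ζ) (differentiableOn_const _) differentiableOn_id fun ζ hζ => den_ne h1 h2 h3 hs hpos ζ (mem_ball_zero_iff.1 hζ)) (hΨm Z h1 h2 h3)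
  have hZ1 : ∀ N : {N : Matrix (Fin p) (Fin q) ℂ // x.1 ᵥ* N = 0 ∧ N *ᵥ G = 0 ∧ ∀ τ ∈ Metric.ball (0:ℂ) 2, Y + τ • N ∈ typeIDomain p q}, Y + N.1 ∈ typeIDomain p q ∧ x.1 ᵥ* (Y + N.1) = x.2 ∧ (Y + N.1) *ᵥ G = H := by
    intro N
    have := hpt N 1 h11
    rwa [one_smul] at this
  let M : ℂ → Matrix (Fin p') (Fin p') ℂ := fun ζ => Matrix.of fun i => (s i).elim (Pi.single k 1) fun N => fcol f N.2 (Ψ (Y + N.1.1) ζ) - fcol f N.2 (Ψ Y ζ)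
  have hMsome : ∀ ζ i (N : J), s i = some N → ∀ i', M ζ i i' = f (Ψ (Y + N.1.1) ζ) i' N.2 - f (Ψ Y ζ) i' N.2 := by
    intro ζ i N h i'
    simp [M, h, fcol]
  have hMnone : ∀ ζ i, s i = none → ∀ i', M ζ i i' = (Pi.single k 1 : Fin p' → ℂ) i' := by
    intro ζ i h i'
    simp [M, h]
  have hm0 : (M 0).det ≠ 0 := by
    have : M 0 = Matrix.of fun i => (s i).elim (Pi.single k 1) fun N => fcol f N.2 (Y + N.1.1) - fcol f N.2 Y := by
      simp only [M, Ψ, Phi_zero]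
    rw [this]; exact hdet
  refine hm0 (arc_zero (fun ζ => (M ζ).det) ?_ (Nat.factorial p' • (2:ℝ) ^ p') ?_ 
    {ξ | x.1 + ξ • star H ≠ 0 ∧ nsq (ev P2 (Fin.append (x.1 + ξ • star H) (x.2 + ξ • star G))) < nsq (ev P1 (Fin.append (x.1 + ξ • star H) (x.2 + ξ • star G)))} ?_ ?_ ?_)
  · refine det_diff M fun i i' => ?_
    rcases hsi : s i with _ | N
    · simp only [hMnone _ i hsi]; exact differentiableOn_const _
    · simp only [hMsome _ i N hsi]
      have d1 := hΨd _ (hZ1 N.1).1 (hZ1 N.1).2.1 (hZ1 N.1).2.2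
      have d2 := hΨd Y hY hxY rfl
      exact (differentiableOn_pi.1 (differentiableOn_pi.1 d1 i') N.2).fun_sub (differentiableOn_pi.1 (differentiableOn_pi.1 d2 i') N.2)
  · intro ζ hζ
    refine det_bound _ _ fun i i' => ?_
    rcases hsi : s i with _ | N
    · rw [hMnone _ i hsi, Pi.single_apply]
      split_ifs <;> simp
    · rw [hMsome _ i N hsi]
      have d1 := dom_entry (hfp.1 (hΨm _ (hZ1 N.1).1 (hZ1 N.1).2.1 (hZ1 N.1).2.2 ζ hζ)) i' N.2
      have d2 := dom_entry (hfp.1 (hΨm Y hY hxY rfl ζ hζ)) i' N.2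
      exact (norm_sub_le _ _).trans (by linarith)
  · have c1 : Continuous fun ξ : ℂ => x.1 + ξ • star H := by fun_prop
    have c2 : Continuous fun ξ : ℂ => x.2 + ξ • star G := by fun_prop
    have c3 : Continuous fun ξ : ℂ => Fin.append (x.1 + ξ • star H) (x.2 + ξ • star G) := append_cont.comp (c1.prodMk c2)
    exact (isOpen_ne_fun c1 continuous_const).inter (isOpen_lt (nsq_continuous.comp ((ev_cont P2).comp c3)) (nsq_continuous.comp ((ev_cont P1).comp c3)))
  · simp only [Set.mem_setOf_eq, one_smul]; exact ⟨hb0, hb⟩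
  · rintro ξ ⟨hξ0, hξlt⟩ hξ1
    rw [Filter.tendsto_iff_ultrafilter]
    intro 𝒰 h𝒰
    have hball : ∀ᶠ ζ in (𝒰 : Filter ℂ), ζ ∈ Metric.ball (0:ℂ) 1 := h𝒰 self_mem_nhdsWithin
    have hid : Filter.Tendsto (fun ζ : ℂ => ζ) 𝒰 (nhds ξ) := h𝒰.trans nhdsWithin_le_nhds
    have hAl : Filter.Tendsto (fun ζ : ℂ => x.1 + ζ • star H) 𝒰 (nhds (x.1 + ξ • star H)) := (hid.smul_const _).const_add _
    have hBl : Filter.Tendsto (fun ζ : ℂ => x.2 + ζ • star G) 𝒰 (nhds (x.2 + ξ • star G)) := (hid.smul_const _).const_add _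
    have hABl : Filter.Tendsto (fun ζ : ℂ => Fin.append (x.1 + ζ • star H) (x.2 + ζ • star G)) 𝒰 (nhds (Fin.append (x.1 + ξ • star H) (x.2 + ξ • star G))) := 
      (append_cont.tendsto ((x.1 + ξ • star H), (x.2 + ξ • star G))).comp (hAl.prodMk_nhds hBl)
    have hfib : ∀ Z ∈ typeIDomain p q, x.1 ᵥ* Z = x.2 → Z *ᵥ G = H → ∀ ζ ∈ Metric.ball (0:ℂ) 1, (x.1 + ζ • star H) ᵥ* Ψ Z ζ = x.2 + ζ • star G := by
      intro Z h1 h2 h3 ζ hζ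
      exact Phi_fib h2 ζ (den_ne h1 h2 h3 hs hpos ζ (mem_ball_zero_iff.1 hζ))
    have hπ : ∀ Z ∈ typeIDomain p q, x.1 ᵥ* Z = x.2 → Z *ᵥ G = H → ∀ W, Filter.Tendsto (fun ζ => f (Ψ Z ζ)) 𝒰 (nhds W) → 
        ev P1 (Fin.append (x.1 + ξ • star H) (x.2 + ξ • star G)) ᵥ* W = ev P2 (Fin.append (x.1 + ξ • star H) (x.2 + ξ • star G)) := by
      intro Z h1 h2 h3 W hW
      have e1 := tendsto_vecMul hW (((ev_cont P1).tendsto _).comp hABl)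
      have e2 := ((ev_cont P2).tendsto _).comp hABl
      refine tendsto_nhds_unique_of_eventuallyEq e1 e2 ?_
      filter_upwards [hball] with ζ hζ
      have := hP (x.1 + ζ • star H) (Ψ Z ζ) (hΨm Z h1 h2 h3 ζ hζ)
      rw [hfib Z h1 h2 h3 ζ hζ] at this
      exact this
    have hWex : ∀ Z ∈ typeIDomain p q, x.1 ᵥ* Z = x.2 → Z *ᵥ G = H → ∃ W, Filter.Tendsto (fun ζ => f (Ψ Z ζ)) 𝒰 (nhds W) := by
      intro Z h1 h2 h3
      exact exists_lim 𝒰 _ (hball.mono fun ζ hζ => hfp.1 (hΨm Z h1 h2 h3 ζ hζ))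
    obtain ⟨W0, hW0⟩ := hWex Y hY hxY rfl
    have hnull : nsq (x.1 + ξ • star H) = nsq (x.2 + ξ • star G) := by
      have := Q_zeta hxY hH.symm hs ξ
      rw [hξ1] at this
      simp at this
      linarith
    have hW0D := bdry_not_mem hfp 𝒰 (fun ζ => Ψ Y ζ) _ _ (hball.mono fun ζ hζ => hΨm Y hY hxY rfl ζ hζ) (hball.mono fun ζ hζ => hfib Y hY hxY rfl ζ hζ) hAl hBl hξ0 hnull hW0
    obtain ⟨e, he0, he⟩ := exists_ec (lim_contr hW0 (hball.mono fun ζ hζ => hfp.1 (hΨm Y hY hxY rfl ζ hζ))).1 hW0D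
    have hcW0 : star (W0 *ᵥ e) ᵥ* W0 = star e := by
      refine harn_lim (fun ζ _ => f (Ψ Y ζ)) (hball.mono fun ζ hζ => ⟨differentiableOn_const _, fun τ _ => hfp.1 (hΨm Y hY hxY rfl ζ hζ)⟩) hW0 hW0 e he
    have hW1ex : ∀ N : J, ∃ W1, Filter.Tendsto (fun ζ => f (Ψ (Y + N.1.1) ζ)) 𝒰 (nhds W1) := fun N => hWex _ (hZ1 N.1).1 (hZ1 N.1).2.1 (hZ1 N.1).2.2
    choose W1 hW1 using hW1ex
    have hcW1 : ∀ N : J, star (W0 *ᵥ e) ᵥ* W1 N = star e := by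
      intro N
      refine harn_lim (fun ζ τ => f (Ψ (Y + τ • N.1.1) ζ)) (hball.mono fun ζ hζ => ⟨?_, fun τ hτ => hfp.1 (hΨm _ (hpt N.1 τ hτ).1 (hpt N.1 τ hτ).2.1 (hpt N.1 τ hτ).2.2 ζ hζ)⟩) (by simpa using hW0) (by simpa using hW1 N) e he
      refine hf.comp (Phi_diff (Zt := fun τ => Y + τ • N.1.1) (ζt := fun _ => ζ) (by fun_prop) (differentiableOn_const _) fun τ hτ => 
        den_ne (hpt N.1 τ hτ).1 (hpt N.1 τ hτ).2.1 (hpt N.1 τ hτ).2.2 hs hpos ζ (mem_ball_zero_iff.1 hζ)) (fun τ hτ => hΨm _ (hpt N.1 τ hτ).1 (hpt N.1 τ hτ).2.1 (hpt N.1 τ hτ).2.2 ζ hζ)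
    have hce : nsq (star (W0 *ᵥ e)) = nsq e := by rw [nsq_star, he]
    have hc0 : star (W0 *ᵥ e) ≠ 0 := by
      intro h; rw [h, nsq_zero] at hce; exact he0 (nsq_eq_zero.1 hce.symm)
    obtain ⟨y, hy0, hyk, a, b, hyab⟩ := exists_y k _ _ _ e W0 hc0 hce hcW0 (hπ Y hY hxY rfl W0 hW0) hξlt
    have hyW : ∀ N : J, y ᵥ* W1 N = y ᵥ* W0 := by
      intro N
      rw [hyab, add_vecMul, add_vecMul, smul_vecMul, smul_vecMul, smul_vecMul, smul_vecMul, hcW1 N, hcW0, hπ Y hY hxY rfl W0 hW0, hπ _ (hZ1 N.1).1 (hZ1 N.1).2.1 (hZ1 N.1).2.2 _ (hW1 N)]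
    let M0 : Matrix (Fin p') (Fin p') ℂ := Matrix.of fun i => (s i).elim (Pi.single k 1) fun N => fun i' => W1 N i' N.2 - W0 i' N.2
    have hM0 : M0.det = 0 := by
      rw [← Matrix.exists_mulVec_eq_zero_iff]
      refine ⟨y, hy0, ?_⟩
      ext i
      rcases hsi : s i with _ | N
      · have : M0 i = Pi.single k 1 := by ext i'; simp [M0, hsi]
        simp only [mulVec, this, single_dotProduct, hyk, mul_zero, Pi.zero_apply]
      · have : M0 i = fun i' => W1 N i' N.2 - W0 i' N.2 := by ext i'; simp [M0, hsi]
        simp only [mulVec, this, Pi.zero_apply]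
        have h5 := congrFun (hyW N) N.2
        rw [← sub_eq_zero] at h5
        refine Eq.trans ?_ h5
        simp only [vecMul, dotProduct, ← Finset.sum_sub_distrib]
        exact Finset.sum_congr rfl fun i' _ => by ring
    rw [← hM0]
    refine det_tendsto M M0 fun i i' => ?_
    rcases hsi : s i with _ | N
    · simp only [hMnone _ i hsi]
      have : M0 i i' = (Pi.single k 1 : Fin p' → ℂ) i' := by simp [M0, hsi]
      rw [this]; exact tendsto_const_nhds
    · simp only [hMsome _ i N hsi]
      have : M0 i i' = W1 N i' N.2 - W0 i' N.2 := by simp [M0, hsi]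
      rw [this]
      exact (tendsto_entry (hW1 N) i' N.2).sub (tendsto_entry hW0 i' N.2)

/-- the normalising factor -/
noncomputable def tfac {p q : ℕ} (x : PX p q) (Y : Matrix (Fin p) (Fin q) ℂ) (G : Fin q → ℂ) : ℂ := ((Real.sqrt ((nsq x.1 - nsq x.2) / (nsq G - nsq (Y *ᵥ G))) : ℝ) : ℂ)

theorem no_strict {p q p' q' : ℕ} (hpq : p' ≤ q) {f : Matrix (Fin p) (Fin q) ℂ → Matrix (Fin p') (Fin q') ℂ} (hf : DifferentiableOn ℂ f (typeIDomain p q)) (hfp : ProperOn f (typeIDomain p q) (typeIDomain p' q'))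
    (P1 : Fin p' → MvPolynomial (Fin (p+q)) ℂ) (P2 : Fin q' → MvPolynomial (Fin (p+q)) ℂ)
    (hP : ∀ A : Fin p → ℂ, ∀ Z ∈ typeIDomain p q, ev P1 (Fin.append A (A ᵥ* Z)) ᵥ* f Z = ev P2 (Fin.append A (A ᵥ* Z)))
    (U0 : Set (PX p q)) (hU0d : genBallCone p q ⊆ closure U0)
    (hU0u : ∀ x ∈ U0, ∃ C0 : Fin p' → ℂ, C0 ≠ 0 ∧ InV f x C0 ∧ ∀ C, InV f x C → ∃ c : ℂ, C = c • C0) 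
    (A0 : Fin p → ℂ) (B0 : Fin q → ℂ) (hA0 : A0 ≠ 0) (hnull : nsq A0 = nsq B0) (hb : nsq (ev P2 (Fin.append A0 B0)) < nsq (ev P1 (Fin.append A0 B0))) : False := by
  have hA0p := nsq_pos hA0
  have hB0 : B0 ≠ 0 := by rintro rfl; rw [nsq_zero] at hnull; linarith
  let x0 : PX p q := (A0, 0)
  let l : Filter (PX p q × (Matrix (Fin p) (Fin q) ℂ × (Fin q → ℂ))) := nhds x0 ×ˢ (nhds (0 : Matrix (Fin p) (Fin q) ℂ) ×ˢ nhds (star B0))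
  have tx : Filter.Tendsto (fun z : PX p q × (Matrix (Fin p) (Fin q) ℂ × (Fin q → ℂ)) => z.1) l (nhds x0) := Filter.tendsto_fst
  have tY : Filter.Tendsto (fun z : PX p q × (Matrix (Fin p) (Fin q) ℂ × (Fin q → ℂ)) => z.2.1) l (nhds 0) := Filter.tendsto_fst.comp Filter.tendsto_snd
  have tG : Filter.Tendsto (fun z : PX p q × (Matrix (Fin p) (Fin q) ℂ × (Fin q → ℂ)) => z.2.2) l (nhds (star B0)) := Filter.tendsto_snd.comp Filter.tendsto_snd
  have tA : Filter.Tendsto (fun z : PX p q × (Matrix (Fin p) (Fin q) ℂ × (Fin q → ℂ)) => z.1.1) l (nhds A0) := (continuous_fst.tendsto x0).comp tx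
  have tB : Filter.Tendsto (fun z : PX p q × (Matrix (Fin p) (Fin q) ℂ × (Fin q → ℂ)) => z.1.2) l (nhds 0) := (continuous_snd.tendsto x0).comp tx
  have tnA := (nsq_continuous.tendsto _).comp tA
  have tnB := (nsq_continuous.tendsto _).comp tB
  have tYG := tendsto_mulVec tY tG
  rw [zero_mulVec] at tYG
  have tnG := (nsq_continuous.tendsto _).comp tG
  have tnYG := (nsq_continuous.tendsto _).comp tYG
  rw [nsq_star] at tnG
  rw [nsq_zero] at tnB tnYG
  have tq := (tnA.sub tnB).div (tnG.sub tnYG) (by rw [sub_zero, ← hnull]; exact hA0p.ne')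
  rw [sub_zero, sub_zero, hnull, div_self (by rw [← hnull]; exact hA0p.ne')] at tq
  have tt0 := (Complex.continuous_ofReal.tendsto _).comp ((Real.continuous_sqrt.tendsto _).comp tq)
  rw [Real.sqrt_one, Complex.ofReal_one] at tt0
  have tt : Filter.Tendsto (fun z : PX p q × (Matrix (Fin p) (Fin q) ℂ × (Fin q → ℂ)) => tfac z.1 z.2.1 z.2.2) l (nhds 1) := tt0
  have ttG := tt.smul tG
  rw [one_smul] at ttG
  have tYtG := tendsto_mulVec tY ttG
  rw [zero_mulVec] at tYtG
  have tb1 := tA.add ((continuous_star.tendsto _).comp tYtG)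
  have tb2 := tB.add ((continuous_star.tendsto _).comp ttG)
  rw [star_zero, add_zero] at tb1
  rw [star_star, zero_add] at tb2
  have tb : Filter.Tendsto (fun z : PX p q × (Matrix (Fin p) (Fin q) ℂ × (Fin q → ℂ)) => Fin.append (z.1.1 + star (z.2.1 *ᵥ (tfac z.1 z.2.1 z.2.2 • z.2.2))) (z.1.2 + star (tfac z.1 z.2.1 z.2.2 • z.2.2))) l (nhds (Fin.append A0 B0)) :=
    (append_cont.tendsto (A0, B0)).comp (tb1.prodMk_nhds tb2)
  have tP1 := (nsq_continuous.tendsto _).comp (((ev_cont P1).tendsto _).comp tb)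
  have tP2 := (nsq_continuous.tendsto _).comp (((ev_cont P2).tendsto _).comp tb)
  have ev1 := tP2.eventually_lt tP1 hb
  have ev2 := tb1.eventually_ne hA0
  have ev3 := tY.eventually_mem ((dom_open p q).mem_nhds (zero_mem_dom p q))
  have ev4 := tG.eventually_ne (show star B0 ≠ 0 by simpa using hB0)
  have ev5 := tnB.eventually_lt tnA hA0p
  have hgood : ∀ᶠ z in l, (z.2.1 ∈ typeIDomain p q ∧ z.2.2 ≠ 0) ∧ nsq z.1.2 < nsq z.1.1 ∧ z.1.1 + star (z.2.1 *ᵥ (tfac z.1 z.2.1 z.2.2 • z.2.2)) ≠ 0 ∧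
      nsq (ev P2 (Fin.append (z.1.1 + star (z.2.1 *ᵥ (tfac z.1 z.2.1 z.2.2 • z.2.2))) (z.1.2 + star (tfac z.1 z.2.1 z.2.2 • z.2.2)))) < nsq (ev P1 (Fin.append (z.1.1 + star (z.2.1 *ᵥ (tfac z.1 z.2.1 z.2.2 • z.2.2))) (z.1.2 + star (tfac z.1 z.2.1 z.2.2 • z.2.2)))) := by
    filter_upwards [ev1, ev2, ev3, ev4, ev5] with z h1 h2 h3 h4 h5
    exact ⟨⟨h3, h4⟩, h5, h2, h1⟩
  obtain ⟨pa, hpa, pb, hpb, hab⟩ := Filter.eventually_prod_iff.1 hgood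
  obtain ⟨pY, hpY, pG, hpG, hYG⟩ := Filter.eventually_prod_iff.1 hpb
  obtain ⟨𝒴, h𝒴, h𝒴o, h𝒴0⟩ := mem_nhds_iff.1 hpY
  obtain ⟨𝒢, h𝒢, h𝒢o, h𝒢0⟩ := mem_nhds_iff.1 hpG
  have hd0 : x0.1 ⬝ᵥ star A0 ≠ 0 := by
    show A0 ⬝ᵥ star A0 ≠ 0
    rw [← nsq_eq_dot]; exact_mod_cast hA0p.ne'
  have hdo : IsOpen {x : PX p q | x.1 ⬝ᵥ star A0 ≠ 0} := isOpen_ne_fun (continuous_fst.dotProduct continuous_const) continuous_const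
  have hZd : Filter.Tendsto (Zd A0 0) (nhds x0) (nhds 0) := by
    have := (Zd_cont A0 (0 : Matrix (Fin p) (Fin q) ℂ)).continuousAt (hdo.mem_nhds hd0)
    have h2 := this.tendsto
    rw [Zd_self A0 0 x0 (by simp [x0])] at h2
    exact h2
  have hx0 : x0 ∈ closure U0 := hU0d (by rw [mem_cone]; simpa [x0] using hA0p)
  obtain ⟨x, ⟨hxa, hxd, hxZ⟩, hxU⟩ := mem_closure_iff_nhds.1 hx0 {x | pa x ∧ x.1 ⬝ᵥ star A0 ≠ 0 ∧ Zd A0 0 x ∈ 𝒴} (by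
    filter_upwards [hpa, hdo.mem_nhds hd0, hZd.eventually_mem (h𝒴o.mem_nhds h𝒴0)] with x h1 h2 h3 using ⟨h1, h2, h3⟩)
  obtain ⟨C0, hC0, hC0V, hC0u⟩ := hU0u x hxU
  have hall : ∀ Y ∈ 𝒴, ∀ G ∈ 𝒢, _ := fun Y hY G hG => hab hxa (hYG (h𝒴 hY) (h𝒢 hG))
  simp only at hall
  refine final_contra hpq hf hC0 hC0V hC0u h𝒴o (fun Y hY => (hall Y hY _ h𝒢0).1.1) h𝒢o (fun h0 => (hall _ h𝒴0 0 h0).1.2 rfl) hxZ (Zd_fib A0 0 x hxd) h𝒢0 ?_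
  intro Y hY hxY G hG hcon
  obtain ⟨⟨h1, h2⟩, h3, h4, h5⟩ := hall Y hY G hG
  have hGp : 0 < nsq G - nsq (Y *ᵥ G) := by have := (mem_dom_iff _).1 h1 G h2; linarith
  refine L1 hf hfp P1 P2 hP x Y (tfac x Y G • G) h1 hxY ?_ h3 h4 h5 C0 hC0 fun C hC => hcon C ?_
  · have e : ‖tfac x Y G‖^2 = (nsq x.1 - nsq x.2) / (nsq G - nsq (Y *ᵥ G)) := by
      rw [tfac, Complex.norm_real, Real.norm_eq_abs, sq_abs, Real.sq_sqrt (div_nonneg (by linarith) hGp.le)]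
    rw [mulVec_smul, nsq_smul, nsq_smul, e, ← mul_sub, div_mul_cancel₀ _ hGp.ne']
  · intro Y' g1 g2 g3
    exact hC Y' g1 g2 (by rw [mulVec_smul, mulVec_smul, g3])

theorem le_null {p q p' q' : ℕ} {f : Matrix (Fin p) (Fin q) ℂ → Matrix (Fin p') (Fin q') ℂ} (hfm : Set.MapsTo f (typeIDomain p q) (typeIDomain p' q'))
    (P1 : Fin p' → MvPolynomial (Fin (p+q)) ℂ) (P2 : Fin q' → MvPolynomial (Fin (p+q)) ℂ)
    (hP : ∀ A : Fin p → ℂ, ∀ Z ∈ typeIDomain p q, ev P1 (Fin.append A (A ᵥ* Z)) ᵥ* f Z = ev P2 (Fin.append A (A ᵥ* Z)))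
    (A0 : Fin p → ℂ) (B0 : Fin q → ℂ) (hA0 : A0 ≠ 0) (hnull : nsq A0 = nsq B0) : nsq (ev P2 (Fin.append A0 B0)) ≤ nsq (ev P1 (Fin.append A0 B0)) := by
  have hA0p := nsq_pos hA0
  have key : ∀ B, nsq B < nsq A0 → nsq (ev P2 (Fin.append A0 B)) ≤ nsq (ev P1 (Fin.append A0 B)) := by
    intro B hB
    obtain ⟨Z, hZ, hAZ⟩ := fiber_nonempty A0 B hB
    have h := hP A0 Z hZ
    rw [hAZ] at h
    rw [← h]
    by_cases h0 : ev P1 (Fin.append A0 B) = 0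
    · rw [h0]; simp
    · exact ((mem_dom_iff' _).1 (hfm hZ) _ h0).le
  have tr : Filter.Tendsto (fun r : ℝ => Fin.append A0 ((r:ℂ) • B0)) (nhdsWithin 1 (Set.Ioo 0 1)) (nhds (Fin.append A0 B0)) := by
    have hc : Continuous fun r : ℝ => Fin.append A0 ((r:ℂ) • B0) := append_cont.comp (continuous_const.prodMk (Complex.continuous_ofReal.smul continuous_const))
    have := hc.tendsto 1
    simp only [Complex.ofReal_one, one_smul] at this
    exact this.mono_left nhdsWithin_le_nhds
  haveI : (nhdsWithin (1:ℝ) (Set.Ioo 0 1)).NeBot := right_nhdsWithin_Ioo_neBot one_pos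
  refine le_of_tendsto_of_tendsto ((nsq_continuous.tendsto _).comp (((ev_cont P2).tendsto _).comp tr)) ((nsq_continuous.tendsto _).comp (((ev_cont P1).tendsto _).comp tr)) ?_
  filter_upwards [self_mem_nhdsWithin] with r hr
  refine key _ ?_
  rw [nsq_smul, ← hnull, Complex.norm_real, Real.norm_eq_abs, sq_abs]
  exact mul_lt_of_lt_one_left hA0p (by nlinarith [hr.1, hr.2])

/-- A proper holomorphic map `f : D^I_{p,q} → D^I_{p',q'}` (`p, q ≥ 2`) mapping every
`(p-1,q)`-subspace into a `(p'-1,q')`-subspace and a general `(p-1,q)`-subspace into a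
unique one admits a rational moduli map (a tuple of homogeneous polynomials of common
degree, not all zero) defined on a dense open subset of the cone over `D_{p,q}`;
if moreover `q ≥ p' ≥ 3`, this rational moduli map is proper, i.e. it sends the boundary
cone into the boundary cone. -/
theorem stmt_19 (p q p' q' : ℕ) (h0p' : 0 < p') (h0q' : 0 < q') (h2p : 2 ≤ p) (h2q : 2 ≤ q)
    (f : Matrix (Fin p) (Fin q) ℂ → Matrix (Fin p') (Fin q') ℂ)
    (hf : DifferentiableOn ℂ f (typeIDomain p q))
    (hfp : ProperOn f (typeIDomain p q) (typeIDomain p' q'))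
    (hfip : ∀ x ∈ genBallCone p q, ∃ y ∈ genBallCone p' q',
      ∀ Z ∈ typeIDomain p q, x.1 ᵥ* Z = x.2 → y.1 ᵥ* f Z = y.2)
    (U0 : Set ((Fin p → ℂ) × (Fin q → ℂ)))
    (hU0open : IsOpen U0) (hU0sub : U0 ⊆ genBallCone p q)
    (hU0dense : genBallCone p q ⊆ closure U0)
    (huniq : ∀ x ∈ U0, ∀ y ∈ genBallCone p' q', ∀ y' ∈ genBallCone p' q',
      (∀ Z ∈ typeIDomain p q, x.1 ᵥ* Z = x.2 → y.1 ᵥ* f Z = y.2) →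
      (∀ Z ∈ typeIDomain p q, x.1 ᵥ* Z = x.2 → y'.1 ᵥ* f Z = y'.2) →
      ∃ c : ℂ, c ≠ 0 ∧ y' = c • y) :
    ∃ (d : ℕ) (P1 : Fin p' → MvPolynomial (Fin (p + q)) ℂ)
      (P2 : Fin q' → MvPolynomial (Fin (p + q)) ℂ),
      (∀ i, (P1 i).IsHomogeneous d) ∧
      (∀ j, (P2 j).IsHomogeneous d) ∧
      ¬ ((∀ i, P1 i = 0) ∧ (∀ j, P2 j = 0)) ∧
      ∃ U : Set ((Fin p → ℂ) × (Fin q → ℂ)),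
        IsOpen U ∧ U ⊆ genBallCone p q ∧ genBallCone p q ⊆ closure U ∧
        (∀ x ∈ U,
          (¬ ((∀ i, MvPolynomial.eval (Fin.append x.1 x.2) (P1 i) = 0) ∧
              (∀ j, MvPolynomial.eval (Fin.append x.1 x.2) (P2 j) = 0))) ∧
          ((fun i => MvPolynomial.eval (Fin.append x.1 x.2) (P1 i)),
            (fun j => MvPolynomial.eval (Fin.append x.1 x.2) (P2 j)))
              ∈ genBallCone p' q' ∧
          ∀ Z ∈ typeIDomain p q, x.1 ᵥ* Z = x.2 →
            (fun i => MvPolynomial.eval (Fin.append x.1 x.2) (P1 i)) ᵥ* f Z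
              = fun j => MvPolynomial.eval (Fin.append x.1 x.2) (P2 j)) ∧
        (p' ≤ q → 3 ≤ p' →
          ∀ x : (Fin p → ℂ) × (Fin q → ℂ), x ≠ 0 →
            ∑ i, ‖x.1 i‖ ^ 2 = ∑ j, ‖x.2 j‖ ^ 2 →
            ¬ ((∀ i, MvPolynomial.eval (Fin.append x.1 x.2) (P1 i) = 0) ∧
               (∀ j, MvPolynomial.eval (Fin.append x.1 x.2) (P2 j) = 0)) →
            ∑ i, ‖MvPolynomial.eval (Fin.append x.1 x.2) (P1 i)‖ ^ 2
              = ∑ j, ‖MvPolynomial.eval (Fin.append x.1 x.2) (P2 j)‖ ^ 2) := by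
  have hfm := hfp.1
  have hV1 : ∀ x ∈ genBallCone p q, ∃ C : Fin p' → ℂ, C ≠ 0 ∧ InV f x C := by
    intro x hx
    obtain ⟨y, hy, h⟩ := hfip x hx
    exact ⟨y.1, nsq_smul_ne ((nsq_nonneg _).trans_lt hy),
      fun Z hZ Z' hZ' h1 h2 => by rw [h Z hZ h1, h Z' hZ' h2]⟩
  have hU0u : ∀ x ∈ U0, ∃ C0 : Fin p' → ℂ, C0 ≠ 0 ∧ InV f x C0 ∧
      ∀ C, InV f x C → ∃ c : ℂ, C = c • C0 := fun x hx =>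
    uniq_of hfm hfip x (hU0sub hx) (huniq x hx)
  obtain ⟨d, k, P1, P2, hk, hh1, hh2, hP⟩ := part1 h2p hf hV1 U0 hU0open hU0dense hU0u hU0sub
  obtain ⟨U, hUo, hUs, hUd, hU⟩ := part1_U hfm k P1 P2 hk hP
  refine ⟨d, P1, P2, hh1, hh2, fun h => hk (h.1 k), U, hUo, hUs, hUd, ?_, ?_⟩
  · intro x hx
    obtain ⟨h1, h2, h3⟩ := hU x hx
    exact ⟨fun h => h1 (funext h.1), h2, h3⟩
  · intro hpq _ x hx0 hnull _
    have hnull' : nsq x.1 = nsq x.2 := hnull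
    have hA0 : x.1 ≠ 0 := by
      intro h0
      rw [nsq_eq_zero.2 h0] at hnull'
      exact hx0 (Prod.ext h0 (nsq_eq_zero.1 hnull'.symm))
    have hle := le_null hfm P1 P2 hP x.1 x.2 hA0 hnull'
    have hge : nsq (ev P1 (Fin.append x.1 x.2)) ≤ nsq (ev P2 (Fin.append x.1 x.2)) := by
      by_contra hlt
      exact no_strict hpq hf hfp P1 P2 hP U0 hU0dense hU0u x.1 x.2 hA0 hnull' (not_le.1 hlt)
    exact le_antisymm hge hle
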